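/- Metric completeness: (𝓜, d_G) is a complete extended metric space. That is, d_G is an extended metric on 𝓜 (symmetric, satisfying the triangle inequality, definite, possibly taking the value ∞), and every sequence (γ_k) in 𝓜 that is Cauchy with respect to d_G converges with respect to d_G to some limit γ ∈ 𝓜. -/

import Mathlib

open MeasureTheory Real Filter Set
open scoped ENNReal Topology RealInnerProductSpace

noncomputable section

/-- Euclidean space `ℝⁿ`. -/
abbrev En (n : ℕ) : Type := EuclideanSpace ℝ (Fin n)

/-- A fundamental domain for the circle `𝕋 = ℝ/ℤ`. -/
def I01 : Set ℝ := Set.Ico (0 : ℝ) 1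

/-- The intrinsic distance on `𝕋 = ℝ/ℤ`, expressed for real representatives. -/
def dT (x y : ℝ) : ℝ := ⨅ k : ℤ, |x - y - (k : ℝ)|

/-- Supremum norm of a (periodic) function on the circle. -/
def supNorm {E : Type*} [NormedAddCommGroup E] (f : ℝ → E) : ℝ := ⨆ x : ℝ, ‖f x‖

/-- The squared Gagliardo seminorm `[v]_{H^σ}²` of a function on the circle, valued in `[0,∞]`. -/
def gagliardoSqE {E : Type*} [NormedAddCommGroup E] (σ : ℝ) (v : ℝ → E) : ℝ≥0∞ :=
  ∫⁻ x in I01, ∫⁻ y in I01, ENNReal.ofReal (‖v y - v x‖ ^ 2 / dT x y ^ (2 * σ + 1))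

/-- Membership in the Sobolev–Slobodeckij space `H^s(𝕋, ℝⁿ)`; for `s ∈ (3/2,2)` such
functions have a `C¹` representative, which we take as the defining data. -/
def InHs {n : ℕ} (s : ℝ) (u : ℝ → En n) : Prop :=
  Function.Periodic u 1 ∧ ContDiff ℝ 1 u ∧ gagliardoSqE (s - 1) (deriv u) < ⊤

/-- The squared `H^s` norm `‖u‖²_{L²} + ‖u'‖²_{L²} + [u']²_{H^{s-1}}`. -/
def HsNormSq {n : ℕ} (s : ℝ) (u : ℝ → En n) : ℝ :=
  (∫ x in I01, ‖u x‖ ^ 2) + (∫ x in I01, ‖deriv u x‖ ^ 2) +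
    (gagliardoSqE (s - 1) (deriv u)).toReal

/-- The `H^s` norm. -/
def HsNorm {n : ℕ} (s : ℝ) (u : ℝ → En n) : ℝ := Real.sqrt (HsNormSq s u)

/-- The `H^s` inner product. -/
def HsInner {n : ℕ} (s : ℝ) (u v : ℝ → En n) : ℝ :=
  (∫ x in I01, ⟪u x, v x⟫) + (∫ x in I01, ⟪deriv u x, deriv v x⟫) +
    ∫ x in I01, ∫ y in I01,
      ⟪deriv u y - deriv u x, deriv v y - deriv v x⟫ / dT x y ^ (2 * (s - 1) + 1)

/-- The manifold `𝓜` of embedded closed curves of class `H^s`: injective (on the circle)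
immersions. -/
def InM {n : ℕ} (s : ℝ) (γ : ℝ → En n) : Prop :=
  InHs s γ ∧ Set.InjOn γ I01 ∧ ∀ x, deriv γ x ≠ 0

/-- The length `L(γ)`. -/
def arcLen {n : ℕ} (γ : ℝ → En n) : ℝ := ∫ x in I01, ‖deriv γ x‖

/-- The arc-length distance `d_γ(x,y)`: the length of the shorter of the two arcs of `γ`
between `x` and `y`. -/
def arcDist {n : ℕ} (γ : ℝ → En n) (x y : ℝ) : ℝ :=
  ⨅ k : ℤ, |∫ t in x..(y + (k : ℝ)), ‖deriv γ t‖|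

/-- Derivative with respect to arc length, `D_γ u = u' / |γ'|`. -/
def Dg {n : ℕ} (γ u : ℝ → En n) (x : ℝ) : En n := ‖deriv γ x‖⁻¹ • deriv u x

/-- `𝒟_γ u (x)`, the pointwise linear map `w ↦ |γ'(x)|⁻² ⟪γ'(x), w⟫ u'(x)`. -/
def DDg {n : ℕ} (γ u : ℝ → En n) (x : ℝ) (w : En n) : En n :=
  ((‖deriv γ x‖ ^ 2)⁻¹ * ⟪deriv γ x, w⟫) • deriv u x

/-- The operator `R^s_γ`. -/
def Rop {n : ℕ} (s : ℝ) (γ u : ℝ → En n) (x y : ℝ) : En n :=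
  (‖γ y - γ x‖ ^ s)⁻¹ • (u y - u x - DDg γ u x (γ y - γ x))

/-- Density of the measure `μ_γ` with respect to `λ ⊗ λ` on `𝕋 × 𝕋`. -/
def muW {n : ℕ} (γ : ℝ → En n) (x y : ℝ) : ℝ :=
  ‖deriv γ x‖ * ‖deriv γ y‖ / ‖γ y - γ x‖

/-- Density of the measure `ν_γ` with respect to `λ ⊗ λ` on `𝕋 × 𝕋`. -/
def nuW {n : ℕ} (γ : ℝ → En n) (x y : ℝ) : ℝ :=
  ‖deriv γ x‖ * ‖deriv γ y‖ / arcDist γ x y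

/-- The tangent-point energy, valued in `[0,∞]`. -/
def EtpE {n : ℕ} (s : ℝ) (γ : ℝ → En n) : ℝ≥0∞ :=
  ∫⁻ x in I01, ∫⁻ y in I01, ENNReal.ofReal (‖Rop s γ γ x y‖ ^ 2 * muW γ x y)

/-- The tangent-point energy, real-valued (finite on `𝓜`). -/
def Etp {n : ℕ} (s : ℝ) (γ : ℝ → En n) : ℝ := (EtpE s γ).toReal

/-- `‖R^s_γ u‖²_{L²(ν_γ)}`, valued in `[0,∞]`. -/
def RnuSqE {n : ℕ} (s : ℝ) (γ u : ℝ → En n) : ℝ≥0∞ :=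
  ∫⁻ x in I01, ∫⁻ y in I01, ENNReal.ofReal (‖Rop s γ u x y‖ ^ 2 * nuW γ x y)

/-- `‖R^s_γ u‖²_{L²(ν_γ)}`, real-valued. -/
def RnuSq {n : ℕ} (s : ℝ) (γ u : ℝ → En n) : ℝ := (RnuSqE s γ u).toReal

/-- The squared `γ`-dependent seminorm `[u]²_{H^s(γ)}`, valued in `[0,∞]`. -/
def gagGammaSqE {n : ℕ} (s : ℝ) (γ u : ℝ → En n) : ℝ≥0∞ :=
  ∫⁻ x in I01, ∫⁻ y in I01,
    ENNReal.ofReal (‖Dg γ u y - Dg γ u x‖ ^ 2 / arcDist γ x y ^ (2 * (s - 1)) * nuW γ x y)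

/-- The squared `γ`-dependent seminorm `[u]²_{H^s(γ)}`, real-valued. -/
def gagGammaSq {n : ℕ} (s : ℝ) (γ u : ℝ → En n) : ℝ := (gagGammaSqE s γ u).toReal

/-- The inner product `⟨u,v⟩_{L²(γ)}`. -/
def innerL2g {n : ℕ} (γ u v : ℝ → En n) : ℝ := ∫ x in I01, ⟪u x, v x⟫ * ‖deriv γ x‖

/-- The inner product `⟨u,v⟩_{H¹(γ)}`. -/
def innerH1g {n : ℕ} (γ u v : ℝ → En n) : ℝ :=
  ∫ x in I01, ⟪Dg γ u x, Dg γ v x⟫ * ‖deriv γ x‖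

/-- The squared `γ`-dependent norm `‖u‖²_{H^s(γ)}`. -/
def HsGammaNormSq {n : ℕ} (s : ℝ) (γ u : ℝ → En n) : ℝ :=
  innerL2g γ u u + innerH1g γ u u + gagGammaSq s γ u

/-- The `γ`-dependent norm `‖u‖_{H^s(γ)}`. -/
def HsGammaNorm {n : ℕ} (s : ℝ) (γ u : ℝ → En n) : ℝ := Real.sqrt (HsGammaNormSq s γ u)

/-- The bilinear form `B¹_γ`. -/
def B1 {n : ℕ} (s : ℝ) (γ u v : ℝ → En n) : ℝ :=
  ∫ x in I01, ∫ y in I01, ⟪Rop s γ u x y, Rop s γ v x y⟫ * muW γ x y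

/-- The bilinear form `B²_γ`. -/
def B2 {n : ℕ} (s : ℝ) (γ u v : ℝ → En n) : ℝ :=
  ∫ x in I01, ∫ y in I01,
    ‖Rop s γ γ x y‖ ^ 2 * (⟪u y - u x, v y - v x⟫ / ‖γ y - γ x‖ ^ 2) * muW γ x y

/-- The bilinear form `B³_γ`. -/
def B3 {n : ℕ} (s : ℝ) (γ u v : ℝ → En n) : ℝ :=
  ∫ x in I01, ∫ y in I01,
    ‖Rop s γ γ x y‖ ^ 2 * (⟪Dg γ u x, Dg γ v x⟫ + ⟪Dg γ u y, Dg γ v y⟫) * muW γ x y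

/-- The Riemannian metric `G_γ(u,v)`. -/
def Gmet {n : ℕ} (s : ℝ) (γ u v : ℝ → En n) : ℝ :=
  2 * B1 s γ u v + (2 * s + 1) * B2 s γ u v + B3 s γ u v + innerH1g γ u v + innerL2g γ u v

/-- The distortion `distor(γ) = sup_{x ≠ y} d_γ(x,y)/|γ(y) − γ(x)|`, valued in `[0,∞]`. -/
def distorE {n : ℕ} (γ : ℝ → En n) : ℝ≥0∞ :=
  ⨆ (x ∈ I01) (y ∈ I01) (_ : x ≠ y), ENNReal.ofReal (arcDist γ x y / ‖γ y - γ x‖)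

/-- The distortion, real-valued. -/
def distor {n : ℕ} (γ : ℝ → En n) : ℝ := (distorE γ).toReal

/-- A `C¹` path `[0,1] → 𝓜 ⊂ H^s(𝕋,ℝⁿ)` (with respect to the `H^s` topology), recorded
together with its velocity field `V`. -/
structure C1Path (s : ℝ) (n : ℕ) where
  Γ : ℝ → ℝ → En n
  V : ℝ → ℝ → En n
  mem : ∀ t ∈ Set.Icc (0 : ℝ) 1, InM s (Γ t)
  memV : ∀ t ∈ Set.Icc (0 : ℝ) 1, InHs s (V t)
  isDeriv : ∀ t ∈ Set.Icc (0 : ℝ) 1,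
    Tendsto (fun h : ℝ => HsNorm s fun x => h⁻¹ • (Γ (t + h) x - Γ t x) - V t x)
      (𝓝[{h : ℝ | t + h ∈ Set.Icc (0 : ℝ) 1 ∧ h ≠ 0}] 0) (𝓝 0)
  contV : ∀ t ∈ Set.Icc (0 : ℝ) 1,
    Tendsto (fun τ : ℝ => HsNorm s fun x => V τ x - V t x) (𝓝[Set.Icc (0 : ℝ) 1] t) (𝓝 0)

/-- Length of a path with respect to `G`. -/
def pathLen {s : ℝ} {n : ℕ} (P : C1Path s n) : ℝ :=
  ∫ t in (0 : ℝ)..1, Real.sqrt (Gmet s (P.Γ t) (P.V t) (P.V t))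

/-- The path (Dirichlet) energy of a path with respect to `G`. -/
def pathEnergy {s : ℝ} {n : ℕ} (P : C1Path s n) : ℝ :=
  (1 / 2) * ∫ t in (0 : ℝ)..1, Gmet s (P.Γ t) (P.V t) (P.V t)

/-- The geodesic distance induced by `G`, valued in `[0,∞]` (`∞` if there is no path). -/
def geodDist (s : ℝ) {n : ℕ} (γ₀ γ₁ : ℝ → En n) : ℝ≥0∞ :=
  ⨅ (P : C1Path s n) (_ : P.Γ 0 = γ₀ ∧ P.Γ 1 = γ₁), ENNReal.ofReal (pathLen P)

/-- `U ⊆ 𝓜` is bounded with respect to the geodesic distance `d_G`. -/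
def GBounded (s : ℝ) {n : ℕ} (U : Set (ℝ → En n)) : Prop :=
  (∀ γ ∈ U, InM s γ) ∧
    ∃ γ₀, InM s γ₀ ∧ ∃ R : ℝ, ∀ γ ∈ U, geodDist s γ γ₀ ≤ ENNReal.ofReal R

/-- Weak convergence in the Hilbert space `H^s(𝕋,ℝⁿ)`. -/
def WeakHsTendsto {n : ℕ} (s : ℝ) (γk : ℕ → ℝ → En n) (γ : ℝ → En n) : Prop :=
  ∀ v : ℝ → En n, InHs s v →
    Tendsto (fun k => HsInner s (γk k) v) atTop (𝓝 (HsInner s γ v))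

/-- Directional derivative of `γ ↦ G_γ(u,v)` at `γ` in direction `w`. -/
def DGdir {n : ℕ} (s : ℝ) (γ w u v : ℝ → En n) : ℝ :=
  deriv (fun t : ℝ => Gmet s (fun x => γ x + t • w x) u v) 0

/-- `F'` is the derivative of the path `F` with respect to the `H^s` norm, on `S`. -/
def IsHsDerivOn {n : ℕ} (s : ℝ) (F F' : ℝ → ℝ → En n) (S : Set ℝ) : Prop :=
  ∀ t ∈ S,
    Tendsto (fun h : ℝ => HsNorm s fun x => h⁻¹ • (F (t + h) x - F t x) - F' t x)
      (𝓝[{h : ℝ | t + h ∈ S ∧ h ≠ 0}] 0) (𝓝 0)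

/-- The path `F` is continuous on `S` with respect to the `H^s` norm. -/
def HsContOn {n : ℕ} (s : ℝ) (F : ℝ → ℝ → En n) (S : Set ℝ) : Prop :=
  ∀ t ∈ S, Tendsto (fun τ : ℝ => HsNorm s fun x => F τ x - F t x) (𝓝[S] t) (𝓝 0)

/-- A solution of the geodesic initial value problem on `[0,∞)`, recorded as a triple
(position `Γ`, velocity `V`, acceleration `W`); the geodesic equation
`Γ̈ + A_Γ(Γ̇)Γ̇ = 0` is expressed weakly via the Koszul formula for the
Christoffel operator `A`. -/
def GeodesicSol {n : ℕ} (s : ℝ) (γ₀ v₀ : ℝ → En n) (Γ V W : ℝ → ℝ → En n) : Prop :=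
  (∀ t ∈ Set.Ici (0 : ℝ), InM s (Γ t) ∧ InHs s (V t) ∧ InHs s (W t)) ∧
  Γ 0 = γ₀ ∧ V 0 = v₀ ∧
  IsHsDerivOn s Γ V (Set.Ici 0) ∧ IsHsDerivOn s V W (Set.Ici 0) ∧
  HsContOn s V (Set.Ici 0) ∧ HsContOn s W (Set.Ici 0) ∧
  ∀ t ∈ Set.Ici (0 : ℝ), ∀ w : ℝ → En n, InHs s w →
    Gmet s (Γ t) (W t) w + DGdir s (Γ t) (V t) (V t) w
      - (1 / 2) * DGdir s (Γ t) w (V t) (V t) = 0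
section Proof
open ENNReal (ofReal_mul ofReal_le_ofReal ofReal_add ofReal_ne_top ofReal_lt_top ofReal_toReal)
variable {n : ℕ} {s : ℝ}
local notation "oR" => ENNReal.ofReal
local notation "U1" => Icc (0:ℝ) 1
local notation "J1" => Ioc (-(1/2):ℝ) (1/2)
local notation "Cv" => ℝ → En n
local notation "sP" => (2 * s + 1)
local notation "sM" => (2 * s - 1)
local notation "pz" => (by positivity)
local notation "gS" v:max => gagliardoSqE (s - 1) (deriv v)
section Morrey
variable {p p' : ℝ → ℝ} {a b ε : ℝ} {E : Type*} [NormedAddCommGroup E] [NormedSpace ℝ E] [CompleteSpace E] {f f' : ℝ → E}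
def mH (p p' : ℝ → ℝ) (f f' : ℝ → E) (x y : ℝ) : E := p' x • (f y - f x) - (p y - p x) • f' x
def mQ (s : ℝ) (p p' : ℝ → ℝ) (f f' : ℝ → E) (x y : ℝ) : ℝ :=
  ‖f y - f x - (p y - p x) • ((p' x)⁻¹ • f' x)‖ ^ 2 / |p y - p x| ^ (2 * s + 1) * p' x * p' y
local notation "nH" x:max y:max => ‖mH p p' f f' x y‖ * p' y
lemma dcont (hf : ∀ x, HasDerivAt f (f' x) x) : Continuous f := continuous_iff_continuousAt.2 fun x => (hf x).continuousAt
lemma msm (hp : ∀ x, HasDerivAt p (p' x) x) (hpos : ∀ x ∈ Icc a b, 0 < p' x) : StrictMonoOn p (Icc a b) := by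
  apply strictMonoOn_of_deriv_pos (convex_Icc a b) (dcont hp).continuousOn
  intro x hx; rw [(hp x).deriv]; exact hpos x (interior_subset hx)
lemma mP (hp : ∀ x, HasDerivAt p (p' x) x) (hpos : ∀ x ∈ Icc a b, 0 < p' x) (hab : a < b) : 0 < p b - p a :=
  sub_pos.2 (msm hp hpos (left_mem_Icc.2 hab.le) (right_mem_Icc.2 hab.le) hab)
lemma mcH (hp : ∀ x, HasDerivAt p (p' x) x) (hf : ∀ x, HasDerivAt f (f' x) x) (hpc : Continuous p') (hfc : Continuous f') (x : ℝ) : Continuous (mH p p' f f' x) := by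
  have := dcont hp; have := dcont hf
  unfold mH; fun_prop
lemma mcg (hp : ∀ x, HasDerivAt p (p' x) x) (hf : ∀ x, HasDerivAt f (f' x) x) (hpc : Continuous p') (hfc : Continuous f') : Continuous fun x => ∫ y in a..b, nH x y := by
  apply intervalIntegral.continuous_parametric_intervalIntegral_of_continuous'
  have := dcont hp; have := dcont hf
  unfold mH; simp only [Function.uncurry_def]; fun_prop
lemma mgn (hab : a < b) (hpos : ∀ x ∈ Icc a b, 0 < p' x) (x : ℝ) : 0 ≤ ∫ y in a..b, nH x y :=
  intervalIntegral.integral_nonneg hab.le fun y hy => mul_nonneg (norm_nonneg _) (hpos y hy).le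
lemma morrey_identity (hp : ∀ x, HasDerivAt p (p' x) x) (hf : ∀ x, HasDerivAt f (f' x) x) (hpc : Continuous p') (x : ℝ) : ∫ y in a..b, ((p y - (p a + p b) / 2) * p' y) • mH p p' f f' x y = p' x • (∫ y in a..b, ((p y - (p a + p b) / 2) * p' y) • f y) - ((p b - p a) ^ 3 / 12) • f' x := by
  have cp := dcont hp
  have cf := dcont hf
  set m := (p a + p b) / 2 with hm
  have h1 : ∫ y in a..b, (p y - m) * p' y = 0 := by
    rw [intervalIntegral.integral_eq_sub_of_hasDerivAt (f := fun y => (p y - m) ^ 2 / 2)]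
    · rw [hm]; ring
    · intro y _
      exact ((((hp y).sub_const m).fun_pow 2).div_const 2).congr_deriv (by push_cast; ring)
    · exact (by fun_prop : Continuous _).intervalIntegrable _ _
  have h2 : ∫ y in a..b, (p y - m) * p' y * (p y - m) = (p b - p a) ^ 3 / 12 := by
    rw [intervalIntegral.integral_eq_sub_of_hasDerivAt (f := fun y => (p y - m) ^ 3 / 3)]
    · rw [hm]; ring
    · intro y _
      exact ((((hp y).sub_const m).fun_pow 3).div_const 3).congr_deriv (by push_cast; ring)
    · exact (by fun_prop : Continuous _).intervalIntegrable _ _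
  have e : ∀ y, ((p y - m) * p' y) • mH p p' f f' x y = p' x • (((p y - m) * p' y) • f y) - (((p y - m) * p' y) • (p' x • f x) + (((p y - m) * p' y * (p y - m)) • f' x + ((p y - m) * p' y) • ((m - p x) • f' x))) := by intro y; unfold mH; module
  simp_rw [e]
  rw [intervalIntegral.integral_sub, intervalIntegral.integral_add, intervalIntegral.integral_add, intervalIntegral.integral_smul, intervalIntegral.integral_smul_const, intervalIntegral.integral_smul_const, intervalIntegral.integral_smul_const, h1, h2]
  · simp
  all_goals exact (by fun_prop : Continuous _).intervalIntegrable _ _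
lemma morrey_step {a' b' A : ℝ} (hp : ∀ x, HasDerivAt p (p' x) x) (hf : ∀ x, HasDerivAt f (f' x) x) (hpc : Continuous p') (hfc : Continuous f') (hab : a < b) (hpos : ∀ x ∈ Icc a b, 0 < p' x) (haa : a ≤ a') (hab' : a' ≤ b') (hbb : b' ≤ b) (hP : 0 < p b - p a) (hA : ∫ x in a..b, ∫ y in a..b, nH x y ≤ A) : ‖(f b' - f a') - (p b' - p a') • ((12 / (p b - p a) ^ 3) •
        (∫ y in a..b, ((p y - (p a + p b) / 2) * p' y) • f y))‖ ≤ 6 / (p b - p a) ^ 2 * A := by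
  have cp := dcont hp
  have cf := dcont hf
  set P := p b - p a with hPd
  set J := ∫ y in a..b, ((p y - (p a + p b) / 2) * p' y) • f y with hJ
  have cg := mcg (a := a) (b := b) hp hf hpc hfc
  have mono : ∀ y ∈ Icc a b, |p y - (p a + p b) / 2| ≤ P / 2 := by
    have hm := (msm hp hpos).monotoneOn
    intro y hy
    have h1 := hm (left_mem_Icc.2 hab.le) hy hy.1
    have h2 := hm hy (right_mem_Icc.2 hab.le) hy.2
    rw [abs_le]; constructor <;> linarith
  have pw : ∀ x, ‖f' x - p' x • ((12 / P ^ 3) • J)‖ ≤ 6 / P ^ 2 * ∫ y in a..b, nH x y := by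
    intro x
    have id := morrey_identity (a := a) (b := b) hp hf hpc x
    have e : f' x - p' x • ((12 / P ^ 3) • J) = (-(12 / P ^ 3)) • ∫ y in a..b, ((p y - (p a + p b) / 2) * p' y) • mH p p' f f' x y := by
      rw [id, smul_sub, smul_smul, smul_smul, ← hPd, ← hJ, smul_smul]
      have : -(12 / P ^ 3) * (P ^ 3 / 12) = -1 := by field_simp
      rw [this]; module
    rw [e, norm_smul, norm_neg, norm_of_nonneg pz]
    have : ‖∫ y in a..b, ((p y - (p a + p b) / 2) * p' y) • mH p p' f f' x y‖ ≤ ∫ y in a..b, P / 2 * (‖mH p p' f f' x y‖ * p' y) := by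
      apply intervalIntegral.norm_integral_le_of_norm_le hab.le
      · refine Eventually.of_forall fun y hy => ?_
        have hy' := Ioc_subset_Icc_self hy
        rw [norm_smul, norm_mul, norm_of_nonneg (hpos y hy').le, norm_eq_abs]
        have := mono y hy'
        have h3 : 0 ≤ p' y * ‖mH p p' f f' x y‖ := mul_nonneg (hpos y hy').le (norm_nonneg _)
        nlinarith
      · exact (((mcH hp hf hpc hfc x).norm.mul hpc).const_mul _).intervalIntegrable _ _
    rw [intervalIntegral.integral_const_mul] at this
    calc _ ≤ 12 / P ^ 3 * (P / 2 * ∫ y in a..b, nH x y) := by gcongr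
      _ = _ := by field_simp; ring
  have e2 : (f b' - f a') - (p b' - p a') • ((12 / P ^ 3) • J) = ∫ x in a'..b', (f' x - p' x • ((12 / P ^ 3) • J)) := by
    rw [intervalIntegral.integral_sub, intervalIntegral.integral_smul_const, intervalIntegral.integral_eq_sub_of_hasDerivAt (fun x _ => hp x), intervalIntegral.integral_eq_sub_of_hasDerivAt (fun x _ => hf x)]
    all_goals exact (by fun_prop : Continuous _).intervalIntegrable _ _
  rw [e2]
  have gnn := mgn (p := p) (f := f) (f' := f') hab hpos
  calc ‖∫ x in a'..b', (f' x - p' x • ((12 / P ^ 3) • J))‖ ≤ ∫ x in a'..b', 6 / P ^ 2 * ∫ y in a..b, nH x y := by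
        apply intervalIntegral.norm_integral_le_of_norm_le hab'
        · exact Eventually.of_forall fun x _ => pw x
        · exact (cg.const_mul (6 / P ^ 2)).intervalIntegrable (μ := volume) a' b'
    _ = 6 / P ^ 2 * ∫ x in a'..b', ∫ y in a..b, nH x y := by rw [intervalIntegral.integral_const_mul]
    _ ≤ 6 / P ^ 2 * ∫ x in a..b, ∫ y in a..b, nH x y := by
        gcongr
        apply intervalIntegral.integral_mono_interval haa hab' hbb
        · exact Eventually.of_forall gnn
        · exact cg.intervalIntegrable _ _
    _ ≤ _ := by gcongr
lemma morrey_A (hs : 0 < s) (hp : ∀ x, HasDerivAt p (p' x) x) (hf : ∀ x, HasDerivAt f (f' x) x) (hpc : Continuous p') (hfc : Continuous f') (hab : a < b) (hpos : ∀ x ∈ Icc a b, 0 < p' x) (hε : 0 < ε) (hQ : ∫⁻ x in Ioc a b, ∫⁻ y in Ioc a b, oR (mQ s p p' f f' x y) ≤ oR (ε ^ 2)) : ∫ x in a..b, ∫ y in a..b, nH x y ≤ ε * (p b - p a) ^ (s + 3 / 2) := by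
  have cp := dcont hp
  have cf := dcont hf
  have hsm := msm hp hpos
  have hP := mP hp hpos hab
  set P := p b - p a with hPd
  have cg := mcg (a := a) (b := b) hp hf hpc hfc
  have gnn := mgn (p := p) (f := f) (f' := f') hab hpos
  set κ := (ε * P ^ (s - 1 / 2))⁻¹ with hκ
  have κpos : 0 < κ := by positivity
  have pw : ∀ x ∈ Ioc a b, ∀ y ∈ Ioc a b, ‖mH p p' f f' x y‖ * p' y ≤ κ * P ^ sP / 2 * mQ s p p' f f' x y + (2 * κ)⁻¹ * (p' x * p' y) := by
    intro x hx y hy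
    have hx' := hpos x (Ioc_subset_Icc_self hx)
    have hy' := hpos y (Ioc_subset_Icc_self hy)
    set F := f y - f x - (p y - p x) • ((p' x)⁻¹ • f' x) with hF
    have eH : mH p p' f f' x y = p' x • F := by
      rw [hF]; unfold mH
      rw [smul_sub (p' x) (f y - f x), smul_smul (p y - p x), smul_smul (p' x)]
      congr 2; field_simp
    have hd : |p y - p x| ≤ P := by
      have h1 := hsm.monotoneOn (left_mem_Icc.2 hab.le) (Ioc_subset_Icc_self hx) hx.1.le
      have h2 := hsm.monotoneOn (Ioc_subset_Icc_self hx) (right_mem_Icc.2 hab.le) hx.2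
      have h3 := hsm.monotoneOn (left_mem_Icc.2 hab.le) (Ioc_subset_Icc_self hy) hy.1.le
      have h4 := hsm.monotoneOn (Ioc_subset_Icc_self hy) (right_mem_Icc.2 hab.le) hy.2
      rw [abs_le]; constructor <;> linarith
    have hF2 : ‖F‖ ^ 2 ≤ P ^ sP * (‖F‖ ^ 2 / |p y - p x| ^ sP) := by
      by_cases hxy : x = y
      · subst hxy; simp [hF]
      have : 0 < |p y - p x| := by
        rw [abs_pos, sub_ne_zero]
        exact fun h => hxy (hsm.injOn (Ioc_subset_Icc_self hy) (Ioc_subset_Icc_self hx) h).symm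
      have h5 : |p y - p x| ^ sP ≤ P ^ sP :=
        rpow_le_rpow this.le hd (by linarith)
      have h6 : 0 < |p y - p x| ^ sP := rpow_pos_of_pos this _
      rw [mul_div_assoc', le_div_iff₀ h6]
      nlinarith [sq_nonneg ‖F‖]
    have key : ‖F‖ ≤ κ / 2 * ‖F‖ ^ 2 + (2 * κ)⁻¹ := by
      have : κ / 2 * ‖F‖ ^ 2 + (2 * κ)⁻¹ - ‖F‖ = (κ * ‖F‖ - 1) ^ 2 / (2 * κ) := by field_simp; ring
      have h7 : 0 ≤ (κ * ‖F‖ - 1) ^ 2 / (2 * κ) := by positivity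
      linarith
    rw [eH, norm_smul, norm_of_nonneg hx'.le]
    unfold mQ; rw [← hF]
    have h8 : ‖F‖ ≤ κ / 2 * (P ^ sP * (‖F‖ ^ 2 / |p y - p x| ^ sP)) + (2 * κ)⁻¹ :=
      key.trans (by gcongr)
    have h9 : 0 < p' x * p' y := by positivity
    calc p' x * ‖F‖ * p' y = ‖F‖ * (p' x * p' y) := by ring
      _ ≤ (κ / 2 * (P ^ sP * (‖F‖ ^ 2 / |p y - p x| ^ sP)) + (2 * κ)⁻¹) * (p' x * p' y) := by gcongr
      _ = _ := by ring
  have conv : oR (∫ x in a..b, ∫ y in a..b, nH x y) = ∫⁻ x in Ioc a b, ∫⁻ y in Ioc a b, oR (‖mH p p' f f' x y‖ * p' y) := by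
    rw [intervalIntegral.integral_of_le hab.le, ofReal_integral_eq_lintegral_ofReal]
    · apply lintegral_congr_ae
      filter_upwards with x
      rw [intervalIntegral.integral_of_le hab.le, ofReal_integral_eq_lintegral_ofReal]
      · have : Continuous fun y => ‖mH p p' f f' x y‖ * p' y := (mcH hp hf hpc hfc x).norm.mul hpc
        exact (this.intervalIntegrable a b).1
      · filter_upwards [ae_restrict_mem measurableSet_Ioc] with y hy
        exact mul_nonneg (norm_nonneg _) (hpos y (Ioc_subset_Icc_self hy)).le
    · exact (cg.intervalIntegrable a b).1
    · exact Eventually.of_forall gnn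
  have hint : oR P = ∫⁻ y in Ioc a b, oR (p' y) := by
    rw [hPd, ← intervalIntegral.integral_eq_sub_of_hasDerivAt (fun x _ => hp x)
      (hpc.intervalIntegrable a b), intervalIntegral.integral_of_le hab.le,
      ofReal_integral_eq_lintegral_ofReal]
    · exact (hpc.intervalIntegrable a b).1
    · filter_upwards [ae_restrict_mem measurableSet_Ioc] with y hy
      exact (hpos y (Ioc_subset_Icc_self hy)).le
  have main : oR (∫ x in a..b, ∫ y in a..b, nH x y) ≤ oR (κ * P ^ sP / 2) * oR (ε ^ 2) + oR ((2 * κ)⁻¹) * (oR P * oR P) := by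
    rw [conv]
    calc _ ≤ ∫⁻ x in Ioc a b, ∫⁻ y in Ioc a b, (oR (κ * P ^ sP / 2) * oR (mQ s p p' f f' x y) + oR ((2 * κ)⁻¹) * (oR (p' x) * oR (p' y))) := by
          apply setLIntegral_mono' measurableSet_Ioc; intro x hx
          apply setLIntegral_mono' measurableSet_Ioc; intro y hy
          refine (ofReal_le_ofReal (pw x hx y hy)).trans ?_
          refine ENNReal.ofReal_add_le.trans ?_
          rw [ofReal_mul pz, ofReal_mul pz, ofReal_mul (hpos x (Ioc_subset_Icc_self hx)).le]
      _ = ∫⁻ x in Ioc a b, ((oR (κ * P ^ sP / 2) * ∫⁻ y in Ioc a b, oR (mQ s p p' f f' x y)) + oR ((2 * κ)⁻¹) * (oR (p' x) * oR P)) := by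
          congr 1; ext x
          rw [lintegral_add_right _ (by fun_prop), lintegral_const_mul' _ _ ofReal_ne_top, lintegral_const_mul' _ _ ofReal_ne_top, lintegral_const_mul' _ _ ofReal_ne_top, hint]
      _ = oR (κ * P ^ sP / 2) * (∫⁻ x in Ioc a b, ∫⁻ y in Ioc a b, oR (mQ s p p' f f' x y)) + oR ((2 * κ)⁻¹) * (oR P * oR P) := by rw [lintegral_add_right _ (by fun_prop), lintegral_const_mul' _ _ ofReal_ne_top, lintegral_const_mul' _ _ ofReal_ne_top, lintegral_mul_const' _ _ ofReal_ne_top, ← hint]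
      _ ≤ _ := by gcongr
  rw [← ofReal_mul pz, ← ofReal_mul pz, ← ofReal_mul pz, ← ofReal_add pz pz, ENNReal.ofReal_le_ofReal_iff pz] at main
  refine main.trans (le_of_eq ?_)
  have e1 : P ^ sP = P ^ (s - 1 / 2) * P ^ (s + 3 / 2) := by rw [← rpow_add hP]; congr 1; ring
  have e2 : P ^ (s + 3 / 2) = P ^ (s - 1 / 2) * P ^ 2 := by rw [← rpow_natCast P 2, ← rpow_add hP]; congr 1; push_cast; ring
  have h0 : 0 < P ^ (s - 1 / 2) := by positivity
  rw [hκ, e1, e2]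
  field_simp
  ring
def mC (s : ℝ) : ℝ := 18 / (1 - (1 / 2 : ℝ) ^ (s - 3 / 2))
lemma mC_pos (hs : 3 / 2 < s) : 0 < mC s := by
  have : (1 / 2 : ℝ) ^ (s - 3 / 2) < 1 :=
    rpow_lt_one (by norm_num) (by norm_num) (by linarith)
  unfold mC; apply div_pos <;> linarith
lemma morrey (hs : 3 / 2 < s) (hp : ∀ x, HasDerivAt p (p' x) x) (hf : ∀ x, HasDerivAt f (f' x) x) (hpc : Continuous p') (hfc : Continuous f') (hab : a < b) (hpos : ∀ x ∈ Icc a b, 0 < p' x) (hε : 0 < ε) (hQ : ∫⁻ x in Ioc a b, ∫⁻ y in Ioc a b, oR (mQ s p p' f f' x y) ≤ oR (ε ^ 2)) {x : ℝ} (hx : x ∈ Icc a b) : ‖(p b - p a)⁻¹ • (f b - f a) - (p' x)⁻¹ • f' x‖ ≤ mC s * ε * (p b - p a) ^ (s - 3 / 2) := by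
  have cp := dcont hp
  have cf := dcont hf
  have hsm := msm hp hpos
  have hP := mP hp hpos hab
  set P := p b - p a with hPd
  have hpa := hsm.monotoneOn (left_mem_Icc.2 hab.le) hx hx.1
  have hpb := hsm.monotoneOn hx (right_mem_Icc.2 hab.le) hx.2
  have hpow : ∀ k : ℕ, 0 < (1 / 2 : ℝ) ^ k ∧ (1 / 2 : ℝ) ^ k ≤ 1 := fun k =>
    ⟨by positivity, pow_le_one₀ (by norm_num) (by norm_num)⟩
  have exA : ∀ k : ℕ, ∃ c ∈ Icc a x, p c = p x - (1 / 2) ^ k * (p x - p a) := by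
    intro k
    have := intermediate_value_Icc hx.1 cp.continuousOn
    apply this; obtain ⟨h1, h2⟩ := hpow k
    constructor <;> nlinarith
  have exB : ∀ k : ℕ, ∃ c ∈ Icc x b, p c = p x + (1 / 2) ^ k * (p b - p x) := by
    intro k
    have := intermediate_value_Icc hx.2 cp.continuousOn
    apply this; obtain ⟨h1, h2⟩ := hpow k
    constructor <;> nlinarith
  choose A hA1 hA2 using exA
  choose B hB1 hB2 using exB
  have hAm : ∀ k, A k ∈ Icc a b := fun k => ⟨(hA1 k).1, (hA1 k).2.trans hx.2⟩
  have hBm : ∀ k, B k ∈ Icc a b := fun k => ⟨hx.1.trans (hB1 k).1, (hB1 k).2⟩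
  have hPk : ∀ k, p (B k) - p (A k) = (1 / 2) ^ k * P := by intro k; rw [hA2, hB2, hPd]; ring
  have hAB : ∀ k, A k < B k := by
    intro k
    rw [← hsm.lt_iff_lt (hAm k) (hBm k), ← sub_pos, hPk]
    have := (hpow k).1; positivity
  have hAA : ∀ k, A k ≤ A (k + 1) := by
    intro k
    rw [← hsm.le_iff_le (hAm k) (hAm _), hA2, hA2, pow_succ]
    nlinarith [(hpow k).1]
  have hBB : ∀ k, B (k + 1) ≤ B k := by
    intro k
    rw [← hsm.le_iff_le (hBm _) (hBm _), hB2, hB2, pow_succ]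
    nlinarith [(hpow k).1]
  have hA0 : A 0 = a := by apply hsm.injOn (hAm 0) (left_mem_Icc.2 hab.le); rw [hA2]; ring
  have hB0 : B 0 = b := by apply hsm.injOn (hBm 0) (right_mem_Icc.2 hab.le); rw [hB2]; ring
  set m : ℕ → E := fun k => (p (B k) - p (A k))⁻¹ • (f (B k) - f (A k)) with hm
  set r : ℝ := (1 / 2 : ℝ) ^ (s - 3 / 2) with hr
  have hr1 : r < 1 := rpow_lt_one (by norm_num) (by norm_num) (by linarith)
  have step : ∀ k, dist (m k) (m (k + 1)) ≤ (18 * ε * P ^ (s - 3 / 2)) * r ^ k := by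
    intro k
    have hPkp : 0 < p (B k) - p (A k) := by rw [hPk]; have := (hpow k).1; positivity
    set Q := p (B k) - p (A k) with hQd
    have hQ1 : p (B (k + 1)) - p (A (k + 1)) = Q / 2 := by rw [hQd, hPk, hPk, pow_succ]; ring
    have sub : Ioc (A k) (B k) ⊆ Ioc a b := Ioc_subset_Ioc (hAm k).1 (hBm k).2
    have hposk : ∀ x ∈ Icc (A k) (B k), 0 < p' x := fun x hx =>
      hpos x ⟨(hAm k).1.trans hx.1, hx.2.trans (hBm k).2⟩
    have hAk := morrey_A (s := s) (by linarith) hp hf hpc hfc (hAB k) hposk hε (by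
      refine le_trans ?_ hQ
      refine (lintegral_mono_set sub).trans ?_
      exact lintegral_mono fun x => lintegral_mono_set sub)
    have h1 := morrey_step hp hf hpc hfc (hAB k) hposk le_rfl (hAB k).le le_rfl hPkp hAk
    have h2 := morrey_step hp hf hpc hfc (hAB k) hposk (hAA k) (hAB (k+1)).le (hBB k) hPkp hAk
    rw [hQ1] at h2
    rw [← hQd] at h1 h2
    set S := (12 / Q ^ 3) • ∫ y in A k..B k, ((p y - (p (A k) + p (B k)) / 2) * p' y) • f y
    have e1 : m k - S = Q⁻¹ • (f (B k) - f (A k) - Q • S) := by rw [hm]; simp only [← hQd]; rw [smul_sub Q⁻¹ (f (B k) - f (A k)), smul_smul, inv_mul_cancel₀ hPkp.ne', one_smul]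
    have e2 : m (k+1) - S = (Q / 2)⁻¹ • (f (B (k+1)) - f (A (k+1)) - (Q / 2) • S) := by rw [hm]; simp only [hQ1]; rw [smul_sub (Q/2)⁻¹ (f (B (k+1)) - f (A (k+1))), smul_smul (Q/2)⁻¹, inv_mul_cancel₀ pz, one_smul]
    have n1 : ‖m k - S‖ ≤ Q⁻¹ * (6 / Q ^ 2 * (ε * Q ^ (s + 3 / 2))) := by rw [e1, norm_smul, norm_of_nonneg pz]; gcongr
    have n2 : ‖m (k+1) - S‖ ≤ (Q / 2)⁻¹ * (6 / Q ^ 2 * (ε * Q ^ (s + 3 / 2))) := by rw [e2, norm_smul, norm_of_nonneg pz]; gcongr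
    have eQ : Q ^ (s + 3 / 2) = Q ^ (s - 3 / 2) * Q ^ 3 := by rw [← rpow_natCast Q 3, ← rpow_add hPkp]; congr 1; push_cast; ring
    have eQ2 : Q ^ (s - 3 / 2) = P ^ (s - 3 / 2) * r ^ k := by rw [hQd, hPk, mul_rpow (hpow k).1.le hP.le, hr, ← rpow_natCast, ← rpow_natCast, ← rpow_mul (by norm_num), ← rpow_mul (by norm_num), mul_comm (k : ℝ), mul_comm]
    calc dist (m k) (m (k+1)) ≤ dist (m k) S + dist (m (k+1)) S := dist_triangle_right _ _ _
      _ ≤ Q⁻¹ * (6 / Q ^ 2 * (ε * Q ^ (s + 3 / 2))) + (Q / 2)⁻¹ * (6 / Q ^ 2 * (ε * Q ^ (s + 3 / 2))) := by rw [dist_eq_norm, dist_eq_norm]; gcongr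
      _ = 18 * ε * Q ^ (s - 3 / 2) := by rw [eQ]; field_simp; ring
      _ = _ := by rw [eQ2]; ring
  obtain ⟨z, hz, hzmin⟩ := isCompact_Icc.exists_isMinOn (nonempty_Icc.2 hab.le) hpc.continuousOn
  have hδ := hpos z hz
  have hlow : ∀ k, p' z * (B k - A k) ≤ (1 / 2) ^ k * P := by
    intro k; rw [← hPk]
    have := Convex.mul_sub_le_image_sub_of_le_deriv (convex_Icc (A k) (B k)) cp.continuousOn
      (fun y _ => (hp y).differentiableAt.differentiableWithinAt) (C := p' z) (fun y hy => by
        rw [(hp y).deriv]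
        have := interior_subset hy
        exact hzmin ⟨(hAm k).1.trans this.1, this.2.trans (hBm k).2⟩)
    exact this _ (left_mem_Icc.2 (hAB k).le) _ (right_mem_Icc.2 (hAB k).le) (hAB k).le
  have hlim : Tendsto (fun k => B k - A k) atTop (𝓝 0) := by
    have h0 : Tendsto (fun k : ℕ => (1 / 2 : ℝ) ^ k * P / p' z) atTop (𝓝 0) := by
      have := (tendsto_pow_atTop_nhds_zero_of_lt_one (r := (1/2 : ℝ)) (by norm_num) (by norm_num)).mul_const P |>.div_const (p' z)
      simpa using this
    refine squeeze_zero (fun k => (sub_pos.2 (hAB k)).le) (fun k => ?_) h0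
    rw [le_div_iff₀ hδ]; linarith [hlow k]
  have hAl : Tendsto A atTop (𝓝 x) := by
    rw [tendsto_iff_dist_tendsto_zero]
    refine squeeze_zero (fun _ => dist_nonneg) (fun k => ?_) hlim
    rw [dist_eq, abs_le]; constructor <;> linarith [(hA1 k).2, (hB1 k).1, hAB k]
  have hBl : Tendsto B atTop (𝓝 x) := by
    rw [tendsto_iff_dist_tendsto_zero]
    refine squeeze_zero (fun _ => dist_nonneg) (fun k => ?_) hlim
    rw [dist_eq, abs_le]; constructor <;> linarith [(hA1 k).2, (hB1 k).1, hAB k]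
  have hmt : Tendsto m atTop (𝓝 ((p' x)⁻¹ • f' x)) := by
    set q := (p' x)⁻¹ • f' x with hq
    have hφ : ∀ y, HasDerivAt (fun y => f y - p y • q) (f' y - p' y • q) y := fun y =>
      (hf y).sub ((hp y).smul_const q)
    have hφs : HasStrictDerivAt (fun y => f y - p y • q) (f' x - p' x • q) x := by
      apply hasStrictDerivAt_of_hasDerivAt_of_continuousAt (Eventually.of_forall hφ)
      fun_prop
    have z0 : f' x - p' x • q = 0 := by rw [hq, smul_smul, mul_inv_cancel₀ (hpos x hx).ne', one_smul, sub_self]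
    rw [z0] at hφs
    have lo := hφs.isLittleO
    simp only [ContinuousLinearMap.toSpanSingleton_zero, ContinuousLinearMap.zero_apply, sub_zero] at lo
    rw [tendsto_iff_dist_tendsto_zero, Metric.tendsto_atTop]
    intro η hη
    have := lo.def (c := η / 2 * p' z) pz
    rw [nhds_prod_eq] at this
    have ev := (hBl.prodMk hAl).eventually this
    obtain ⟨N, hN⟩ := eventually_atTop.1 ev
    refine ⟨N, fun k hk => ?_⟩
    have h := hN k hk
    simp only [] at h
    have hPkp : 0 < p (B k) - p (A k) := by rw [hPk]; have := (hpow k).1; positivity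
    have e1 : m k - q = (p (B k) - p (A k))⁻¹ • (f (B k) - p (B k) • q - (f (A k) - p (A k) • q)) := by
      rw [hm]; simp only
      have : f (B k) - p (B k) • q - (f (A k) - p (A k) • q) = (f (B k) - f (A k)) - (p (B k) - p (A k)) • q := by module
      rw [this, smul_sub (p (B k) - p (A k))⁻¹ (f (B k) - f (A k)), smul_smul, inv_mul_cancel₀ hPkp.ne', one_smul]
    rw [dist_0_eq_abs, abs_of_nonneg dist_nonneg, dist_eq_norm, e1, norm_smul, norm_inv, norm_of_nonneg hPkp.le]
    rw [norm_of_nonneg (sub_pos.2 (hAB k)).le] at h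
    have h3 := hlow k; rw [← hPk] at h3
    rw [inv_mul_lt_iff₀ hPkp]
    nlinarith
  have fin := dist_le_of_le_geometric_of_tendsto₀ r (18 * ε * P ^ (s - 3 / 2)) hr1 step hmt
  rw [dist_eq_norm] at fin
  have : m 0 = P⁻¹ • (f b - f a) := by rw [hm]; simp only [hA0, hB0, hPd]
  rw [this] at fin
  refine fin.trans (le_of_eq ?_)
  unfold mC; rw [← hr]; ring
end Morrey
theorem dT_eq (x y : ℝ) : dT x y = |x - y - round (x - y)| := by
  unfold dT
  apply le_antisymm
  · exact ciInf_le ⟨0, by rintro _ ⟨k, rfl⟩; exact abs_nonneg _⟩ (round (x - y))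
  · exact le_ciInf fun k => round_le _ _
theorem dT_le (x y : ℝ) (k : ℤ) : dT x y ≤ |x - y - k| :=
  ciInf_le ⟨0, by rintro _ ⟨k, rfl⟩; exact abs_nonneg _⟩ k
theorem dT_nonneg (x y : ℝ) : 0 ≤ dT x y := by rw [dT_eq]; exact abs_nonneg _
theorem dT_add_int (x y : ℝ) (k : ℤ) : dT x (y + k) = dT x y := by
  apply le_antisymm
  · rw [dT_eq x y]
    refine (dT_le x (y + k) (round (x - y) - k)).trans (le_of_eq ?_)
    push_cast; congr 1; ring
  · rw [dT_eq x (y + k)]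
    refine (dT_le x y (round (x - (y + k)) + k)).trans (le_of_eq ?_)
    push_cast; congr 1; ring
theorem dT_of_abs_le (x h : ℝ) (hh : |h| ≤ 1 / 2) : dT x (x + h) = |h| := by
  apply le_antisymm
  · have := dT_le x (x + h) 0
    simpa using this
  · rw [dT_eq]
    set k := round (x - (x + h))
    have e : x - (x + h) - (k : ℝ) = -(h + k) := by ring
    rw [e, abs_neg]
    by_cases hk : k = 0
    · simp [hk]
    · have : (1 : ℝ) ≤ |(k : ℝ)| := by exact_mod_cast Int.one_le_abs hk
      have h2 : |(k : ℝ)| ≤ |h + k| + |h| := by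
        have := abs_sub (h + (k : ℝ)) h
        simpa using this
      linarith
theorem exists_shift (x y : ℝ) : ∃ (h : ℝ) (k : ℤ), |h| ≤ 1 / 2 ∧ y = x + h + k := by refine ⟨y - x - round (y - x), round (y - x), abs_sub_round _, by ring⟩
theorem measurable_dT : Measurable fun z : ℝ × ℝ => dT z.1 z.2 := by
  unfold dT
  exact Measurable.iInf fun k => by fun_prop
def mu2 : Measure (ℝ × ℝ) := (volume.restrict I01).prod (volume.restrict I01)
theorem lint_mu2 {F : ℝ × ℝ → ℝ≥0∞} (hF : Measurable F) : ∫⁻ z, F z ∂mu2 = ∫⁻ x in I01, ∫⁻ y in I01, F (x, y) :=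
  lintegral_prod _ hF.aemeasurable
theorem lint_mu2_swap (F : ℝ × ℝ → ℝ≥0∞) : ∫⁻ z, F z.swap ∂mu2 = ∫⁻ z, F z ∂mu2 := by
  unfold mu2
  exact lintegral_prod_swap F
instance : IsFiniteMeasure (volume.restrict I01) := by constructor; simp [I01]
instance : IsProbabilityMeasure (volume.restrict I01) := by constructor; simp [I01]
instance : IsProbabilityMeasure mu2 := by unfold mu2; infer_instance
theorem lint_periodic {f : ℝ → ℝ≥0∞} (hf : Function.Periodic f 1) (a : ℝ) : ∫⁻ x in Ioc a (a + 1), f x = ∫⁻ x in I01, f x := by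
  have h1 := (isAddFundamentalDomain_Ioc (zero_lt_one (α := ℝ)) a).setLIntegral_eq
    (isAddFundamentalDomain_Ioc (zero_lt_one (α := ℝ)) 0) f hf.map_vadd_zmultiples
  rw [h1, I01]
  simp only [zero_add]
  exact setLIntegral_congr Ico_ae_eq_Ioc.symm
theorem lint_shift {f : ℝ → ℝ≥0∞} (hf : Function.Periodic f 1) (x : ℝ) : ∫⁻ y in I01, f y = ∫⁻ h in J1, f (x + h) := by
  rw [← lint_periodic hf (x - 1/2)]
  have h := (measurePreserving_add_left volume x).setLIntegral_comp_emb
    (measurableEmbedding_addLeft x) f (J1)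
  rw [h]
  congr 2
  rw [image_const_add_Ioc]
  congr 1; ring
theorem lint_scale {f : ℝ → ℝ≥0∞} (hf : Measurable f) {θ : ℝ} (hθ : 0 < θ) (hθ1 : θ ≤ 1) : oR θ * ∫⁻ h in J1, f (θ * h) ≤ ∫⁻ h in J1, f h := by
  have e := smul_map_volume_mul_left (ne_of_gt hθ)
  have hm : Measurable fun h : ℝ => θ * h := by fun_prop
  set g : ℝ → ℝ≥0∞ := (J1).indicator f with hg
  have hgm : Measurable g := hf.indicator measurableSet_Ioc
  rw [← lintegral_indicator measurableSet_Ioc, ← lintegral_indicator measurableSet_Ioc, ← hg]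
  calc _ ≤ oR θ * ∫⁻ h, g (θ * h) := by
        gcongr with h
        rw [hg]
        by_cases hh : h ∈ J1
        · rw [indicator_of_mem hh, indicator_of_mem]
          rcases hh with ⟨h1, h2⟩
          constructor <;> nlinarith
        · rw [indicator_of_notMem hh]; exact zero_le
    _ = ∫⁻ h, g h := by
        conv_rhs => rw [← e]
        rw [lintegral_smul_measure, lintegral_map hgm hm, abs_of_pos hθ]
        simp
theorem InHs.cd {u : Cv} (h : InHs s u) : Continuous (deriv u) :=
  h.2.1.continuous_deriv le_rfl
theorem InHs.c {u : Cv} (h : InHs s u) : Continuous u := h.2.1.continuous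
theorem InHs.hd {u : Cv} (h : InHs s u) (x : ℝ) : HasDerivAt u (deriv u x) x :=
  (h.2.1.differentiable (by norm_num) x).hasDerivAt
theorem per_deriv {u : Cv} (h : Function.Periodic u 1) : Function.Periodic (deriv u) 1 := by
  intro x
  rw [← deriv_comp_add_const]
  congr 1
  funext y; exact h y
theorem per_int {E : Type*} {u : ℝ → E} (h : Function.Periodic u 1) (x : ℝ) (k : ℤ) : u (x + k) = u x := by simpa using (h.int_mul k) x
theorem gag_shift {E : Type*} [NormedAddCommGroup E] {v : ℝ → E} (h : Function.Periodic v 1)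
    (σ : ℝ) : gagliardoSqE σ v = ∫⁻ x in I01, ∫⁻ h in J1, oR (‖v (x + h) - v x‖ ^ 2 / |h| ^ (2 * σ + 1)) := by
  unfold gagliardoSqE
  refine lintegral_congr fun x => ?_
  rw [lint_shift (fun y => ?_) x]
  · refine setLIntegral_congr_fun measurableSet_Ioc fun h hh => ?_
    rw [dT_of_abs_le]
    exact abs_le.2 ⟨hh.1.le, hh.2⟩
  · have := dT_add_int x y 1
    push_cast at this
    rw [h y, this]
theorem jensen_sq {E : Type*} [NormedAddCommGroup E] [NormedSpace ℝ E] {g : ℝ → E} (hg : Continuous g) : oR (‖∫ θ in (0:ℝ)..1, g θ‖ ^ 2) ≤ ∫⁻ θ in Ioc (0:ℝ) 1, oR (‖g θ‖ ^ 2) := by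
  rw [← ofReal_integral_eq_lintegral_ofReal]
  · apply ofReal_le_ofReal
    rw [← intervalIntegral.integral_of_le zero_le_one]
    set m := ∫ θ in (0:ℝ)..1, ‖g θ‖ with hm
    have h1 : ‖∫ θ in (0:ℝ)..1, g θ‖ ≤ m :=
      intervalIntegral.norm_integral_le_integral_norm zero_le_one
    have h2 : 0 ≤ ∫ θ in (0:ℝ)..1, (‖g θ‖ - m) ^ 2 :=
      intervalIntegral.integral_nonneg zero_le_one fun _ _ => sq_nonneg _
    have h3 : ∫ θ in (0:ℝ)..1, (‖g θ‖ - m) ^ 2 = (∫ θ in (0:ℝ)..1, ‖g θ‖ ^ 2) - (2 * m) * m + m ^ 2 := by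
      have : ∀ θ, (‖g θ‖ - m) ^ 2 = (‖g θ‖ ^ 2 - (2 * m) * ‖g θ‖) + m ^ 2 := fun θ => by ring
      simp_rw [this]
      rw [intervalIntegral.integral_add, intervalIntegral.integral_sub, intervalIntegral.integral_const_mul, ← hm]
      · simp
      all_goals exact (by fun_prop : Continuous _).intervalIntegrable _ _
    nlinarith [norm_nonneg (∫ θ in (0:ℝ)..1, g θ)]
  · exact (by fun_prop : Continuous fun θ => ‖g θ‖ ^ 2).integrableOn_Ioc
  · exact Eventually.of_forall fun _ => by positivity
theorem rem_eq {u : Cv} (hu : InHs s u) (x h : ℝ) : u (x + h) - u x - h • deriv u x = h • ∫ θ in (0:ℝ)..1, (deriv u (x + θ * h) - deriv u x) := by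
  have hc := hu.cd
  rw [intervalIntegral.integral_sub, smul_sub]
  · congr 1
    · have e := intervalIntegral.integral_eq_sub_of_hasDerivAt (a := 0) (b := 1)
        (f := fun θ => u (x + θ * h)) (f' := fun θ => h • deriv u (x + θ * h))
        (fun θ _ => by
          have h1 : HasDerivAt (fun θ : ℝ => x + θ * h) h θ := by simpa using ((hasDerivAt_id θ).mul_const h).const_add x
          exact HasDerivAt.scomp θ (hu.hd _) h1)
        ((by fun_prop : Continuous _).intervalIntegrable _ _)
      rw [intervalIntegral.integral_smul] at e
      simp at e
      rw [e]
    · simp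
  all_goals exact (by fun_prop : Continuous _).intervalIntegrable _ _
def phiR (s : ℝ) (v : Cv) (x h : ℝ) : ℝ≥0∞ :=
  oR (‖v (x + h) - v x‖ ^ 2 / |h| ^ (2 * s - 1))
theorem phiR_meas {v : Cv} (hc : Continuous v) : Measurable fun p : ℝ × ℝ => phiR s v p.1 p.2 := by
  unfold phiR
  apply ENNReal.measurable_ofReal.comp
  have : Measurable fun a : ℝ × ℝ => v (a.1 + a.2) := (by fun_prop : Continuous _).measurable
  have : Measurable fun a : ℝ × ℝ => v a.1 := (by fun_prop : Continuous _).measurable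
  fun_prop
theorem rem_key (hs : 3/2 < s) {u : Cv} (hu : InHs s u) (x h : ℝ) : oR (‖u (x + h) - u x - h • deriv u x‖ ^ 2 / |h| ^ sP) ≤ ∫⁻ θ in Ioc (0:ℝ) 1, oR θ * phiR s (deriv u) x (θ * h) := by
  have hc := hu.cd
  rcases eq_or_ne h 0 with rfl | hh
  · simp
  have hh' : 0 < |h| := abs_pos.2 hh
  have hp : |h| ^ sP = |h| ^ sM * |h| ^ 2 := by rw [← rpow_natCast, ← rpow_add hh']; congr 1; push_cast; ring
  have hpp : 0 < |h| ^ sM := rpow_pos_of_pos hh' _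
  have e2 : ‖u (x + h) - u x - h • deriv u x‖ ^ 2 / |h| ^ sP = (|h| ^ sM)⁻¹ * ‖∫ θ in (0:ℝ)..1, (deriv u (x + θ * h) - deriv u x)‖ ^ 2 := by
    rw [rem_eq hu, norm_smul, norm_eq_abs, hp, mul_pow]
    generalize ‖∫ θ in (0:ℝ)..1, (deriv u (x + θ * h) - deriv u x)‖ ^ 2 = I
    field_simp
  rw [e2, ofReal_mul pz]
  refine (mul_le_mul_right (jensen_sq (by fun_prop)) _).trans ?_
  rw [← lintegral_const_mul _ (by fun_prop)]
  refine setLIntegral_mono' measurableSet_Ioc fun θ hθ => ?_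
  have hθ0 := hθ.1
  unfold phiR
  rw [← ofReal_mul pz, ← ofReal_mul hθ0.le]
  apply ofReal_le_ofReal
  rw [abs_mul, abs_of_pos hθ0, mul_rpow hθ0.le hh'.le]
  have h3 : θ ^ sM ≤ θ := by
    conv_rhs => rw [← rpow_one θ]
    exact rpow_le_rpow_of_exponent_ge hθ0 hθ.2 (by linarith)
  have h4 : 0 < θ ^ sM := rpow_pos_of_pos hθ0 _
  rw [inv_mul_eq_div, ← mul_div_assoc, div_le_div_iff₀ hpp pz]
  have : 0 ≤ ‖deriv u (x + θ * h) - deriv u x‖ ^ 2 * |h| ^ sM := by positivity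
  nlinarith
theorem remainder_bound (hs : 3/2 < s) {u : Cv} (hu : InHs s u) : ∫⁻ x in I01, ∫⁻ h in J1, oR (‖u (x + h) - u x - h • deriv u x‖ ^ 2 / |h| ^ sP) ≤ gS u := by
  have hφ := phiR_meas (s := s) hu.cd
  rw [gag_shift (per_deriv hu.1), show 2 * (s - 1) + 1 = 2 * s - 1 by ring]
  change _ ≤ ∫⁻ x in I01, ∫⁻ h in J1, phiR s (deriv u) x h
  refine lintegral_mono fun x => ?_
  have hφx : Measurable fun h => phiR s (deriv u) x h :=
    Measurable.of_uncurry_left (f := phiR s (deriv u)) hφ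
  refine (lintegral_mono fun h => rem_key hs hu x h).trans ?_
  rw [lintegral_lintegral_swap]
  · calc ∫⁻ θ in Ioc (0:ℝ) 1, ∫⁻ h in J1, oR θ * phiR s (deriv u) x (θ * h) ≤ ∫⁻ θ in Ioc (0:ℝ) 1, ∫⁻ h in J1, phiR s (deriv u) x h := by
          refine setLIntegral_mono' measurableSet_Ioc fun θ hθ => ?_
          have : Measurable fun h : ℝ => phiR s (deriv u) x (θ * h) :=
            hφx.comp (by fun_prop : Measurable fun h : ℝ => θ * h)
          rw [lintegral_const_mul _ this]
          exact lint_scale hφx hθ.1 hθ.2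
      _ = ∫⁻ h in J1, phiR s (deriv u) x h := by rw [setLIntegral_const]; simp
  · apply Measurable.aemeasurable
    have : Measurable fun a : ℝ × ℝ => phiR s (deriv u) x (a.2 * a.1) :=
      hφx.comp (by fun_prop : Measurable fun a : ℝ × ℝ => a.2 * a.1)
    simp only [Function.uncurry_def]
    fun_prop
theorem rem_local (hs : 3/2 < s) {u : Cv} (hu : InHs s u) (c : ℝ) : ∫⁻ x in Ioc c (c + 1/2), ∫⁻ y in Ioc c (c + 1/2), oR (‖u y - u x - (y - x) • deriv u x‖ ^ 2 / |y - x| ^ sP) ≤ gS u := by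
  refine le_trans ?_ (remainder_bound hs hu)
  rw [← lint_periodic (fun x => ?_) c]
  · refine (setLIntegral_mono' measurableSet_Ioc fun x hx => ?_).trans
      (lintegral_mono_set (Ioc_subset_Ioc_right (by linarith)))
    have h := (measurePreserving_add_left volume x).setLIntegral_comp_emb
      (measurableEmbedding_addLeft x)
      (fun y => oR (‖u y - u x - (y - x) • deriv u x‖ ^ 2 / |y - x| ^ sP))
      (J1)
    simp only [add_sub_cancel_left] at h
    rw [h, image_const_add_Ioc]
    exact lintegral_mono_set (Ioc_subset_Ioc (by linarith [hx.2]) (by linarith [hx.1]))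
  · refine lintegral_congr fun h => ?_
    rw [hu.1 x, per_deriv hu.1 x, add_right_comm, hu.1]
theorem sob_local (hs : 3/2 < s) {u : Cv} (hu : InHs s u) {ε : ℝ} (hε : 0 < ε) (hg : gS u ≤ oR (ε ^ 2)) (c x : ℝ) (hx : x ∈ Icc c (c + 1/2)) : ‖deriv u x - deriv u c‖ ≤ 2 * (mC s * ε) := by
  have key : ∀ z ∈ Icc c (c + 1/2), ‖((c + 1/2) - c)⁻¹ • (u (c + 1/2) - u c) - deriv u z‖ ≤ mC s * ε := by
    intro z hz
    have h := morrey (s := s) (p := fun x => x) (p' := fun _ => 1) (f := u) (f' := deriv u)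
      (a := c) (b := c + 1/2) (ε := ε) hs (fun x => hasDerivAt_id x) hu.hd continuous_const
      hu.cd (by linarith) (fun _ _ => one_pos) hε ?_ hz
    · simp only [inv_one, one_smul] at h
      refine h.trans ?_
      have : (c + 1/2 - c) ^ (s - 3/2) ≤ 1 :=
        rpow_le_one (by linarith) (by linarith) (by linarith)
      have h0 : 0 < mC s * ε := mul_pos (mC_pos hs) hε
      nlinarith
    · refine le_trans (le_of_eq ?_) ((rem_local hs hu c).trans hg)
      simp [mQ]
  have h1 := key x hx
  have h2 := key c ⟨le_rfl, by linarith⟩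
  set m := ((c + 1/2) - c)⁻¹ • (u (c + 1/2) - u c)
  have : deriv u x - deriv u c = (m - deriv u c) - (m - deriv u x) := by abel
  rw [this]
  exact (norm_sub_le _ _).trans (by linarith)
theorem per_shift {E : Type*} [NormedAddCommGroup E] {v : ℝ → E} (hv : Function.Periodic v 1) {A : ℝ} (h : ∀ x y, x ≤ y → y ≤ x + 1 → ‖v y - v x‖ ≤ A) (x y : ℝ) : ‖v y - v x‖ ≤ A := by
  obtain ⟨k, hk, -⟩ := existsUnique_add_zsmul_mem_Ico (one_pos (α := ℝ)) y x
  have e : v (y + k • (1:ℝ)) = v y := by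
    have := per_int hv y k
    simpa using this
  rw [← e]
  exact h _ _ hk.1 hk.2.le
theorem sq_avg {E : Type*} [NormedAddCommGroup E] {v : ℝ → E} (hv : Continuous v) {A : ℝ} (c : ℝ) (h : ∀ x, ‖v c - v x‖ ≤ A) : ‖v c‖ ^ 2 ≤ 2 * (∫ x in I01, ‖v x‖ ^ 2) + 2 * A ^ 2 := by
  have hi : Integrable (fun x => ‖v x‖ ^ 2) (volume.restrict I01) :=
    ((by fun_prop : Continuous fun x => ‖v x‖ ^ 2).integrableOn_Icc).mono_set Ico_subset_Icc_self
  have h1 : ∫ x in I01, ‖v c‖ ^ 2 ≤ ∫ x in I01, (2 * ‖v x‖ ^ 2 + 2 * A ^ 2) := by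
    apply integral_mono (integrable_const _) ((hi.const_mul 2).add (integrable_const _))
    intro x
    have h2 := h x
    have h3 : ‖v c‖ ≤ ‖v c - v x‖ + ‖v x‖ := by simpa using norm_add_le (v c - v x) (v x)
    have h4 : ‖v c‖ ≤ A + ‖v x‖ := by linarith
    have := pow_le_pow_left₀ (norm_nonneg _) h4 2
    simp only [Pi.add_apply]
    nlinarith [sq_nonneg (A - ‖v x‖)]
  rw [integral_add (hi.const_mul 2) (integrable_const _), integral_const_mul] at h1
  simpa using h1
theorem HsNormSq_nonneg (u : Cv) : 0 ≤ HsNormSq s u := by unfold HsNormSq; positivity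
theorem HsNorm_sq (u : Cv) : HsNorm s u ^ 2 = HsNormSq s u :=
  sq_sqrt (HsNormSq_nonneg u)
theorem HsNorm_nonneg (u : Cv) : 0 ≤ HsNorm s u := sqrt_nonneg _
theorem gag_le_Hs {u : Cv} (hu : InHs s u) : gS u ≤ oR (HsNorm s u ^ 2) := by
  rw [HsNorm_sq, ← ofReal_toReal hu.2.2.ne]
  apply ofReal_le_ofReal
  unfold HsNormSq
  have h1 : 0 ≤ ∫ x in I01, ‖u x‖ ^ 2 := by positivity
  have h2 : 0 ≤ ∫ x in I01, ‖deriv u x‖ ^ 2 := by positivity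
  linarith
theorem lip_of_sup {u : Cv} (hu : InHs s u) {K : ℝ} (hK : ∀ x, ‖deriv u x‖ ≤ K) (x y : ℝ) : ‖u y - u x‖ ≤ K * |y - x| := by
  have := Convex.norm_image_sub_le_of_norm_deriv_le (f := u) (s := univ) (x := x) (y := y)
    (fun x _ => (hu.hd x).differentiableAt) (fun x _ => hK x) convex_univ trivial trivial
  simpa using this
theorem sobolev (hs : 3/2 < s) : ∃ C : ℝ, 0 < C ∧ ∀ u : Cv, InHs s u → ∀ x, ‖u x‖ ≤ C * HsNorm s u ∧ ‖deriv u x‖ ≤ C * HsNorm s u := by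
  have hC := mC_pos hs
  set D := 2 + 32 * mC s ^ 2 with hD
  have hD2 : 2 ≤ D := by rw [hD]; nlinarith
  refine ⟨2 + 2 * D, by linarith, fun u hu => ?_⟩
  have hN : 0 ≤ HsNorm s u := HsNorm_nonneg u
  have key : ∀ ε, HsNorm s u < ε → ∀ x, ‖deriv u x‖ ≤ D * ε := by
    intro ε hε x
    have hε0 : 0 < ε := hN.trans_lt hε
    have hg : gS u ≤ oR (ε ^ 2) :=
      (gag_le_Hs hu).trans (ofReal_le_ofReal (by gcongr))
    have h1 : ∀ x y, ‖deriv u y - deriv u x‖ ≤ 4 * (mC s * ε) := by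
      apply per_shift (per_deriv hu.1)
      intro x y hxy hyx
      have hm := mul_pos hC hε0
      by_cases h : y ≤ x + 1/2
      · have := sob_local hs hu hε0 hg x y ⟨hxy, h⟩
        linarith
      · have a := sob_local hs hu hε0 hg x (x + 1/2) ⟨by linarith, le_rfl⟩
        have b := sob_local hs hu hε0 hg (x + 1/2) y ⟨by linarith, by linarith⟩
        have := norm_add_le (deriv u y - deriv u (x + 1/2)) (deriv u (x + 1/2) - deriv u x)
        simp only [sub_add_sub_cancel] at this
        linarith
    have h2 := sq_avg hu.cd x (fun y => h1 y x)
    have h3 : ∫ x in I01, ‖deriv u x‖ ^ 2 ≤ ε ^ 2 := by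
      have : HsNormSq s u ≤ ε ^ 2 := by rw [← HsNorm_sq]; gcongr
      refine le_trans ?_ this
      unfold HsNormSq
      have h1 : 0 ≤ ∫ x in I01, ‖u x‖ ^ 2 := by positivity
      have h2 : 0 ≤ (gS u).toReal := ENNReal.toReal_nonneg
      linarith
    have h4 : ‖deriv u x‖ ^ 2 ≤ D * ε ^ 2 := by rw [hD]; nlinarith
    apply le_of_sq_le_sq _ pz
    rw [mul_pow]
    have : D ≤ D ^ 2 := by nlinarith
    nlinarith [sq_nonneg ε]
  have key' : ∀ x, ‖deriv u x‖ ≤ D * HsNorm s u := by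
    intro x
    apply le_of_forall_pos_le_add
    intro δ hδ
    have := key (HsNorm s u + δ / D) (by have : 0 < δ / D := by positivity
                                         linarith) x
    rwa [mul_add, mul_div_cancel₀ _ (by linarith)] at this
  intro x
  refine ⟨?_, (key' x).trans (by gcongr; linarith)⟩
  have h1 : ∀ y z, ‖u z - u y‖ ≤ D * HsNorm s u := by
    apply per_shift hu.1
    intro x y hxy hyx
    refine (lip_of_sup hu key' x y).trans ?_
    have : |y - x| ≤ 1 := by rw [abs_le]; constructor <;> linarith
    have h0 : 0 ≤ D * HsNorm s u := by positivity
    nlinarith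
  have h2 := sq_avg hu.c x (fun y => h1 y x)
  have h3 : ∫ x in I01, ‖u x‖ ^ 2 ≤ HsNorm s u ^ 2 := by
    rw [HsNorm_sq]
    unfold HsNormSq
    have h1 : 0 ≤ ∫ x in I01, ‖deriv u x‖ ^ 2 := by positivity
    have h2 : 0 ≤ (gS u).toReal := ENNReal.toReal_nonneg
    linarith
  apply le_of_sq_le_sq _ pz
  have h5 := sq_nonneg (HsNorm s u)
  have h6 : (2 + 2 * D ^ 2) ≤ (2 + 2 * D) ^ 2 := by nlinarith
  calc _ ≤ _ := h2
    _ ≤ (2 + 2 * D ^ 2) * HsNorm s u ^ 2 := by nlinarith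
    _ ≤ (2 + 2 * D) ^ 2 * HsNorm s u ^ 2 := by gcongr
    _ = _ := by ring
theorem deriv_comb {u v : Cv} (hu : InHs s u) (hv : InHs s v) (a b : ℝ) : deriv (fun x => a • u x + b • v x) = fun x => a • deriv u x + b • deriv v x := by
  funext x
  exact (((hu.hd x).const_smul a).add ((hv.hd x).const_smul b)).deriv
theorem sq_comb {E : Type*} [NormedAddCommGroup E] [NormedSpace ℝ E] (p q : E) (a b : ℝ) : ‖a • p + b • q‖ ^ 2 ≤ 2 * a ^ 2 * ‖p‖ ^ 2 + 2 * b ^ 2 * ‖q‖ ^ 2 := by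
  have h := norm_add_le (a • p) (b • q)
  rw [norm_smul, norm_smul, norm_eq_abs, norm_eq_abs] at h
  have := pow_le_pow_left₀ (norm_nonneg _) h 2
  rw [← sq_abs a, ← sq_abs b]
  nlinarith [sq_nonneg (|a| * ‖p‖ - |b| * ‖q‖)]
theorem gag_meas {v : Cv} (hv : Continuous v) (σ : ℝ) : Measurable fun z : ℝ × ℝ => oR (‖v z.2 - v z.1‖ ^ 2 / dT z.1 z.2 ^ σ) := by
  have h1 : Measurable fun z : ℝ × ℝ => v z.2 := (by fun_prop : Continuous _).measurable
  have h2 : Measurable fun z : ℝ × ℝ => v z.1 := (by fun_prop : Continuous _).measurable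
  have := measurable_dT
  fun_prop
theorem gag_mu2 {v : Cv} (hv : Continuous v) (σ : ℝ) : gagliardoSqE σ v = ∫⁻ z, oR (‖v z.2 - v z.1‖ ^ 2 / dT z.1 z.2 ^ (2 * σ + 1)) ∂mu2 :=
  (lint_mu2 (gag_meas hv _)).symm
theorem gag_comb {u v : Cv} (hu : Continuous u) (hv : Continuous v) (σ a b : ℝ) : gagliardoSqE σ (fun x => a • u x + b • v x) ≤ oR (2 * a ^ 2) * gagliardoSqE σ u + oR (2 * b ^ 2) * gagliardoSqE σ v := by
  rw [gag_mu2 hu, gag_mu2 hv, gag_mu2 (by fun_prop), ← lintegral_const_mul _ (gag_meas hu _), ← lintegral_const_mul _ (gag_meas hv _), ← lintegral_add_left ((gag_meas hu _).const_mul _)]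
  refine lintegral_mono fun z => ?_
  have hd : 0 ≤ dT z.1 z.2 ^ (2 * σ + 1) := rpow_nonneg (dT_nonneg _ _) _
  simp only
  rw [← ofReal_mul pz, ← ofReal_mul pz, ← ofReal_add pz pz]
  apply ofReal_le_ofReal
  rw [← mul_div_assoc, ← mul_div_assoc, ← add_div]
  refine div_le_div_of_nonneg_right ?_ hd
  have e : a • u z.2 + b • v z.2 - (a • u z.1 + b • v z.1) = a • (u z.2 - u z.1) + b • (v z.2 - v z.1) := by module
  rw [e]
  exact sq_comb _ _ _ _
theorem InHs.comb {u v : Cv} (hu : InHs s u) (hv : InHs s v) (a b : ℝ) : InHs s (fun x => a • u x + b • v x) := by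
  refine ⟨fun x => ?_, ?_, ?_⟩
  · simp only [hu.1 x, hv.1 x]
  · exact (hu.2.1.const_smul a).add (hv.2.1.const_smul b)
  · rw [deriv_comb hu hv]
    refine (gag_comb hu.cd hv.cd _ _ _).trans_lt ?_
    exact ENNReal.add_lt_top.2 ⟨ENNReal.mul_lt_top ofReal_lt_top hu.2.2, ENNReal.mul_lt_top ofReal_lt_top hv.2.2⟩
theorem intg_sq {v : Cv} (hv : Continuous v) : Integrable (fun x => ‖v x‖ ^ 2) (volume.restrict I01) :=
  ((by fun_prop : Continuous fun x => ‖v x‖ ^ 2).integrableOn_Icc).mono_set Ico_subset_Icc_self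
theorem l2_comb {u v : Cv} (hu : Continuous u) (hv : Continuous v) (a b : ℝ) : ∫ x in I01, ‖a • u x + b • v x‖ ^ 2 ≤ 2 * a ^ 2 * (∫ x in I01, ‖u x‖ ^ 2) + 2 * b ^ 2 * (∫ x in I01, ‖v x‖ ^ 2) := by
  rw [← integral_const_mul, ← integral_const_mul, ← integral_add ((intg_sq hu).const_mul _) ((intg_sq hv).const_mul _)]
  apply integral_mono (intg_sq (by fun_prop)) (((intg_sq hu).const_mul _).add
    ((intg_sq hv).const_mul _))
  intro x
  exact sq_comb _ _ _ _
theorem HsNormSq_comb {u v : Cv} (hu : InHs s u) (hv : InHs s v) (a b : ℝ) : HsNormSq s (fun x => a • u x + b • v x) ≤ 2 * a ^ 2 * HsNormSq s u + 2 * b ^ 2 * HsNormSq s v := by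
  unfold HsNormSq
  have h1 := l2_comb hu.c hv.c a b
  have h2 := l2_comb hu.cd hv.cd a b
  have h3 : (gagliardoSqE (s - 1) (fun x => a • deriv u x + b • deriv v x)).toReal ≤ 2 * a ^ 2 * (gS u).toReal + 2 * b ^ 2 * (gS v).toReal := by
    have := ENNReal.toReal_mono ?_ (gag_comb hu.cd hv.cd (s - 1) a b)
    · rwa [ENNReal.toReal_add, ENNReal.toReal_mul, ENNReal.toReal_mul, ENNReal.toReal_ofReal pz, ENNReal.toReal_ofReal pz] at this
      · exact (ENNReal.mul_lt_top ofReal_lt_top hu.2.2).ne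
      · exact (ENNReal.mul_lt_top ofReal_lt_top hv.2.2).ne
    · exact (ENNReal.add_lt_top.2 ⟨ENNReal.mul_lt_top ofReal_lt_top hu.2.2, ENNReal.mul_lt_top ofReal_lt_top hv.2.2⟩).ne
  rw [deriv_comb hu hv]
  nlinarith
theorem InHs.sub {u v : Cv} (hu : InHs s u) (hv : InHs s v) : InHs s (fun x => u x - v x) := by simpa [sub_eq_add_neg] using hu.comb hv 1 (-1)
theorem InHs.zero : InHs s (fun _ => (0 : En n)) := by
  refine ⟨fun _ => rfl, contDiff_const, ?_⟩
  simp [gagliardoSqE]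
theorem HsNorm_smul (u : Cv) (a : ℝ) : HsNorm s (fun x => a • u x) = |a| * HsNorm s u := by
  have hd : deriv (fun x => a • u x) = fun x => a • deriv u x := by funext x; simp [deriv_fun_const_smul_field]
  have hg : gagliardoSqE (s - 1) (fun x => a • deriv u x) = oR (a ^ 2) * gS u := by
    unfold gagliardoSqE
    rw [← lintegral_const_mul' _ _ ofReal_ne_top]
    refine lintegral_congr fun x => ?_
    rw [← lintegral_const_mul' _ _ ofReal_ne_top]
    refine lintegral_congr fun y => ?_
    rw [← ofReal_mul pz, ← smul_sub, norm_smul, mul_pow, norm_eq_abs, sq_abs, mul_div_assoc]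
  unfold HsNorm
  rw [← sqrt_sq_eq_abs, ← sqrt_mul (sq_nonneg a)]
  congr 1
  unfold HsNormSq
  rw [hd, hg, ENNReal.toReal_mul, ENNReal.toReal_ofReal (sq_nonneg a)]
  simp_rw [norm_smul, mul_pow, norm_eq_abs, sq_abs]
  rw [integral_const_mul, integral_const_mul]
  ring
theorem HsNorm_zero : HsNorm s (fun _ => (0 : En n)) = 0 := by simpa using HsNorm_smul (s := s) (fun _ => (0 : En n)) 0
def cl (t : ℝ) : ℝ := max 0 (min 1 t)
theorem cl_mem (t : ℝ) : cl t ∈ U1 := by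
  unfold cl; constructor
  · exact le_max_left _ _
  · exact max_le zero_le_one (min_le_left _ _)
theorem cl_eq {t : ℝ} (ht : t ∈ U1) : cl t = t := by unfold cl; rw [min_eq_right ht.2, max_eq_right ht.1]
theorem cl_cont : Continuous cl := by unfold cl; fun_prop
namespace C1Path
def Vx (P : C1Path s n) (t x : ℝ) : En n := P.V (cl t) x
def Vd (P : C1Path s n) (t x : ℝ) : En n := deriv (P.V (cl t)) x
def Gx (P : C1Path s n) (t x : ℝ) : En n := P.Γ 0 x + ∫ τ in (0:ℝ)..t, P.Vx τ x
def Gd (P : C1Path s n) (t x : ℝ) : En n := deriv (P.Γ 0) x + ∫ τ in (0:ℝ)..t, P.Vd τ x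
theorem V_cont (hs : 3/2 < s) (P : C1Path s n) : Continuous (Function.uncurry P.Vx) ∧ Continuous (Function.uncurry P.Vd) := by
  obtain ⟨C, hC, hsob⟩ := sobolev (n := n) hs
  have aux : ∀ t, Tendsto (fun τ => C * HsNorm s fun x => P.V (cl τ) x - P.V (cl t) x) (𝓝 t)
      (𝓝 0) := by
    intro t
    have h := (P.contV (cl t) (cl_mem t)).comp
      (tendsto_nhdsWithin_iff.2 ⟨cl_cont.tendsto t, Eventually.of_forall cl_mem⟩)
    simpa using h.const_mul C
  constructor
  · rw [continuous_iff_continuousAt]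
    rintro ⟨t, x⟩
    rw [ContinuousAt, tendsto_iff_norm_sub_tendsto_zero]
    have h1 : Tendsto (fun z : ℝ × ℝ => P.V (cl t) z.2 - P.V (cl t) x) (𝓝 (t, x)) (𝓝 0) := by
      have : Continuous fun z : ℝ × ℝ => P.V (cl t) z.2 - P.V (cl t) x := by
        have := (P.memV _ (cl_mem t)).c
        fun_prop
      simpa using this.tendsto (t, x)
    have h2 := ((aux t).comp (continuous_fst.tendsto (t, x))).add h1.norm
    simp only [norm_zero, add_zero] at h2
    refine squeeze_zero (fun _ => norm_nonneg _) (fun z => ?_) h2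
    have h3 := (hsob _ ((P.memV _ (cl_mem z.1)).sub (P.memV _ (cl_mem t))) z.2).1
    have h4 := norm_add_le (P.V (cl z.1) z.2 - P.V (cl t) z.2) (P.V (cl t) z.2 - P.V (cl t) x)
    rw [sub_add_sub_cancel] at h4
    exact h4.trans (by gcongr; exact h3)
  · rw [continuous_iff_continuousAt]
    rintro ⟨t, x⟩
    rw [ContinuousAt, tendsto_iff_norm_sub_tendsto_zero]
    have h1 : Tendsto (fun z : ℝ × ℝ => deriv (P.V (cl t)) z.2 - deriv (P.V (cl t)) x)
        (𝓝 (t, x)) (𝓝 0) := by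
      have : Continuous fun z : ℝ × ℝ => deriv (P.V (cl t)) z.2 - deriv (P.V (cl t)) x := by
        have := (P.memV _ (cl_mem t)).cd
        fun_prop
      simpa using this.tendsto (t, x)
    have h2 := ((aux t).comp (continuous_fst.tendsto (t, x))).add h1.norm
    simp only [norm_zero, add_zero] at h2
    refine squeeze_zero (fun _ => norm_nonneg _) (fun z => ?_) h2
    have h3 := (hsob _ ((P.memV _ (cl_mem z.1)).sub (P.memV _ (cl_mem t))) z.2).2
    rw [(((P.memV _ (cl_mem z.1)).hd z.2).fun_sub ((P.memV _ (cl_mem t)).hd z.2)).deriv] at h3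
    have h4 := norm_add_le (deriv (P.V (cl z.1)) z.2 - deriv (P.V (cl t)) z.2)
      (deriv (P.V (cl t)) z.2 - deriv (P.V (cl t)) x)
    rw [sub_add_sub_cancel] at h4
    exact h4.trans (by gcongr; exact h3)
theorem time_deriv (hs : 3/2 < s) (P : C1Path s n) {t : ℝ} (ht : t ∈ U1) (x : ℝ) : HasDerivWithinAt (fun t => P.Γ t x) (P.V t x) (Icc 0 1) t ∧ HasDerivWithinAt (fun t => deriv (P.Γ t) x) (deriv (P.V t) x) (Icc 0 1) t := by
  obtain ⟨C, hC, hsob⟩ := sobolev (n := n) hs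
  have hmap : Tendsto (fun τ => τ - t) (𝓝[U1 \ {t}] t)
      (𝓝[{h : ℝ | t + h ∈ U1 ∧ h ≠ 0}] 0) := by
    refine tendsto_nhdsWithin_iff.2 ⟨?_, ?_⟩
    · have : Tendsto (fun τ => τ - t) (𝓝 t) (𝓝 (t - t)) := by
        exact (continuous_id.sub continuous_const).tendsto t
      rw [sub_self] at this
      exact this.mono_left nhdsWithin_le_nhds
    · filter_upwards [self_mem_nhdsWithin] with τ hτ
      refine ⟨by simpa using hτ.1, sub_ne_zero.2 hτ.2⟩
  have h := ((P.isDeriv t ht).comp hmap).const_mul C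
  rw [mul_zero] at h
  have hmem : ∀ τ ∈ U1, InHs s (fun x => (τ - t)⁻¹ • (P.Γ (t + (τ - t)) x - P.Γ t x) - P.V t x) := by
    intro τ hτ
    have := (((P.mem τ hτ).1.sub (P.mem t ht).1).comb (P.memV t ht) (τ - t)⁻¹ (-1))
    simpa [sub_eq_add_neg] using this
  constructor
  · rw [hasDerivWithinAt_iff_tendsto_slope, tendsto_iff_norm_sub_tendsto_zero]
    refine squeeze_zero' (Eventually.of_forall fun _ => norm_nonneg _) ?_ h
    filter_upwards [self_mem_nhdsWithin] with τ hτ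
    have := (hsob _ (hmem τ hτ.1) x).1
    rw [slope_def_module]
    simpa using this
  · rw [hasDerivWithinAt_iff_tendsto_slope, tendsto_iff_norm_sub_tendsto_zero]
    refine squeeze_zero' (Eventually.of_forall fun _ => norm_nonneg _) ?_ h
    filter_upwards [self_mem_nhdsWithin] with τ hτ
    have := (hsob _ (hmem τ hτ.1) x).2
    rw [add_sub_cancel] at this
    rw [(((((P.mem τ hτ.1).1.hd x).fun_sub ((P.mem t ht).1.hd x)).fun_const_smul (τ - t)⁻¹).fun_sub
      ((P.memV t ht).hd x)).deriv] at this
    rw [slope_def_module]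
    simpa using this
theorem ftc_aux {F f : Cv} (hf : Continuous f) (hF : ∀ t ∈ U1, HasDerivWithinAt F (f t) (Icc 0 1) t) {t : ℝ} (ht : t ∈ U1) : F t = F 0 + ∫ τ in (0:ℝ)..t, f τ := by
  rw [intervalIntegral.integral_eq_sub_of_hasDerivAt_of_le ht.1
    (fun τ hτ => ((hF τ ⟨hτ.1, hτ.2.trans ht.2⟩).continuousWithinAt.mono
      (Icc_subset_Icc_right ht.2)))
    (fun τ hτ => (hF τ ⟨hτ.1.le, hτ.2.le.trans ht.2⟩).hasDerivAt
      (Icc_mem_nhds hτ.1 (hτ.2.trans_le ht.2))) (hf.intervalIntegrable _ _)]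
  abel
theorem Vx_ct (hs : 3/2 < s) (P : C1Path s n) (x : ℝ) : Continuous fun t => P.Vx t x :=
  (P.V_cont hs).1.comp (by fun_prop : Continuous fun t : ℝ => (t, x))
theorem Vd_ct (hs : 3/2 < s) (P : C1Path s n) (x : ℝ) : Continuous fun t => P.Vd t x :=
  (P.V_cont hs).2.comp (by fun_prop : Continuous fun t : ℝ => (t, x))
theorem G_eq (hs : 3/2 < s) (P : C1Path s n) {t : ℝ} (ht : t ∈ U1) (x : ℝ) : P.Γ t x = P.Gx t x ∧ deriv (P.Γ t) x = P.Gd t x := by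
  constructor
  · exact ftc_aux (F := fun t => P.Γ t x) (P.Vx_ct hs x) (fun τ hτ => by
      have := (P.time_deriv hs hτ x).1
      rwa [Vx, cl_eq hτ]) ht
  · exact ftc_aux (F := fun t => deriv (P.Γ t) x) (P.Vd_ct hs x) (fun τ hτ => by
      have := (P.time_deriv hs hτ x).2
      rwa [Vd, cl_eq hτ]) ht
theorem V_eq (P : C1Path s n) {t : ℝ} (ht : t ∈ U1) (x : ℝ) : P.V t x = P.Vx t x ∧ deriv (P.V t) x = P.Vd t x := by unfold Vx Vd; rw [cl_eq ht]; exact ⟨rfl, rfl⟩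
theorem Gx_hd (hs : 3/2 < s) (P : C1Path s n) (t x : ℝ) : HasDerivAt (fun t => P.Gx t x) (P.Vx t x) t ∧ HasDerivAt (fun t => P.Gd t x) (P.Vd t x) t :=
  ⟨((P.Vx_ct hs x).integral_hasStrictDerivAt 0 t).hasDerivAt.const_add _, ((P.Vd_ct hs x).integral_hasStrictDerivAt 0 t).hasDerivAt.const_add _⟩
theorem G_cont (hs : 3/2 < s) (P : C1Path s n) : Continuous (Function.uncurry P.Gx) ∧ Continuous (Function.uncurry P.Gd) := by
  have aux : ∀ f : ℝ → Cv, Continuous (Function.uncurry f) → Continuous fun z : ℝ × ℝ => ∫ τ in (0:ℝ)..z.1, f τ z.2 := by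
    intro f hf
    have := intervalIntegral.continuous_parametric_intervalIntegral_of_continuous
      (μ := volume) (a₀ := 0) (f := fun (z : ℝ × ℝ) τ => f τ z.2) (s := fun z => z.1)
      (hf.comp (by fun_prop : Continuous fun p : (ℝ × ℝ) × ℝ => (p.2, p.1.2))) continuous_fst
    exact this
  have h0 := (P.mem 0 (by simp)).1
  constructor
  · exact (h0.c.comp continuous_snd).add (aux _ (P.V_cont hs).1)
  · exact (h0.cd.comp continuous_snd).add (aux _ (P.V_cont hs).2)
end C1Path
def kk (s : ℝ) (a b d w p : En n) : ℝ :=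
  ‖w - ((‖a‖ ^ 2)⁻¹ * ⟪a, d⟫) • p‖ ^ 2 * (‖a‖ * ‖b‖) / ‖d‖ ^ (2 * s + 1)
def k1 (s : ℝ) (γ u : Cv) (x y : ℝ) : ℝ :=
  kk s (deriv γ x) (deriv γ y) (γ y - γ x) (u y - u x) (deriv u x)
def k2 (s : ℝ) (γ u : Cv) (x y : ℝ) : ℝ :=
  k1 s γ γ x y * (‖u y - u x‖ ^ 2 / ‖γ y - γ x‖ ^ 2)
def k3 (s : ℝ) (γ u : Cv) (x y : ℝ) : ℝ :=
  k1 s γ γ x y * (‖Dg γ u x‖ ^ 2 + ‖Dg γ u y‖ ^ 2)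
def I2 (k : ℝ → ℝ → ℝ) : ℝ≥0∞ := ∫⁻ z, oR (k z.1 z.2) ∂mu2
def I1 (k : ℝ → ℝ) : ℝ≥0∞ := ∫⁻ x in I01, oR (k x)
def l1 (γ u : Cv) (x : ℝ) : ℝ := ‖Dg γ u x‖ ^ 2 * ‖deriv γ x‖
def l0 (γ u : Cv) (x : ℝ) : ℝ := ‖u x‖ ^ 2 * ‖deriv γ x‖
def GE (s : ℝ) (γ u : Cv) : ℝ≥0∞ :=
  2 * I2 (k1 s γ u) + oR (2 * s + 1) * I2 (k2 s γ u) + I2 (k3 s γ u) + I1 (l1 γ u) + I1 (l0 γ u)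
theorem kk_nonneg (a b d w p : En n) : 0 ≤ kk s a b d w p := by unfold kk; positivity
theorem k1_nonneg (γ u : Cv) (x y) : 0 ≤ k1 s γ u x y := kk_nonneg _ _ _ _ _
theorem k2_nonneg (γ u : Cv) (x y) : 0 ≤ k2 s γ u x y :=
  mul_nonneg (k1_nonneg _ _ _ _) pz
theorem k3_nonneg (γ u : Cv) (x y) : 0 ≤ k3 s γ u x y :=
  mul_nonneg (k1_nonneg _ _ _ _) pz
theorem Rop_k1 (hs : 0 < s) (γ u : Cv) (x y : ℝ) : ‖Rop s γ u x y‖ ^ 2 * muW γ x y = k1 s γ u x y := by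
  unfold Rop muW k1 kk DDg
  rw [norm_smul, norm_inv, norm_eq_abs, abs_of_nonneg (rpow_nonneg (norm_nonneg _) _)]
  rcases eq_or_ne (γ y - γ x) 0 with h | h
  · rw [h]; simp [zero_rpow (by linarith : sP ≠ 0)]
  · have hp : 0 < ‖γ y - γ x‖ := norm_pos_iff.2 h
    have e : ‖γ y - γ x‖ ^ sP = (‖γ y - γ x‖ ^ s) ^ 2 * ‖γ y - γ x‖ := by rw [rpow_add hp, rpow_one, mul_comm 2 s, rpow_mul hp.le]; norm_num
    have h2 : 0 < ‖γ y - γ x‖ ^ s := rpow_pos_of_pos hp _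
    rw [e]
    field_simp
theorem kk_meas {X : Type*} [MeasurableSpace X] {a b d w p : X → En n} (ha : Measurable a) (hb : Measurable b) (hd : Measurable d) (hw : Measurable w) (hp : Measurable p) : Measurable fun z => kk s (a z) (b z) (d z) (w z) (p z) := by
  unfold kk
  have h1 : Measurable fun z => ⟪a z, d z⟫ := ha.inner hd
  have h2 : Measurable fun z => ((‖a z‖ ^ 2)⁻¹ * ⟪a z, d z⟫) • p z := by
    have h3 : Measurable fun z => (‖a z‖ ^ 2)⁻¹ * ⟪a z, d z⟫ := by fun_prop
    exact h3.smul hp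
  fun_prop
theorem meas_fst {f : Cv} (hf : Continuous f) : Measurable fun z : ℝ × ℝ => f z.1 :=
  (by fun_prop : Continuous _).measurable
theorem meas_snd {f : Cv} (hf : Continuous f) : Measurable fun z : ℝ × ℝ => f z.2 :=
  (by fun_prop : Continuous _).measurable
theorem k1_meas {γ u : Cv} (hγ : InHs s γ) (hu : InHs s u) : Measurable fun z : ℝ × ℝ => k1 s γ u z.1 z.2 :=
  kk_meas (meas_fst hγ.cd) (meas_snd hγ.cd) ((meas_snd hγ.c).sub (meas_fst hγ.c))
    ((meas_snd hu.c).sub (meas_fst hu.c)) (meas_fst hu.cd)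
theorem Dg_meas {γ u : Cv} (hγ : InHs s γ) (hu : InHs s u) : Measurable (Dg γ u) := by
  unfold Dg
  have := hγ.cd.measurable
  have := hu.cd.measurable
  fun_prop
theorem k2_meas {γ u : Cv} (hγ : InHs s γ) (hu : InHs s u) : Measurable fun z : ℝ × ℝ => k2 s γ u z.1 z.2 := by
  unfold k2
  have h1 := k1_meas hγ hγ
  have h2 := meas_fst hu.c
  have h3 := meas_snd hu.c
  have h4 := meas_fst hγ.c
  have h5 := meas_snd hγ.c
  exact h1.mul (((h3.sub h2).norm.pow_const 2).div ((h5.sub h4).norm.pow_const 2))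
theorem k3_meas {γ u : Cv} (hγ : InHs s γ) (hu : InHs s u) : Measurable fun z : ℝ × ℝ => k3 s γ u z.1 z.2 := by
  unfold k3
  have h1 := k1_meas hγ hγ
  have h2 := Dg_meas hγ hu
  fun_prop
theorem l1_meas {γ u : Cv} (hγ : InHs s γ) (hu : InHs s u) : Measurable (l1 γ u) := by
  unfold l1
  have h1 := Dg_meas hγ hu
  have := hγ.cd.measurable
  fun_prop
theorem l0_meas {γ u : Cv} (hγ : InHs s γ) (hu : InHs s u) : Measurable (l0 γ u) := by
  unfold l0
  have := hγ.cd.measurable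
  have := hu.c.measurable
  fun_prop
theorem bochner2 {k : ℝ → ℝ → ℝ} (hk : Measurable fun z : ℝ × ℝ => k z.1 z.2) (h0 : ∀ x y, 0 ≤ k x y) (hfin : I2 k < ⊤) : oR (∫ x in I01, ∫ y in I01, k x y) = I2 k ∧ 0 ≤ ∫ x in I01, ∫ y in I01, k x y := by
  have hi : Integrable (fun z : ℝ × ℝ => k z.1 z.2) mu2 := by
    refine ⟨hk.aestronglyMeasurable, ?_⟩
    rw [hasFiniteIntegral_iff_ofReal (Eventually.of_forall fun z => h0 _ _)]
    exact hfin
  have e : ∫ z, k z.1 z.2 ∂mu2 = ∫ x in I01, ∫ y in I01, k x y := integral_prod _ hi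
  rw [← e]
  exact ⟨ofReal_integral_eq_lintegral_ofReal hi (Eventually.of_forall fun z => h0 _ _), integral_nonneg fun z => h0 _ _⟩
theorem bochner1 {k : ℝ → ℝ} (hk : Measurable k) (h0 : ∀ x, 0 ≤ k x) (hfin : I1 k < ⊤) : oR (∫ x in I01, k x) = I1 k ∧ 0 ≤ ∫ x in I01, k x := by
  have hi : Integrable k (volume.restrict I01) := by
    refine ⟨hk.aestronglyMeasurable, ?_⟩
    rw [hasFiniteIntegral_iff_ofReal (Eventually.of_forall fun z => h0 _)]
    exact hfin
  exact ⟨ofReal_integral_eq_lintegral_ofReal hi (Eventually.of_forall fun z => h0 _), integral_nonneg fun z => h0 _⟩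
theorem Gmet_eq (hs : 0 < s) {γ u : Cv} (hγ : InHs s γ) (hu : InHs s u) (hfin : GE s γ u < ⊤) : oR (Gmet s γ u u) = GE s γ u ∧ 0 ≤ Gmet s γ u u := by
  have hf := hfin
  unfold GE at hf
  simp only [ENNReal.add_lt_top] at hf
  obtain ⟨⟨⟨⟨f1, f2⟩, f3⟩, f4⟩, f5⟩ := hf
  have f1 : I2 (k1 s γ u) < ⊤ := by
    refine lt_of_le_of_lt ?_ f1
    conv_lhs => rw [← one_mul (I2 _)]
    gcongr; norm_num
  have f2 : I2 (k2 s γ u) < ⊤ := by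
    refine lt_of_le_of_lt ?_ f2
    conv_lhs => rw [← one_mul (I2 _)]
    gcongr; rw [← ENNReal.ofReal_one]; exact ofReal_le_ofReal (by linarith)
  have e1 := bochner2 (k1_meas hγ hu) (k1_nonneg γ u) f1
  have e2 := bochner2 (k2_meas hγ hu) (k2_nonneg γ u) f2
  have e3 := bochner2 (k3_meas hγ hu) (k3_nonneg γ u) f3
  have e4 := bochner1 (l1_meas hγ hu) (fun x => by unfold l1; positivity) f4
  have e5 := bochner1 (l0_meas hγ hu) (fun x => by unfold l0; positivity) f5
  have E : Gmet s γ u u = 2 * (∫ x in I01, ∫ y in I01, k1 s γ u x y) + sP * (∫ x in I01, ∫ y in I01, k2 s γ u x y) + (∫ x in I01, ∫ y in I01, k3 s γ u x y) + (∫ x in I01, l1 γ u x) + (∫ x in I01, l0 γ u x) := by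
    unfold Gmet B1 B2 B3 innerH1g innerL2g
    simp only [real_inner_self_eq_norm_sq, Rop_k1 hs, mul_right_comm _ _ (muW _ _ _)]
    rfl
  have hs' : 0 ≤ 2 * s + 1 := by linarith
  rw [E]
  refine ⟨?_, ?_⟩
  · have := e1.2; have := e2.2; have := e3.2; have := e4.2; have := e5.2
    rw [ofReal_add pz pz, ofReal_add pz pz, ofReal_add pz pz, ofReal_add pz pz, ofReal_mul (by norm_num), ofReal_mul hs', e1.1, e2.1, e3.1, e4.1, e5.1]
    unfold GE
    simp
  · have := e1.2; have := e2.2; have := e3.2; have := e4.2; have := e5.2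
    positivity
structure Good (s c K A : ℝ) (γ : Cv) : Prop where
  hs : InHs s γ
  chord : ∀ x h, |h| ≤ 1/2 → c * |h| ≤ ‖γ (x + h) - γ x‖
  lb : ∀ x, c ≤ ‖deriv γ x‖
  ub : ∀ x, ‖deriv γ x‖ ≤ K
  gag : gagliardoSqE (s - 1) (deriv γ) ≤ oR A
theorem k1_bd (hs : 3/2 < s) {c K A U : ℝ} (hc : 0 < c) {γ u : Cv} (hγ : Good s c K A γ) (hU : ∀ x, ‖deriv u x‖ ≤ U) (x h : ℝ) (hh : |h| ≤ 1/2) : k1 s γ u x (x + h) ≤ 2 * K ^ 2 / c ^ sP * (‖u (x + h) - u x - h • deriv u x‖ ^ 2 / |h| ^ sP + U ^ 2 / c ^ 2 * (‖γ (x + h) - γ x - h • deriv γ x‖ ^ 2 / |h| ^ sP)) := by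
  have hK : 0 ≤ K := (norm_nonneg _).trans (hγ.ub 0)
  have hU0 : 0 ≤ U := (norm_nonneg _).trans (hU 0)
  rcases eq_or_ne h 0 with rfl | h0
  · simp [k1, kk]
  have h0' : 0 < |h| := abs_pos.2 h0
  have hch := hγ.chord x h hh
  have ha := hγ.lb x
  unfold k1 kk
  set a := deriv γ x
  set d := γ (x + h) - γ x
  set p := deriv u x
  have ha0 : 0 < ‖a‖ := hc.trans_le ha
  have e : u (x + h) - u x - ((‖a‖ ^ 2)⁻¹ * ⟪a, d⟫) • p = (u (x + h) - u x - h • p) - ((‖a‖ ^ 2)⁻¹ * ⟪a, d - h • a⟫) • p := by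
    rw [inner_sub_right a d, inner_smul_right, real_inner_self_eq_norm_sq]
    rw [mul_sub, show (‖a‖ ^ 2)⁻¹ * (h * ‖a‖ ^ 2) = h by field_simp]
    module
  rw [e]
  set r := u (x + h) - u x - h • p
  set q := d - h • a
  have h1 : ‖((‖a‖ ^ 2)⁻¹ * ⟪a, q⟫) • p‖ ≤ U / c * ‖q‖ := by
    rw [norm_smul, norm_mul, norm_inv, norm_pow, norm_norm]
    have := norm_inner_le_norm (𝕜 := ℝ) a q
    calc _ ≤ (‖a‖ ^ 2)⁻¹ * (‖a‖ * ‖q‖) * U := by gcongr; exact hU x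
      _ = U / ‖a‖ * ‖q‖ := by field_simp
      _ ≤ _ := by gcongr
  have h2 : ‖r - ((‖a‖ ^ 2)⁻¹ * ⟪a, q⟫) • p‖ ^ 2 ≤ 2 * ‖r‖ ^ 2 + 2 * (U ^ 2 / c ^ 2 * ‖q‖ ^ 2) := by
    have h3 : ‖r - ((‖a‖ ^ 2)⁻¹ * ⟪a, q⟫) • p‖ ≤ ‖r‖ + U / c * ‖q‖ :=
      (norm_sub_le _ _).trans (by linarith)
    have := pow_le_pow_left₀ (norm_nonneg _) h3 2
    have e : U ^ 2 / c ^ 2 * ‖q‖ ^ 2 = (U / c * ‖q‖) ^ 2 := by rw [mul_pow, div_pow]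
    rw [e]
    nlinarith [sq_nonneg (‖r‖ - U / c * ‖q‖)]
  have h4 : c ^ sP * |h| ^ sP ≤ ‖d‖ ^ sP := by
    rw [← mul_rpow hc.le h0'.le]
    exact rpow_le_rpow pz hch (by linarith)
  have h5 : 0 < c ^ sP := rpow_pos_of_pos hc _
  have h6 : 0 < |h| ^ sP := rpow_pos_of_pos h0' _
  calc _ ≤ (2 * ‖r‖ ^ 2 + 2 * (U ^ 2 / c ^ 2 * ‖q‖ ^ 2)) * (K * K) / (c ^ sP * |h| ^ sP) := by
        gcongr
        · exact hγ.ub x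
        · exact hγ.ub _
    _ = _ := by field_simp
theorem I2_shift {k : ℝ → ℝ → ℝ} (hk : Measurable fun z : ℝ × ℝ => k z.1 z.2) (hp : ∀ x, Function.Periodic (k x) 1) : I2 k = ∫⁻ x in I01, ∫⁻ h in J1, oR (k x (x + h)) := by
  unfold I2
  rw [lint_mu2 (by fun_prop)]
  refine lintegral_congr fun x => ?_
  rw [lint_shift (fun y => ?_) x]
  rw [hp x y]
theorem I2_k1_bd (hs : 3/2 < s) {c K A U : ℝ} (hc : 0 < c) {γ u : Cv} (hγ : Good s c K A γ) (hu : InHs s u) (hU : ∀ x, ‖deriv u x‖ ≤ U) : I2 (k1 s γ u) ≤ oR (2 * K ^ 2 / c ^ sP) * (gS u + oR (U ^ 2 / c ^ 2) * oR A) := by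
  have h5 : 0 < c ^ sP := rpow_pos_of_pos hc _
  rw [I2_shift (k1_meas hγ.hs hu) (fun x y => by
    simp only [k1, hγ.hs.1 y, hu.1 y, per_deriv hγ.hs.1 y])]
  set R : (Cv) → ℝ → ℝ → ℝ≥0∞ := fun u x h =>
    oR (‖u (x + h) - u x - h • deriv u x‖ ^ 2 / |h| ^ sP) with hR
  have hRm : ∀ u : Cv, InHs s u → Measurable (Function.uncurry (R u)) := by
    intro u hu
    have h1 : Measurable fun z : ℝ × ℝ => u (z.1 + z.2) - u z.1 - z.2 • deriv u z.1 := by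
      have := hu.c; have := hu.cd
      exact (by fun_prop : Continuous _).measurable
    simp only [hR, Function.uncurry_def]
    fun_prop
  calc _ ≤ ∫⁻ x in I01, ∫⁻ h in J1, oR (2 * K ^ 2 / c ^ sP) * (R u x h + oR (U ^ 2 / c ^ 2) * R γ x h) := by
        refine lintegral_mono fun x => setLIntegral_mono' measurableSet_Ioc fun h hh => ?_
        simp only [hR]
        rw [← ofReal_mul pz, ← ofReal_add pz
          pz, ← ofReal_mul pz]
        exact ofReal_le_ofReal (k1_bd hs hc hγ hU x h (abs_le.2 ⟨hh.1.le, hh.2⟩))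
    _ = oR (2 * K ^ 2 / c ^ sP) * ((∫⁻ x in I01, ∫⁻ h in J1, R u x h) + oR (U ^ 2 / c ^ 2) * ∫⁻ x in I01, ∫⁻ h in J1, R γ x h) := by
        simp_rw [lintegral_const_mul' _ _ ofReal_ne_top]
        congr 1
        have e : ∀ x, ∫⁻ h in J1, (R u x h + oR (U ^ 2 / c ^ 2) * R γ x h) = (∫⁻ h in J1, R u x h) + oR (U ^ 2 / c ^ 2) * ∫⁻ h in J1, R γ x h := fun x => by
          rw [lintegral_add_left (Measurable.of_uncurry_left (hRm u hu)), lintegral_const_mul' _ _ ofReal_ne_top]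
        simp_rw [e]
        rw [lintegral_add_left (hRm u hu).lintegral_prod_right, lintegral_const_mul' _ _ ofReal_ne_top]
    _ ≤ _ := by
        gcongr
        · exact remainder_bound hs hu
        · exact (remainder_bound hs hγ.hs).trans hγ.gag
theorem I2_mul_le {k k' : ℝ → ℝ → ℝ} {C : ℝ} (hC : 0 ≤ C) (h : ∀ x ∈ I01, ∀ y ∈ I01, k x y ≤ C * k' x y) : I2 k ≤ oR C * I2 k' := by
  unfold I2
  rw [← lintegral_const_mul' _ _ ofReal_ne_top]
  have hm : ∀ᵐ z ∂mu2, z ∈ I01 ×ˢ I01 := by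
    unfold mu2
    rw [Measure.prod_restrict]
    exact ae_restrict_mem (measurableSet_Ico.prod measurableSet_Ico)
  refine lintegral_mono_ae ?_
  filter_upwards [hm] with z hz
  rw [← ofReal_mul hC]
  exact ofReal_le_ofReal (h _ hz.1 _ hz.2)
theorem I1_le {k : ℝ → ℝ} {C : ℝ} (h : ∀ x, k x ≤ C) : I1 k ≤ oR C := by
  unfold I1
  calc _ ≤ ∫⁻ x in I01, oR C := lintegral_mono fun x => ofReal_le_ofReal (h x)
    _ = _ := by simp
theorem Good.slope_le {c K A U : ℝ} (hc : 0 < c) {γ u : Cv} (hγ : Good s c K A γ) (hu : InHs s u) (hU : ∀ x, ‖deriv u x‖ ≤ U) (x y : ℝ) : ‖u y - u x‖ ^ 2 / ‖γ y - γ x‖ ^ 2 ≤ U ^ 2 / c ^ 2 := by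
  have hU0 : 0 ≤ U := (norm_nonneg _).trans (hU 0)
  obtain ⟨h, k, hh, rfl⟩ := exists_shift x y
  rw [per_int hu.1, per_int hγ.hs.1]
  rw [← div_pow, ← div_pow]
  refine pow_le_pow_left₀ pz ?_ 2
  have h1 := lip_of_sup hu hU x (x + h)
  rw [add_sub_cancel_left] at h1
  have h2 := hγ.chord x h hh
  rcases eq_or_lt_of_le (norm_nonneg (γ (x + h) - γ x)) with h0 | h0
  · rw [← h0]; simp; positivity
  rw [div_le_div_iff₀ h0 hc]
  nlinarith
theorem Good.Dg_le {c K A U : ℝ} (hc : 0 < c) {γ u : Cv} (hγ : Good s c K A γ) (hU : ∀ x, ‖deriv u x‖ ≤ U) (x : ℝ) : ‖Dg γ u x‖ ^ 2 ≤ U ^ 2 / c ^ 2 := by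
  rw [← div_pow]
  gcongr
  unfold Dg
  have h1 := hγ.lb x
  have h2 := hU x
  rw [norm_smul, norm_inv, norm_norm, inv_mul_eq_div]
  have hU0 : 0 ≤ U := (norm_nonneg _).trans (hU 0)
  gcongr
theorem upper (hs : 3/2 < s) {c : ℝ} (hc : 0 < c) (K A : ℝ) : ∃ C : ℝ, 0 < C ∧ ∀ γ u : Cv, Good s c K A γ → InHs s u → GE s γ u ≤ oR (C * HsNorm s u ^ 2) := by
  obtain ⟨S, hS, hsob⟩ := sobolev (n := n) hs
  set M := 2 * K ^ 2 / c ^ sP with hM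
  have hM0 : 0 ≤ M := by positivity
  set A' := |A| with hA'
  set E0 := M * (A' + K ^ 2 / c ^ 2 * A') with hE0
  have hE00 : 0 ≤ E0 := by positivity
  set q := S ^ 2 / c ^ 2 with hq
  set C := 2 * (M * (1 + q * A')) + sP * (q * E0) + 2 * q * E0 + q * |K| + S ^ 2 * |K|
    with hCdef
  have hC0 : 0 ≤ C := by
    have : 0 ≤ 2 * s + 1 := by linarith
    positivity
  refine ⟨C + 1, by positivity, fun γ u hγ hu => ?_⟩
  set N := HsNorm s u with hN
  have hN0 : 0 ≤ N := HsNorm_nonneg u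
  have hU : ∀ x, ‖deriv u x‖ ≤ S * N := fun x => (hsob u hu x).2
  have hK : 0 ≤ K := (norm_nonneg _).trans (hγ.ub 0)
  have hqq : (S * N) ^ 2 / c ^ 2 = q * N ^ 2 := by rw [hq]; ring
  have hgA : gS γ ≤ oR A' :=
    hγ.gag.trans (ofReal_le_ofReal (le_abs_self A))
  have hAA : oR A ≤ oR A' := ofReal_le_ofReal (le_abs_self A)
  have b0 : I2 (k1 s γ γ) ≤ oR E0 := by
    refine (I2_k1_bd hs hc hγ hγ.hs hγ.ub).trans ?_
    rw [hE0, ofReal_mul hM0, ofReal_add pz pz, ofReal_mul pz]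
    gcongr
  have b1 : I2 (k1 s γ u) ≤ oR (M * (1 + q * A') * N ^ 2) := by
    refine (I2_k1_bd hs hc hγ hu hU).trans ?_
    rw [show M * (1 + q * A') * N ^ 2 = M * (N ^ 2 + (S * N) ^ 2 / c ^ 2 * A') by
      rw [hqq]; ring, ofReal_mul hM0, ofReal_add pz pz,
      ofReal_mul pz]
    gcongr
    exact gag_le_Hs hu
  have b2 : I2 (k2 s γ u) ≤ oR (q * E0 * N ^ 2) := by
    refine (I2_mul_le (C := q * N ^ 2) (k' := k1 s γ γ) pz fun x _ y _ => ?_).trans ?_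
    · unfold k2
      rw [mul_comm, ← hqq]
      exact mul_le_mul_of_nonneg_right (hγ.slope_le hc hu hU x y) (k1_nonneg _ _ _ _)
    · rw [show q * E0 * N ^ 2 = q * N ^ 2 * E0 by ring, ofReal_mul (p := q * N ^ 2) pz]
      exact mul_le_mul_right b0 _
  have b3 : I2 (k3 s γ u) ≤ oR (2 * q * E0 * N ^ 2) := by
    refine (I2_mul_le (C := 2 * (q * N ^ 2)) (k' := k1 s γ γ) pz
      fun x _ y _ => ?_).trans ?_
    · unfold k3
      rw [mul_comm, ← hqq]
      refine mul_le_mul_of_nonneg_right ?_ (k1_nonneg _ _ _ _)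
      linarith [hγ.Dg_le hc hU x, hγ.Dg_le hc hU y]
    · rw [show 2 * q * E0 * N ^ 2 = 2 * (q * N ^ 2) * E0 by ring, ofReal_mul (p := 2 * (q * N ^ 2)) pz]
      exact mul_le_mul_right b0 _
  have b4 : I1 (l1 γ u) ≤ oR (q * |K| * N ^ 2) := by
    apply I1_le
    intro x
    unfold l1
    calc _ ≤ q * N ^ 2 * |K| := by
          gcongr
          · rw [← hqq]; exact hγ.Dg_le hc hU x
          · exact (hγ.ub x).trans (le_abs_self K)
      _ = _ := by ring
  have b5 : I1 (l0 γ u) ≤ oR (S ^ 2 * |K| * N ^ 2) := by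
    apply I1_le
    intro x
    unfold l0
    calc _ ≤ (S * N) ^ 2 * |K| := by
          gcongr
          · exact (hsob u hu x).1
          · exact (hγ.ub x).trans (le_abs_self K)
      _ = _ := by ring
  have hs' : 0 ≤ 2 * s + 1 := by linarith
  calc GE s γ u ≤ 2 * oR (M * (1 + q * A') * N ^ 2) + oR sP * oR (q * E0 * N ^ 2) + oR (2 * q * E0 * N ^ 2) + oR (q * |K| * N ^ 2) + oR (S ^ 2 * |K| * N ^ 2) := by unfold GE; gcongr
    _ = oR (C * N ^ 2) := by
      rw [show (2 : ℝ≥0∞) = oR 2 by simp, ← ofReal_mul (by norm_num), ← ofReal_mul hs', ← ofReal_add pz pz, ← ofReal_add pz pz, ← ofReal_add pz pz, ← ofReal_add pz pz]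
      congr 1; rw [hCdef]; ring
    _ ≤ _ := ofReal_le_ofReal (by nlinarith [sq_nonneg N])
theorem inj_mod {γ : Cv} (hγ : InM s γ) {a b : ℝ} (h : γ a = γ b) : ∃ k : ℤ, a = b + k := by
  have e : ∀ a, γ (Int.fract a) = γ a := fun a => by
    have := per_int hγ.1.1 (Int.fract a) ⌊a⌋
    rw [← this, Int.fract_add_floor]
  have := hγ.2.1 (show Int.fract a ∈ I01 from ⟨Int.fract_nonneg _, Int.fract_lt_one _⟩)
    (show Int.fract b ∈ I01 from ⟨Int.fract_nonneg _, Int.fract_lt_one _⟩)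
    (by rw [e, e, h])
  refine ⟨⌊a⌋ - ⌊b⌋, ?_⟩
  have h1 := Int.fract_add_floor a
  have h2 := Int.fract_add_floor b
  push_cast; linarith
theorem ftc_h {u : Cv} (hu : InHs s u) (x h : ℝ) : u (x + h) - u x = h • ∫ θ in (0:ℝ)..1, deriv u (x + θ * h) := by
  have hc := hu.cd
  have := rem_eq hu x h
  rw [intervalIntegral.integral_sub, smul_sub] at this
  · simpa using this
  all_goals exact (by fun_prop : Continuous _).intervalIntegrable _ _
theorem loc_bdd {f : ℝ → ℝ} (h : ∀ t ∈ U1, ∃ M, ∀ᶠ τ in 𝓝[U1] t, f τ ≤ M) : ∃ M, ∀ t ∈ U1, f t ≤ M := by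
  refine isCompact_Icc.induction_on (p := fun S => ∃ M, ∀ t ∈ S, f t ≤ M) ⟨0, by simp⟩ ?_ ?_ ?_
  · rintro S T hST ⟨M, hM⟩
    exact ⟨M, fun t ht => hM t (hST ht)⟩
  · rintro S T ⟨M, hM⟩ ⟨M', hM'⟩
    refine ⟨max M M', fun t ht => ?_⟩
    rcases ht with ht | ht
    · exact (hM t ht).trans (le_max_left _ _)
    · exact (hM' t ht).trans (le_max_right _ _)
  · intro t ht
    obtain ⟨M, hM⟩ := h t ht
    exact ⟨{τ | f τ ≤ M}, hM, M, fun _ h => h⟩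
namespace C1Path
theorem V_bdd (P : C1Path s n) : ∃ M, ∀ t ∈ U1, HsNormSq s (P.V t) ≤ M := by
  apply loc_bdd
  intro t ht
  refine ⟨2 * 1 ^ 2 * 1 + 2 * 1 ^ 2 * HsNormSq s (P.V t), ?_⟩
  have h := (P.contV t ht).eventually (gt_mem_nhds zero_lt_one)
  filter_upwards [h, self_mem_nhdsWithin] with τ h1 hτ
  have h2 := HsNormSq_comb ((P.memV τ hτ).sub (P.memV t ht)) (P.memV t ht) 1 1
  simp only [one_smul, sub_add_cancel] at h2
  refine h2.trans ?_
  rw [← HsNorm_sq (fun x => P.V τ x - P.V t x)]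
  have := HsNorm_nonneg (s := s) (fun x => P.V τ x - P.V t x)
  gcongr
  nlinarith
theorem G_bdd (P : C1Path s n) : ∃ M, ∀ t ∈ U1, HsNormSq s (P.Γ t) ≤ M := by
  apply loc_bdd
  intro t ht
  set Q := 2 * 1 ^ 2 * HsNormSq s (P.Γ t) + 2 * 1 * (2 * 1 ^ 2 * HsNormSq s (P.V t) + 2 * 1 ^ 2 * 1) with hQ
  refine ⟨max (HsNormSq s (P.Γ t)) Q, ?_⟩
  have hmap : Tendsto (fun τ => τ - t) (𝓝[U1 \ {t}] t)
      (𝓝[{h : ℝ | t + h ∈ U1 ∧ h ≠ 0}] 0) := by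
    refine tendsto_nhdsWithin_iff.2 ⟨?_, ?_⟩
    · have : Tendsto (fun τ => τ - t) (𝓝 t) (𝓝 (t - t)) := by
        exact (continuous_id.sub continuous_const).tendsto t
      rw [sub_self] at this
      exact this.mono_left nhdsWithin_le_nhds
    · filter_upwards [self_mem_nhdsWithin] with τ hτ
      refine ⟨by simpa using hτ.1, sub_ne_zero.2 hτ.2⟩
  have h := ((P.isDeriv t ht).comp hmap).eventually (gt_mem_nhds zero_lt_one)
  rw [eventually_nhdsWithin_iff] at h ⊢
  filter_upwards [h] with τ hτ1 hτ
  by_cases hne : τ = t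
  · rw [hne]; exact le_max_left _ _
  refine le_trans ?_ (le_max_right _ _)
  have h1 := hτ1 ⟨hτ, hne⟩
  simp only [Function.comp, add_sub_cancel] at h1
  have hw : InHs s (fun x => (τ - t)⁻¹ • (P.Γ τ x - P.Γ t x) - P.V t x) := by
    have := (((P.mem τ hτ).1.sub (P.mem t ht).1).comb (P.memV t ht) (τ - t)⁻¹ (-1))
    simpa [sub_eq_add_neg] using this
  have h2 := HsNormSq_comb (P.memV t ht) hw 1 1
  have h3 := HsNormSq_comb (P.mem t ht).1 ((P.memV t ht).comb hw 1 1) 1 (τ - t)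
  have e : (fun x => (1:ℝ) • P.Γ t x + (τ - t) • ((1:ℝ) • P.V t x + (1:ℝ) • ((τ - t)⁻¹ • (P.Γ τ x - P.Γ t x) - P.V t x))) = P.Γ τ := by
    funext x
    rw [one_smul, one_smul, one_smul, add_sub_cancel, smul_smul, mul_inv_cancel₀ (sub_ne_zero.2 hne), one_smul, add_sub_cancel]
  rw [e] at h3
  refine h3.trans ?_
  rw [hQ]
  have h4 : (τ - t) ^ 2 ≤ 1 := by
    rw [sq_le_one_iff_abs_le_one, abs_le]
    constructor <;> linarith [hτ.1, hτ.2, ht.1, ht.2]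
  have h5 : HsNormSq s (fun x => (τ - t)⁻¹ • (P.Γ τ x - P.Γ t x) - P.V t x) ≤ 1 := by
    rw [← HsNorm_sq]
    have := HsNorm_nonneg (s := s) (fun x => (τ - t)⁻¹ • (P.Γ τ x - P.Γ t x) - P.V t x)
    nlinarith
  have h6 := HsNormSq_nonneg (s := s) (P.V t)
  have h7 := HsNormSq_nonneg (s := s)
    (fun x => (1:ℝ) • P.V t x + (1:ℝ) • ((τ - t)⁻¹ • (P.Γ τ x - P.Γ t x) - P.V t x))
  gcongr
  refine h2.trans ?_
  gcongr
theorem chord_bd (hs : 3/2 < s) (P : C1Path s n) : ∃ c > 0, ∀ t ∈ U1, (∀ x h, |h| ≤ 1/2 → c * |h| ≤ ‖P.Γ t (x + h) - P.Γ t x‖) ∧ ∀ x, c ≤ ‖deriv (P.Γ t) x‖ := by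
  have hG := (P.G_cont hs).2
  set q : ℝ × ℝ × ℝ → ℝ := fun p => ‖∫ θ in (0:ℝ)..1, P.Gd p.1 (p.2.1 + θ * p.2.2)‖
  have hq : Continuous q := by
    apply Continuous.norm
    apply intervalIntegral.continuous_parametric_intervalIntegral_of_continuous'
    exact hG.comp (by fun_prop : Continuous fun z : (ℝ × ℝ × ℝ) × ℝ =>
      (z.1.1, z.1.2.1 + z.2 * z.1.2.2))
  have hqe : ∀ t ∈ U1, ∀ x h, ‖P.Γ t (x + h) - P.Γ t x‖ = q (t, x, h) * |h| := by
    intro t ht x h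
    rw [ftc_h (P.mem t ht).1, norm_smul, norm_eq_abs, mul_comm]
    congr 2
    refine intervalIntegral.integral_congr fun θ _ => ?_
    exact (P.G_eq hs ht _).2
  have hq0 : ∀ t ∈ U1, ∀ x, q (t, x, 0) = ‖deriv (P.Γ t) x‖ := by
    intro t ht x
    simp [q, (P.G_eq hs ht x).2]
  set S : Set (ℝ × ℝ × ℝ) := U1 ×ˢ (U1 ×ˢ Icc (-(1/2):ℝ) (1/2))
  have hS : IsCompact S := isCompact_Icc.prod (isCompact_Icc.prod isCompact_Icc)
  obtain ⟨⟨t0, x0, h0⟩, hm, hmin⟩ := hS.exists_isMinOn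
    ⟨(0, 0, 0), by simp [S]⟩ hq.continuousOn
  have hM := P.mem t0 hm.1
  have hpos : 0 < q (t0, x0, h0) := by
    by_cases hh : h0 = 0
    · rw [hh, hq0 _ hm.1]; exact norm_pos_iff.2 (hM.2.2 _)
    · have h1 := hqe t0 hm.1 x0 h0
      rcases (norm_nonneg (P.Γ t0 (x0 + h0) - P.Γ t0 x0)).eq_or_lt with h2 | h2
      · exfalso
        obtain ⟨k, hk⟩ := inj_mod hM (sub_eq_zero.1 (norm_eq_zero.1 h2.symm))
        have hk' : h0 = k := by linarith
        have hk0 : k ≠ 0 := by rintro rfl; simp at hk'; exact hh hk'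
        have := Int.one_le_abs hk0
        have h3 : (1:ℝ) ≤ |(k:ℝ)| := by exact_mod_cast this
        have h4 : |h0| ≤ 1/2 := abs_le.2 hm.2.2
        rw [hk'] at h4
        linarith
      · rw [h1] at h2
        exact pos_of_mul_pos_left h2 (abs_nonneg _)
  refine ⟨q (t0, x0, h0), hpos, fun t ht => ?_⟩
  have hall : ∀ x h, |h| ≤ 1/2 → q (t0, x0, h0) ≤ q (t, Int.fract x, h) := fun x h hh =>
    hmin (show (t, Int.fract x, h) ∈ S from
      ⟨ht, ⟨Int.fract_nonneg _, (Int.fract_lt_one _).le⟩, abs_le.1 hh⟩)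
  have hper := (P.mem t ht).1.1
  constructor
  · intro x h hh
    have := hqe t ht (Int.fract x) h
    rw [← per_int hper (Int.fract x + h) ⌊x⌋, ← per_int hper (Int.fract x) ⌊x⌋, add_right_comm, Int.fract_add_floor] at this
    rw [this]
    exact mul_le_mul_of_nonneg_right (hall x h hh) (abs_nonneg _)
  · intro x
    have := hall x 0 (by simp)
    rw [hq0 t ht, ← per_int (per_deriv hper) (Int.fract x) ⌊x⌋, Int.fract_add_floor] at this
    exact this
theorem good (hs : 3/2 < s) (P : C1Path s n) : ∃ c K A : ℝ, 0 < c ∧ 0 ≤ A ∧ ∀ t ∈ U1, Good s c K A (P.Γ t) := by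
  obtain ⟨c, hc, h1⟩ := P.chord_bd hs
  obtain ⟨A, hA⟩ := P.G_bdd
  obtain ⟨C, hC, hsob⟩ := sobolev (n := n) hs
  have hA0 : 0 ≤ A := (HsNormSq_nonneg _).trans (hA 0 (by simp))
  refine ⟨c, C * √A, A, hc, hA0, fun t ht => ⟨(P.mem t ht).1, (h1 t ht).1, (h1 t ht).2, fun x => ?_, ?_⟩⟩
  · refine (hsob _ (P.mem t ht).1 x).2.trans ?_
    gcongr
    exact sqrt_le_sqrt (hA t ht)
  · refine (gag_le_Hs (P.mem t ht).1).trans (ofReal_le_ofReal ?_)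
    rw [HsNorm_sq]; exact hA t ht
theorem GE_bdd (hs : 3/2 < s) (P : C1Path s n) : ∃ B : ℝ, 0 ≤ B ∧ ∀ t ∈ U1, GE s (P.Γ t) (P.V t) ≤ oR B := by
  obtain ⟨c, K, A, hc, -, h⟩ := P.good hs
  obtain ⟨C, hC, h2⟩ := upper (n := n) hs hc K A
  obtain ⟨M, hM⟩ := P.V_bdd
  have : 0 ≤ M := (HsNormSq_nonneg _).trans (hM 0 (by simp))
  refine ⟨C * M, by positivity, fun t ht => (h2 _ _ (h t ht) (P.memV t ht)).trans ?_⟩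
  apply ofReal_le_ofReal
  rw [HsNorm_sq]
  have := hM t ht
  gcongr
end C1Path
theorem cx_meas {f : ℝ → Cv} (hf : Continuous fun z : ℝ × ℝ => f z.1 z.2) : Measurable fun p : ℝ × ℝ × ℝ => f p.1 p.2.1 :=
  (hf.comp (by fun_prop : Continuous fun p : ℝ × ℝ × ℝ => (p.1, p.2.1))).measurable
theorem cy_meas {f : ℝ → Cv} (hf : Continuous fun z : ℝ × ℝ => f z.1 z.2) : Measurable fun p : ℝ × ℝ × ℝ => f p.1 p.2.2 :=
  (hf.comp (by fun_prop : Continuous fun p : ℝ × ℝ × ℝ => (p.1, p.2.2))).measurable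
theorem k1_fam {γ v : ℝ → Cv} (h1 : Continuous fun z : ℝ × ℝ => γ z.1 z.2) (h2 : Continuous fun z : ℝ × ℝ => deriv (γ z.1) z.2) (h3 : Continuous fun z : ℝ × ℝ => v z.1 z.2) (h4 : Continuous fun z : ℝ × ℝ => deriv (v z.1) z.2) : Measurable fun p : ℝ × ℝ × ℝ => k1 s (γ p.1) (v p.1) p.2.1 p.2.2 := by
  have a := cx_meas (f := fun t => deriv (γ t)) h2
  have b := cy_meas (f := fun t => deriv (γ t)) h2
  have c := (cy_meas h1).sub (cx_meas h1)
  have d := (cy_meas h3).sub (cx_meas h3)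
  have e := cx_meas (f := fun t => deriv (v t)) h4
  unfold k1
  exact kk_meas a b c d e
theorem Dg_fam {γ u : ℝ → Cv} (h2 : Continuous fun z : ℝ × ℝ => deriv (γ z.1) z.2) (h4 : Continuous fun z : ℝ × ℝ => deriv (u z.1) z.2) : Measurable fun z : ℝ × ℝ => Dg (γ z.1) (u z.1) z.2 := by
  unfold Dg
  exact h2.measurable.norm.inv.smul h4.measurable
theorem k2_fam {γ u : ℝ → Cv} (h1 : Continuous fun z : ℝ × ℝ => γ z.1 z.2) (h2 : Continuous fun z : ℝ × ℝ => deriv (γ z.1) z.2) (h3 : Continuous fun z : ℝ × ℝ => u z.1 z.2) : Measurable fun p : ℝ × ℝ × ℝ => k2 s (γ p.1) (u p.1) p.2.1 p.2.2 := by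
  have a := k1_fam (s := s) h1 h2 h1 h2
  have b := ((cy_meas h3).sub (cx_meas h3)).norm.pow_const 2
  have c := ((cy_meas h1).sub (cx_meas h1)).norm.pow_const 2
  unfold k2
  exact a.mul (b.div c)
theorem k3_fam {γ u : ℝ → Cv} (h1 : Continuous fun z : ℝ × ℝ => γ z.1 z.2) (h2 : Continuous fun z : ℝ × ℝ => deriv (γ z.1) z.2) (h4 : Continuous fun z : ℝ × ℝ => deriv (u z.1) z.2) : Measurable fun p : ℝ × ℝ × ℝ => k3 s (γ p.1) (u p.1) p.2.1 p.2.2 := by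
  have a := ((cx_meas (f := fun t => deriv (γ t)) h2).norm.inv.smul
    (cx_meas (f := fun t => deriv (u t)) h4)).norm.pow_const 2
  have b := ((cy_meas (f := fun t => deriv (γ t)) h2).norm.inv.smul
    (cy_meas (f := fun t => deriv (u t)) h4)).norm.pow_const 2
  have c := k1_fam (s := s) h1 h2 h1 h2
  unfold k3 Dg
  exact c.mul (a.add b)
theorem I2_fam {k : ℝ → ℝ → ℝ → ℝ} (hk : Measurable fun p : ℝ × ℝ × ℝ => k p.1 p.2.1 p.2.2) : Measurable fun t => I2 (k t) :=
  (ENNReal.measurable_ofReal.comp hk).lintegral_prod_right'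
theorem I1_fam {k : ℝ → ℝ → ℝ} (hk : Measurable fun p : ℝ × ℝ => k p.1 p.2) : Measurable fun t => I1 (k t) :=
  (ENNReal.measurable_ofReal.comp hk).lintegral_prod_right'
theorem GE_fam_meas {γ u : ℝ → Cv} (h1 : Continuous fun z : ℝ × ℝ => γ z.1 z.2) (h2 : Continuous fun z : ℝ × ℝ => deriv (γ z.1) z.2) (h3 : Continuous fun z : ℝ × ℝ => u z.1 z.2) (h4 : Continuous fun z : ℝ × ℝ => deriv (u z.1) z.2) : Measurable fun t => GE s (γ t) (u t) := by
  have m4 : Measurable fun z : ℝ × ℝ => l1 (γ z.1) (u z.1) z.2 := by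
    have := Dg_fam h2 h4
    unfold l1
    exact (this.norm.pow_const 2).mul h2.measurable.norm
  have m5 : Measurable fun z : ℝ × ℝ => l0 (γ z.1) (u z.1) z.2 := by
    unfold l0
    exact (h3.measurable.norm.pow_const 2).mul h2.measurable.norm
  have a := I2_fam (k := fun t => k1 s (γ t) (u t)) (k1_fam h1 h2 h3 h4)
  have b := I2_fam (k := fun t => k2 s (γ t) (u t)) (k2_fam h1 h2 h3)
  have c := I2_fam (k := fun t => k3 s (γ t) (u t)) (k3_fam h1 h2 h4)
  have d := I1_fam (k := fun t => l1 (γ t) (u t)) m4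
  have e := I1_fam (k := fun t => l0 (γ t) (u t)) m5
  unfold GE
  exact ((((a.const_mul 2).add (b.const_mul _)).add c).add d).add e
namespace C1Path
theorem cont_cl (hs : 3/2 < s) (P : C1Path s n) : (Continuous fun z : ℝ × ℝ => P.Γ (cl z.1) z.2) ∧ (Continuous fun z : ℝ × ℝ => deriv (P.Γ (cl z.1)) z.2) := by
  have hc : Continuous fun z : ℝ × ℝ => (cl z.1, z.2) :=
    (cl_cont.comp continuous_fst).prodMk continuous_snd
  constructor
  · have := (P.G_cont hs).1.comp hc
    convert this using 2 with z
    exact (P.G_eq hs (cl_mem z.1) z.2).1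
  · have := (P.G_cont hs).2.comp hc
    convert this using 2 with z
    exact (P.G_eq hs (cl_mem z.1) z.2).2
theorem GE_meas (hs : 3/2 < s) (P : C1Path s n) : Measurable fun t => GE s (P.Γ (cl t)) (P.V (cl t)) :=
  GE_fam_meas (γ := fun t => P.Γ (cl t)) (u := fun t => P.V (cl t)) (P.cont_cl hs).1
    (P.cont_cl hs).2 (P.V_cont hs).1 (P.V_cont hs).2
def spd (P : C1Path s n) (t : ℝ) : ℝ≥0∞ := GE s (P.Γ (cl t)) (P.V (cl t)) ^ (1/2 : ℝ)
theorem spd_meas (hs : 3/2 < s) (P : C1Path s n) : Measurable P.spd :=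
  (P.GE_meas hs).pow_const _
theorem len_eq (hs : 3/2 < s) (P : C1Path s n) : ∫⁻ t in Ioc (0:ℝ) 1, P.spd t = oR (pathLen P) ∧ 0 ≤ pathLen P := by
  obtain ⟨B, hB, hb⟩ := P.GE_bdd hs
  have e : ∀ t ∈ Ioc (0:ℝ) 1, P.spd t = oR √(Gmet s (P.Γ t) (P.V t) (P.V t)) := by
    intro t ht
    have ht' : t ∈ U1 := ⟨ht.1.le, ht.2⟩
    have h := Gmet_eq (by linarith) (P.mem t ht').1 (P.memV t ht')
      ((hb t ht').trans_lt ofReal_lt_top)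
    rw [spd, cl_eq ht', ← h.1, ENNReal.ofReal_rpow_of_nonneg h.2 (by norm_num), sqrt_eq_rpow]
  have hpl : pathLen P = ∫ t in Ioc (0:ℝ) 1, (P.spd t).toReal := by
    unfold pathLen
    rw [intervalIntegral.integral_of_le zero_le_one]
    refine setIntegral_congr_fun measurableSet_Ioc fun t ht => ?_
    rw [e t ht, ENNReal.toReal_ofReal (sqrt_nonneg _)]
  have hsb : ∀ t, P.spd t ≤ oR B ^ (1/2:ℝ) := fun t => by
    unfold spd
    gcongr
    exact hb _ (cl_mem t)
  have hfin : ∫⁻ t in Ioc (0:ℝ) 1, P.spd t ≠ ⊤ := by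
    refine ((lintegral_mono fun t => hsb t).trans_lt ?_).ne
    simp only [lintegral_const]
    refine ENNReal.mul_lt_top ?_ (by simp)
    exact ENNReal.rpow_lt_top_of_nonneg (by norm_num) ofReal_ne_top
  rw [hpl, integral_toReal (P.spd_meas hs).aemeasurable (Eventually.of_forall fun t =>
    (hsb t).trans_lt (ENNReal.rpow_lt_top_of_nonneg (by norm_num) ofReal_ne_top)),
    ofReal_toReal hfin]
  exact ⟨rfl, ENNReal.toReal_nonneg⟩
def const {γ : Cv} (hγ : InM s γ) : C1Path s n where
  Γ := fun _ => γ
  V := fun _ _ => 0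
  mem := fun _ _ => hγ
  memV := fun _ _ => InHs.zero
  isDeriv := fun t _ => by
    simp only [sub_self, smul_zero, HsNorm_zero]
    exact tendsto_const_nhds
  contV := fun t _ => by
    simp only [sub_self, HsNorm_zero]
    exact tendsto_const_nhds
end C1Path
theorem InM.good (hs : 3/2 < s) {γ : Cv} (hγ : InM s γ) : ∃ c K A : ℝ, 0 < c ∧ 0 ≤ A ∧ Good s c K A γ := by
  obtain ⟨c, K, A, h1, h2, h3⟩ := (C1Path.const hγ).good hs
  exact ⟨c, K, A, h1, h2, h3 0 (by simp)⟩
theorem I2_arc {k : ℝ → ℝ → ℝ} (hk : Measurable fun z : ℝ × ℝ => k z.1 z.2) (hp1 : ∀ x y, k (x + 1) y = k x y) (hp2 : ∀ x y, k x (y + 1) = k x y) {a b : ℝ} (hab : b ≤ a + 1) : ∫⁻ x in Ioc a b, ∫⁻ y in Ioc a b, oR (k x y) ≤ I2 k := by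
  have hsub : Ioc a b ⊆ Ioc a (a + 1) := Ioc_subset_Ioc_right hab
  unfold I2
  rw [lint_mu2 (by fun_prop)]
  calc _ ≤ ∫⁻ x in Ioc a (a+1), ∫⁻ y in Ioc a (a+1), oR (k x y) :=
        (lintegral_mono_set hsub).trans (lintegral_mono fun x => lintegral_mono_set hsub)
    _ = ∫⁻ x in Ioc a (a+1), ∫⁻ y in I01, oR (k x y) := by
        refine lintegral_congr fun x => ?_
        rw [lint_periodic (fun y => ?_)]
        rw [hp2]
    _ = _ := by
        rw [lint_periodic (fun x => ?_)]
        simp only [hp1]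
structure Arc (γ : Cv) (e : En n) (a b : ℝ) : Prop where
  one : ‖e‖ = 1
  dir : ∀ x ∈ Icc a b, 0.9 * ‖deriv γ x‖ ≤ ⟪e, deriv γ x⟫
theorem int_mono {f g : ℝ → ℝ} (hf : Continuous f) (hg : Continuous g) {a b x y : ℝ} (hax : a ≤ x) (hxy : x ≤ y) (hyb : y ≤ b) (h : ∀ z ∈ Icc a b, f z ≤ g z) : ∫ z in x..y, f z ≤ ∫ z in x..y, g z :=
  intervalIntegral.integral_mono_on hxy (hf.intervalIntegrable _ _) (hg.intervalIntegrable _ _)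
    fun z hz => h z ⟨hax.trans hz.1, hz.2.trans hyb⟩
theorem hs_ftc {u : Cv} (hu : InHs s u) (x y : ℝ) : ∫ z in x..y, deriv u z = u y - u x :=
  intervalIntegral.integral_eq_sub_of_hasDerivAt (fun z _ => hu.hd z)
    (hu.cd.intervalIntegrable _ _)
theorem hs_ftc_inner {u : Cv} (hu : InHs s u) (e : En n) (x y : ℝ) : ∫ z in x..y, ⟪e, deriv u z⟫ = ⟪e, u y - u x⟫ := by
  have hc := hu.cd
  have h : ∀ z, HasDerivAt (fun z => ⟪e, u z⟫) ⟪e, deriv u z⟫ z := fun z => by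
    simpa using (hasDerivAt_const z e).inner ℝ (hu.hd z)
  rw [intervalIntegral.integral_eq_sub_of_hasDerivAt (fun z _ => h z)
    ((by fun_prop : Continuous fun z => ⟪e, deriv u z⟫).intervalIntegrable _ _), inner_sub_right]
theorem hs_len {u : Cv} (hu : InHs s u) {x y : ℝ} (hxy : x ≤ y) : ‖u y - u x‖ ≤ ∫ z in x..y, ‖deriv u z‖ := by
  rw [← hs_ftc hu]
  exact intervalIntegral.norm_integral_le_integral_norm hxy
theorem Arc.len {γ : Cv} (hγ : InHs s γ) {e : En n} {a b : ℝ} (h : Arc γ e a b) {x y : ℝ} (hax : a ≤ x) (hxy : x ≤ y) (hyb : y ≤ b) : 0.9 * ∫ z in x..y, ‖deriv γ z‖ ≤ ⟪e, γ y - γ x⟫ := by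
  have hc := hγ.cd
  rw [← hs_ftc_inner hγ, ← intervalIntegral.integral_const_mul]
  exact int_mono (by fun_prop) (by fun_prop) hax hxy hyb h.dir
theorem Arc.lip {γ : Cv} (hγ : InHs s γ) {e : En n} {a b : ℝ} (h : Arc γ e a b) {x y : ℝ} (hx : x ∈ Icc a b) (hy : y ∈ Icc a b) : 0.9 * ‖γ y - γ x‖ ≤ |⟪e, γ y⟫ - ⟪e, γ x⟫| := by
  wlog hxy : x ≤ y generalizing x y
  · rw [norm_sub_rev, abs_sub_comm]
    exact this hy hx (le_of_not_ge hxy)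
  rw [← inner_sub_right]
  refine le_trans ?_ ((h.len hγ hx.1 hxy hy.2).trans (le_abs_self _))
  exact mul_le_mul_of_nonneg_left (hs_len hγ hxy) (by norm_num)
theorem arc_pt {a b d w q e : En n} (hs0 : 3/2 < s) (hs2 : s < 2) (ha : 0 < ‖a‖) (he : ‖e‖ = 1) (h1 : 0.9 * ‖a‖ ≤ ⟪e, a⟫) (h2 : 0.9 * ‖d‖ ≤ |⟪e, d⟫|) (h3 : 0 ≤ ⟪e, b⟫) : ‖w - ⟪e, d⟫ • ((⟪e, a⟫)⁻¹ • q)‖ ^ 2 / |⟪e, d⟫| ^ sP * ⟪e, a⟫ * ⟪e, b⟫ ≤ 4 * kk s a b d w q + 5 * (kk s a b d d a * ‖‖a‖⁻¹ • q‖ ^ 2) := by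
  have hea : 0 < ⟪e, a⟫ := by linarith [mul_pos (by norm_num : (0:ℝ) < 0.9) ha]
  have hea' : ⟪e, a⟫ ≤ ‖a‖ := by simpa [he] using real_inner_le_norm e a
  have heb : ⟪e, b⟫ ≤ ‖b‖ := by simpa [he] using real_inner_le_norm e b
  rcases eq_or_ne d 0 with rfl | hd
  · simp [kk, zero_rpow (by linarith : 2 * s + 1 ≠ 0)]
  have hd0 : 0 < ‖d‖ := norm_pos_iff.2 hd
  set r := w - ((‖a‖ ^ 2)⁻¹ * ⟪a, d⟫) • q with hr
  set N := d - ((‖a‖ ^ 2)⁻¹ * ⟪a, d⟫) • a with hN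
  have e1 : w - ⟪e, d⟫ • ((⟪e, a⟫)⁻¹ • q) = r - (⟪e, N⟫ * (⟪e, a⟫)⁻¹) • q := by
    rw [hr, hN, smul_smul, inner_sub_right, inner_smul_right, sub_mul, mul_assoc _ ⟪e, a⟫, mul_inv_cancel₀ hea.ne', mul_one, sub_smul]
    abel
  set D := ‖‖a‖⁻¹ • q‖ with hD
  have hD' : D = ‖q‖ / ‖a‖ := by rw [hD, norm_smul, norm_inv, norm_norm]; field_simp
  have e2 : ‖(⟪e, N⟫ * (⟪e, a⟫)⁻¹) • q‖ ≤ (10/9) * (‖N‖ * D) := by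
    rw [norm_smul, norm_mul, norm_inv, norm_eq_abs, norm_eq_abs, abs_of_pos hea]
    have : |⟪e, N⟫| ≤ ‖N‖ := by simpa [he] using abs_real_inner_le_norm e N
    have h5 : (⟪e, a⟫)⁻¹ ≤ (10/9) * ‖a‖⁻¹ := by rw [← one_div, ← one_div, mul_one_div, div_le_div_iff₀ hea ha]; linarith
    calc |⟪e, N⟫| * (⟪e, a⟫)⁻¹ * ‖q‖ ≤ ‖N‖ * ((10/9) * ‖a‖⁻¹) * ‖q‖ := by gcongr
      _ = _ := by rw [hD']; ring
  have hD0 : 0 ≤ D := norm_nonneg _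
  have e3 : ‖w - ⟪e, d⟫ • ((⟪e, a⟫)⁻¹ • q)‖ ^ 2 ≤ 2 * ‖r‖ ^ 2 + 5/2 * (‖N‖ ^ 2 * D ^ 2) := by
    rw [e1]
    have := norm_sub_le r ((⟪e, N⟫ * (⟪e, a⟫)⁻¹) • q)
    have h6 : ‖r - (⟪e, N⟫ * (⟪e, a⟫)⁻¹) • q‖ ≤ ‖r‖ + (10/9) * (‖N‖ * D) := by linarith
    have h7 := pow_le_pow_left₀ (norm_nonneg _) h6 2
    nlinarith [sq_nonneg (‖r‖ - (10/9) * (‖N‖ * D)), sq_nonneg (‖N‖ * D)]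
  have e4 : ‖d‖ ^ sP ≤ 2 * |⟪e, d⟫| ^ sP := by
    have h8 : ((0.9:ℝ) * ‖d‖) ^ sP ≤ |⟪e, d⟫| ^ sP :=
      rpow_le_rpow pz h2 (by linarith)
    rw [mul_rpow (by norm_num) hd0.le] at h8
    have h9 : (1/2:ℝ) ≤ (0.9:ℝ) ^ sP := by
      calc (1/2:ℝ) ≤ (0.9:ℝ) ^ (5:ℝ) := by norm_num
        _ ≤ _ := rpow_le_rpow_of_exponent_ge (by norm_num) (by norm_num) (by linarith)
    have := rpow_pos_of_pos hd0 sP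
    nlinarith
  have hdp := rpow_pos_of_pos hd0 sP
  have hep : 0 < |⟪e, d⟫| ^ sP := by linarith
  unfold kk
  rw [← hr, ← hN]
  calc _ ≤ (2 * ‖r‖ ^ 2 + 5/2 * (‖N‖ ^ 2 * D ^ 2)) / (‖d‖ ^ sP / 2) * ‖a‖ * ‖b‖ := by
        gcongr
        linarith
    _ = _ := by field_simp; ring
theorem Arc.mQ_le {γ u : Cv} (hs0 : 3/2 < s) (hs2 : s < 2) (hγ : InHs s γ) (hne : ∀ x, deriv γ x ≠ 0) {e : En n} {a b : ℝ} (h : Arc γ e a b) {x y : ℝ} (hx : x ∈ Icc a b) (hy : y ∈ Icc a b) : mQ s (fun x => ⟪e, γ x⟫) (fun x => ⟪e, deriv γ x⟫) u (deriv u) x y ≤ 4 * k1 s γ u x y + 5 * k3 s γ u x y := by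
  have hp : ∀ z, 0 < ‖deriv γ z‖ := fun z => norm_pos_iff.2 (hne z)
  have := arc_pt (d := γ y - γ x) (w := u y - u x) (q := deriv u x) hs0 hs2 (hp x) h.one
    (h.dir x hx) (by rw [inner_sub_right]; exact h.lip hγ hx hy)
    (le_trans pz (h.dir y hy))
  unfold mQ
  rw [← inner_sub_right]
  refine this.trans ?_
  unfold k3
  have h0 : 0 ≤ k1 s γ γ x y := k1_nonneg _ _ _ _
  have : k1 s γ γ x y * ‖Dg γ u x‖ ^ 2 ≤ k1 s γ γ x y * (‖Dg γ u x‖ ^ 2 + ‖Dg γ u y‖ ^ 2) := by gcongr; nlinarith [sq_nonneg ‖Dg γ u y‖]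
  have e : kk s (deriv γ x) (deriv γ y) (γ y - γ x) (u y - u x) (deriv u x) = k1 s γ u x y := rfl
  have e' : kk s (deriv γ x) (deriv γ y) (γ y - γ x) (γ y - γ x) (deriv γ x) * ‖‖deriv γ x‖⁻¹ • deriv u x‖ ^ 2 = k1 s γ γ x y * ‖Dg γ u x‖ ^ 2 := rfl
  rw [e, e']
  linarith
theorem k1_per {γ u : Cv} (hγ : InHs s γ) (hu : InHs s u) (x y : ℝ) : k1 s γ u (x + 1) y = k1 s γ u x y ∧ k1 s γ u x (y + 1) = k1 s γ u x y := by simp only [k1, hγ.1 _, hu.1 _, per_deriv hγ.1 _, per_deriv hu.1 _, and_self]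
theorem Dg_per {γ u : Cv} (hγ : InHs s γ) (hu : InHs s u) : Function.Periodic (Dg γ u) 1 := by
  intro x
  simp only [Dg, per_deriv hγ.1 _, per_deriv hu.1 _]
theorem k3_per {γ u : Cv} (hγ : InHs s γ) (hu : InHs s u) (x y : ℝ) : k3 s γ u (x + 1) y = k3 s γ u x y ∧ k3 s γ u x (y + 1) = k3 s γ u x y := by simp only [k3, (k1_per hγ hγ _ _).1, (k1_per hγ hγ _ _).2, Dg_per hγ hu _, and_self]
theorem Arc.morrey {γ u : Cv} (hs0 : 3/2 < s) (hs2 : s < 2) (hγ : InHs s γ) (hu : InHs s u) (hne : ∀ x, deriv γ x ≠ 0) {e : En n} {a b : ℝ} (h : Arc γ e a b) (hab : a < b) (hb1 : b ≤ a + 1) {ε : ℝ} (hε : 0 < ε) (hQ : 4 * I2 (k1 s γ u) + 5 * I2 (k3 s γ u) ≤ oR (ε ^ 2)) {x : ℝ} (hx : x ∈ Icc a b) : ‖(⟪e, γ b⟫ - ⟪e, γ a⟫)⁻¹ • (u b - u a) - (⟪e, deriv γ x⟫)⁻¹ • deriv u x‖ ≤ mC s * ε * (⟪e, γ b⟫ -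 ⟪e, γ a⟫) ^ (s - 3/2) := by
  have hc := hγ.cd
  refine _root_.morrey (p := fun x => ⟪e, γ x⟫) (p' := fun x => ⟪e, deriv γ x⟫) hs0
    (fun z => by simpa using (hasDerivAt_const z e).inner ℝ (hγ.hd z)) hu.hd (by fun_prop) hu.cd
    hab (fun z hz => ?_) hε ?_ hx
  · have := norm_pos_iff.2 (hne z)
    exact lt_of_lt_of_le pz (h.dir z hz)
  refine le_trans ?_ hQ
  have m1 := k1_meas hγ hu
  have m3 := k3_meas hγ hu
  have e4 : oR 4 = 4 := by norm_num
  have e5 : oR 5 = 5 := by norm_num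
  have hI : 4 * I2 (k1 s γ u) + 5 * I2 (k3 s γ u) = I2 (fun x y => 4 * k1 s γ u x y + 5 * k3 s γ u x y) := by
    unfold I2
    rw [← lintegral_const_mul' _ _ (by simp), ← lintegral_const_mul' _ _ (by simp), ← lintegral_add_left (by fun_prop)]
    refine lintegral_congr fun z => ?_
    have h1 : 0 ≤ k1 s γ u z.1 z.2 := k1_nonneg _ _ _ _
    have h3 : 0 ≤ k3 s γ u z.1 z.2 := k3_nonneg _ _ _ _
    rw [ofReal_add pz pz, ofReal_mul (p := 4) (by norm_num), ofReal_mul (p := 5) (by norm_num), e4, e5]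
  rw [hI]
  refine le_trans ?_ (I2_arc (by fun_prop) (fun x y => ?_) (fun x y => ?_) hb1)
  · refine setLIntegral_mono' measurableSet_Ioc fun x hx => ?_
    refine setLIntegral_mono' measurableSet_Ioc fun y hy => ?_
    exact ofReal_le_ofReal (h.mQ_le hs0 hs2 hγ hne (Ioc_subset_Icc_self hx)
      (Ioc_subset_Icc_self hy))
  · rw [(k1_per hγ hu _ _).1, (k3_per hγ hu _ _).1]
  · rw [(k1_per hγ hu _ _).2, (k3_per hγ hu _ _).2]
theorem Dg_self_norm {γ : Cv} {x : ℝ} (h : deriv γ x ≠ 0) : ‖Dg γ γ x‖ = 1 := by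
  unfold Dg
  rw [norm_smul, norm_inv, norm_norm, inv_mul_cancel₀ (norm_ne_zero_iff.2 h)]
theorem k3_self {γ : Cv} (hne : ∀ x, deriv γ x ≠ 0) : I2 (k3 s γ γ) = 2 * I2 (k1 s γ γ) := by
  unfold I2
  rw [← lintegral_const_mul' _ _ (by simp)]
  refine lintegral_congr fun z => ?_
  rw [← ENNReal.ofReal_ofNat 2, ← ofReal_mul (by norm_num)]
  congr 1
  simp only [k3, Dg_self_norm (hne _)]
  ring
theorem P0_ex (hs : 3/2 < s) (Λ : ℝ) (hΛ : 0 < Λ) : ∃ P > 0, 2 * (mC s * √(14 * Λ) * P ^ (s - 3/2)) ≤ 0.4 := by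
  have hC := mC_pos hs
  have h14 : 0 < √(14 * Λ) := sqrt_pos.2 pz
  set q := 0.2 / (mC s * √(14 * Λ)) with hq
  have hq0 : 0 < q := by positivity
  refine ⟨q ^ (s - 3/2)⁻¹, rpow_pos_of_pos hq0 _, ?_⟩
  rw [← rpow_mul hq0.le, inv_mul_cancel₀ (by linarith), rpow_one, hq]
  apply le_of_eq
  field_simp
  norm_num
theorem arc_ex (hs0 : 3/2 < s) (hs2 : s < 2) {Λ P : ℝ} (hΛ : 0 < Λ) (hP : 0 < P) (hP0 : 2 * (mC s * √(14 * Λ) * P ^ (s - 3/2)) ≤ 0.4) {γ : Cv} (hγ : InHs s γ) (hne : ∀ x, deriv γ x ≠ 0) (hE : I2 (k1 s γ γ) ≤ oR Λ) (c : ℝ) : ∃ b, c < b ∧ b < c + 1 ∧ Arc γ (Dg γ γ c) c b ∧ ⟪Dg γ γ c, γ b - γ c⟫ = P := by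
  have hcd := hγ.cd
  have hn : ∀ x, 0 < ‖deriv γ x‖ := fun x => norm_pos_iff.2 (hne x)
  set e := Dg γ γ c with he
  have he1 : ‖e‖ = 1 := Dg_self_norm (hne c)
  set F : ℝ → ℝ := fun x => ⟪e, deriv γ x⟫ - 0.9 * ‖deriv γ x‖ with hF
  have hFc : Continuous F := by fun_prop
  have hec : ⟪e, deriv γ c⟫ = ‖deriv γ c‖ := by
    rw [he, Dg, inner_smul_left, real_inner_self_eq_norm_sq]
    have := (hn c).ne'
    simp; field_simp
  have hF0 : 0 < F c := by simp only [hF, hec]; linarith [hn c]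
  have hFp : F (c + 1) = F c := by simp only [hF, per_deriv hγ.1 c]
  set S := Icc c (c + 1) ∩ {x | F x ≤ 0} with hS
  have hSc : IsCompact S := isCompact_Icc.inter_right (isClosed_le hFc continuous_const)
  have hSn : S.Nonempty := by
    by_contra hcon
    rw [not_nonempty_iff_eq_empty] at hcon
    have hpos : ∀ z ∈ Icc c (c+1), 0.9 * ‖deriv γ z‖ ≤ ⟪e, deriv γ z⟫ := by
      intro z hz
      by_contra hlt
      have : z ∈ S := ⟨hz, by simp only [mem_ofPred_eq, hF]; linarith⟩
      rw [hcon] at this; exact this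
    have h1 := (Arc.mk he1 hpos).len hγ le_rfl (by linarith : c ≤ c+1) le_rfl
    rw [hγ.1 c, sub_self, inner_zero_right] at h1
    have h2 : 0 < ∫ z in c..(c+1), ‖deriv γ z‖ :=
      intervalIntegral.intervalIntegral_pos_of_pos_on (by
        exact (by fun_prop : Continuous fun z => ‖deriv γ z‖).intervalIntegrable _ _)
        (fun z _ => hn z) (by linarith)
    linarith
  obtain ⟨b, ⟨hb, hFb⟩, hmin⟩ := hSc.exists_isLeast hSn
  have hcb : c < b := lt_of_le_of_ne hb.1 (by rintro rfl; exact absurd hFb (not_le.2 hF0))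
  have hb1 : b < c + 1 := lt_of_le_of_ne hb.2 (by
    intro h; rw [h] at hFb; simp only [mem_ofPred_eq, hFp] at hFb; linarith)
  have hFb0 : F b = 0 := by
    obtain ⟨z, hz, hz0⟩ := intermediate_value_Icc' hcb.le hFc.continuousOn
      (show (0:ℝ) ∈ Icc (F b) (F c) from ⟨hFb, hF0.le⟩)
    have : b ≤ z := hmin ⟨⟨hz.1, hz.2.trans hb.2⟩, hz0.le⟩
    rwa [le_antisymm this hz.2]
  have harc : Arc γ e c b := by
    refine ⟨he1, fun x hx => ?_⟩
    by_contra hlt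
    have hxS : x ∈ S := ⟨⟨hx.1, hx.2.trans hb.2⟩, by simp only [mem_ofPred_eq, hF]; linarith⟩
    have hxb : x = b := le_antisymm hx.2 (hmin hxS)
    rw [hxb] at hlt
    simp only [hF] at hFb0
    linarith
  have hsq : √(14 * Λ) ^ 2 = 14 * Λ := sq_sqrt pz
  have h14 : 0 < √(14 * Λ) := sqrt_pos.2 pz
  have hQ : 4 * I2 (k1 s γ γ) + 5 * I2 (k3 s γ γ) ≤ oR (√(14 * Λ) ^ 2) := by
    rw [k3_self hne, hsq, ofReal_mul (p := 14) (by norm_num), ENNReal.ofReal_ofNat, ← mul_assoc, ← add_mul]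
    have : (4 + 5 * 2 : ℝ≥0∞) = 14 := by norm_num
    rw [this]
    gcongr
  have m1 := harc.morrey hs0 hs2 hγ hγ hne hcb hb1.le h14 hQ (left_mem_Icc.2 hcb.le)
  have m2 := harc.morrey hs0 hs2 hγ hγ hne hcb hb1.le h14 hQ (right_mem_Icc.2 hcb.le)
  set D := ⟪e, γ b⟫ - ⟪e, γ c⟫ with hD
  have hD0 : 0 ≤ D := by
    rw [hD, ← inner_sub_right]
    refine le_trans ?_ (harc.len hγ le_rfl hcb.le le_rfl)
    exact mul_nonneg (by norm_num) (intervalIntegral.integral_nonneg hcb.le fun _ _ => norm_nonneg _)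
  have hfar : (0.4:ℝ) < 2 * (mC s * √(14 * Λ) * D ^ (s - 3/2)) := by
    have h1 : ‖(⟪e, deriv γ b⟫)⁻¹ • deriv γ b - (⟪e, deriv γ c⟫)⁻¹ • deriv γ c‖ ≤ 2 * (mC s * √(14 * Λ) * D ^ (s - 3/2)) := by
      rw [norm_sub_rev] at m2
      have := norm_add_le ((⟪e, deriv γ b⟫)⁻¹ • deriv γ b - D⁻¹ • (γ b - γ c))
        (D⁻¹ • (γ b - γ c) - (⟪e, deriv γ c⟫)⁻¹ • deriv γ c)
      rw [sub_add_sub_cancel] at this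
      linarith
    refine lt_of_lt_of_le ?_ h1
    have h2 : (⟪e, deriv γ c⟫)⁻¹ • deriv γ c = e := by rw [hec]; rfl
    have h3 : ⟪e, deriv γ b⟫ = 0.9 * ‖deriv γ b‖ := by simp only [hF] at hFb0; linarith
    rw [h2]
    refine lt_of_pow_lt_pow_left₀ 2 (norm_nonneg _) ?_
    rw [h3, norm_sub_sq_real, norm_smul, real_inner_comm e, inner_smul_right, h3, he1, norm_inv, norm_mul, norm_norm, mul_pow, inv_pow, mul_pow]
    have hb0 := (hn b).ne'
    have e1 : (‖(0.9:ℝ)‖ ^ 2 * ‖deriv γ b‖ ^ 2)⁻¹ * ‖deriv γ b‖ ^ 2 = (0.9 ^ 2)⁻¹ := by rw [norm_of_nonneg (by norm_num)]; field_simp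
    have e2 : (0.9 * ‖deriv γ b‖)⁻¹ * (0.9 * ‖deriv γ b‖) = 1 := inv_mul_cancel₀ pz
    rw [e1, e2]; norm_num
  have hPD : P < D := by
    by_contra hle
    have h1 : D ^ (s - 3/2) ≤ P ^ (s - 3/2) :=
      rpow_le_rpow hD0 (not_lt.1 hle) (by linarith)
    have hC := mC_pos hs0
    have : mC s * √(14 * Λ) * D ^ (s - 3/2) ≤ mC s * √(14 * Λ) * P ^ (s - 3/2) := by gcongr
    linarith
  have hpc : Continuous fun x => ⟪e, γ x - γ c⟫ := by have := hγ.c; fun_prop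
  obtain ⟨z, hz, hzP⟩ := intermediate_value_Icc hcb.le hpc.continuousOn
    (show P ∈ Icc ⟪e, γ c - γ c⟫ ⟪e, γ b - γ c⟫ from
      ⟨by simpa using hP.le, by rw [inner_sub_right]; exact hPD.le⟩)
  refine ⟨z, lt_of_le_of_ne hz.1 ?_, hz.2.trans_lt hb1, ⟨he1, fun x hx =>
    harc.dir x ⟨hx.1, hx.2.trans hz.2⟩⟩, hzP⟩
  rintro rfl
  simp at hzP; linarith
theorem arc_int {γ f : Cv} (hγ : InHs s γ) (hf : Continuous f) (hfp : Function.Periodic f 1) {g : ℝ} (hg : 0 < g) (hI : I1 (fun x => ‖f x‖ ^ 2 * ‖deriv γ x‖) ≤ oR (g ^ 2)) {a b : ℝ} (hab : a ≤ b) (hb : b ≤ a + 1) : ∫ x in a..b, ‖f x‖ * ‖deriv γ x‖ ≤ g * (1 + ∫ x in a..b, ‖deriv γ x‖) / 2 := by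
  have hcd := hγ.cd
  have h1 : ∫ x in a..b, ‖f x‖ ^ 2 * ‖deriv γ x‖ ≤ g ^ 2 := by
    rw [intervalIntegral.integral_of_le hab, ← ENNReal.ofReal_le_ofReal_iff pz]
    rw [ofReal_integral_eq_lintegral_ofReal]
    · refine le_trans (lintegral_mono_set (Ioc_subset_Ioc_right hb)) ?_
      rw [lint_periodic (fun x => ?_)]
      · exact hI
      · simp only [hfp x, per_deriv hγ.1 x]
    · exact (by fun_prop : Continuous _).integrableOn_Ioc
    · exact Eventually.of_forall fun x => by positivity
  have h2 : ∫ x in a..b, ‖f x‖ * ‖deriv γ x‖ ≤ ∫ x in a..b, ((2*g)⁻¹ * (‖f x‖ ^ 2 * ‖deriv γ x‖) + g / 2 * ‖deriv γ x‖) := by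
    refine int_mono (a := a) (b := b) (by fun_prop) (by fun_prop) le_rfl hab le_rfl fun z _ => ?_
    have : ‖f z‖ ≤ (2*g)⁻¹ * ‖f z‖ ^ 2 + g / 2 := by
      have e : (2*g)⁻¹ * ‖f z‖ ^ 2 + g / 2 - ‖f z‖ = (2*g)⁻¹ * (‖f z‖ - g) ^ 2 := by field_simp; ring
      have : 0 ≤ (2*g)⁻¹ * (‖f z‖ - g) ^ 2 := by positivity
      linarith
    have := mul_le_mul_of_nonneg_right this (norm_nonneg (deriv γ z))
    linarith
  rw [intervalIntegral.integral_add, intervalIntegral.integral_const_mul, intervalIntegral.integral_const_mul] at h2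
  rotate_left
  · exact (by fun_prop : Continuous _).intervalIntegrable _ _
  · exact (by fun_prop : Continuous _).intervalIntegrable _ _
  have h3 := mul_le_mul_of_nonneg_left h1 (by positivity : 0 ≤ (2*g)⁻¹)
  have e : (2*g)⁻¹ * g ^ 2 = g / 2 := by field_simp
  rw [e] at h3
  linarith
theorem GE_comp {γ u : Cv} (hs : 0 < s) {M : ℝ≥0∞} (h : GE s γ u ≤ M) : 2 * I2 (k1 s γ u) ≤ M ∧ I2 (k2 s γ u) ≤ M ∧ I2 (k3 s γ u) ≤ M ∧ I1 (l1 γ u) ≤ M ∧ I1 (l0 γ u) ≤ M := by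
  have h2 : I2 (k2 s γ u) ≤ oR sP * I2 (k2 s γ u) := by
    calc _ = 1 * I2 (k2 s γ u) := (one_mul _).symm
      _ ≤ _ := by
        gcongr
        rw [← ENNReal.ofReal_one]
        exact ofReal_le_ofReal (by linarith)
  unfold GE at h
  refine ⟨le_trans ?_ h, (h2.trans ?_).trans h, le_trans ?_ h, le_trans ?_ h, le_trans ?_ h⟩
  · rw [add_assoc, add_assoc, add_assoc]; exact le_self_add
  · rw [add_assoc, add_assoc]
    exact le_trans le_add_self le_self_add
  · rw [add_assoc]; exact le_trans le_add_self le_self_add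
  · exact le_trans le_add_self le_self_add
  · exact le_add_self
theorem Dg_cont {γ u : Cv} (hγ : InHs s γ) (hu : InHs s u) (hne : ∀ x, deriv γ x ≠ 0) : Continuous (Dg γ u) := by
  unfold Dg
  have h1 := hγ.cd
  have h2 := hu.cd
  exact (h1.norm.inv₀ fun x => norm_ne_zero_iff.2 (hne x)).smul h2
theorem Dg_mul {γ u : Cv} {x : ℝ} (h : deriv γ x ≠ 0) : ‖deriv u x‖ = ‖Dg γ u x‖ * ‖deriv γ x‖ := by
  unfold Dg
  have := norm_ne_zero_iff.2 h
  rw [norm_smul, norm_inv, norm_norm]; field_simp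
theorem supS (hs0 : 3/2 < s) (hs2 : s < 2) {Λ : ℝ} (hΛ : 0 < Λ) : ∃ C : ℝ, 0 < C ∧ ∀ (γ u : Cv), InHs s γ → (∀ x, deriv γ x ≠ 0) → I2 (k1 s γ γ) ≤ oR Λ → InHs s u → ∀ g > 0, GE s γ u ≤ oR (g ^ 2) → ∀ c, ‖Dg γ u c‖ ≤ C * g ∧ ‖u c‖ ≤ C * g := by
  obtain ⟨P, hP, hP0⟩ := P0_ex hs0 Λ hΛ
  have hC := mC_pos hs0
  have hPs := rpow_pos_of_pos hP (s - 3/2)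
  refine ⟨(1 + 2 * P) / (2 * P) + mC s * 3 * P ^ (s - 3/2) + (2 * P)⁻¹ + 1/2 + (1 + 2 * P) / 2, by positivity, fun γ u hγ hne hE hu g hg hG c => ?_⟩
  obtain ⟨b, hcb, hb1, harc, hbP⟩ := arc_ex hs0 hs2 hΛ hP hP0 hγ hne hE c
  have hcd := hγ.cd
  obtain ⟨g1, -, g3, g4, g5⟩ := GE_comp (by linarith) hG
  set ℓ := ∫ x in c..b, ‖deriv γ x‖ with hℓ
  have hℓ1 : P ≤ ℓ := by
    rw [← hbP]
    refine le_trans (real_inner_le_norm _ _) ?_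
    rw [harc.one, one_mul]
    exact hs_len hγ hcb.le
  have hℓ2 : ℓ ≤ 2 * P := by
    have := harc.len hγ le_rfl hcb.le le_rfl
    rw [hbP] at this; linarith
  have i1 := arc_int hγ (Dg_cont hγ hu hne) (Dg_per hγ hu) hg g4 hcb.le hb1.le
  have i0 := arc_int hγ hu.c hu.1 hg g5 hcb.le hb1.le
  have hud : ∀ z ∈ Icc c b, ‖u z - u c‖ ≤ g * (1 + 2 * P) / 2 := by
    intro z hz
    refine (hs_len hu hz.1).trans ?_
    have e : ∀ x, ‖deriv u x‖ = ‖Dg γ u x‖ * ‖deriv γ x‖ := fun x => Dg_mul (hne x)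
    simp_rw [e]
    refine le_trans ?_ (i1.trans ?_)
    · refine intervalIntegral.integral_mono_interval le_rfl hz.1 hz.2
        (Eventually.of_forall fun x => by positivity) ?_
      have := Dg_cont hγ hu hne
      exact (by fun_prop : Continuous _).intervalIntegrable _ _
    · gcongr
  have hQ : 4 * I2 (k1 s γ u) + 5 * I2 (k3 s γ u) ≤ oR ((3 * g) ^ 2) := by
    rw [mul_pow, ofReal_mul (by norm_num), show (3:ℝ)^2 = 9 by norm_num, ENNReal.ofReal_ofNat]
    calc 4 * I2 (k1 s γ u) + 5 * I2 (k3 s γ u) = 2 * (2 * I2 (k1 s γ u)) + 5 * I2 (k3 s γ u) := by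
          rw [← mul_assoc]; norm_num
      _ ≤ 2 * oR (g ^ 2) + 5 * oR (g ^ 2) := by gcongr
      _ = 7 * oR (g ^ 2) := by rw [← add_mul]; norm_num
      _ ≤ _ := by gcongr; norm_num
  have hm := harc.morrey hs0 hs2 hγ hu hne hcb hb1.le (by positivity : 0 < 3 * g) hQ
    (left_mem_Icc.2 hcb.le)
  rw [← inner_sub_right, hbP] at hm
  have hec : ⟪Dg γ γ c, deriv γ c⟫ = ‖deriv γ c‖ := by
    rw [Dg, inner_smul_left, real_inner_self_eq_norm_sq]
    have := norm_ne_zero_iff.2 (hne c)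
    simp; field_simp
  rw [hec] at hm
  change ‖P⁻¹ • (u b - u c) - Dg γ u c‖ ≤ _ at hm
  have hsl : ‖P⁻¹ • (u b - u c)‖ ≤ (1 + 2 * P) / (2 * P) * g := by
    rw [norm_smul, norm_inv, norm_of_nonneg hP.le]
    calc P⁻¹ * ‖u b - u c‖ ≤ P⁻¹ * (g * (1 + 2 * P) / 2) := by
          gcongr; exact hud b (right_mem_Icc.2 hcb.le)
      _ = _ := by field_simp
  have q1 : 0 < (1 + 2 * P) / (2 * P) * g := by positivity
  have q2 : 0 < mC s * 3 * P ^ (s - 3/2) * g := by positivity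
  have q3 : 0 < (2 * P)⁻¹ * g := by positivity
  have q4 : 0 < (1 + 2 * P) / 2 * g := by positivity
  constructor
  · have h1 : ‖Dg γ u c‖ ≤ ‖P⁻¹ • (u b - u c)‖ + ‖P⁻¹ • (u b - u c) - Dg γ u c‖ := by
      have := norm_sub_le (P⁻¹ • (u b - u c)) (P⁻¹ • (u b - u c) - Dg γ u c)
      rwa [sub_sub_cancel] at this
    have e : mC s * (3 * g) * P ^ (s - 3/2) = mC s * 3 * P ^ (s - 3/2) * g := by ring
    rw [e] at hm
    linarith
  · have huc := hu.c
    have h1 : ‖u c‖ * ℓ ≤ ∫ x in c..b, (‖u x‖ * ‖deriv γ x‖ + g * (1 + 2 * P) / 2 * ‖deriv γ x‖) := by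
      rw [hℓ, ← intervalIntegral.integral_const_mul]
      refine int_mono (a := c) (b := b) (by fun_prop) (by fun_prop) le_rfl hcb.le le_rfl
        fun z hz => ?_
      have := hud z hz
      have h2 := norm_sub_le (u z) (u z - u c)
      rw [sub_sub_cancel] at h2
      rw [← add_mul]
      exact mul_le_mul_of_nonneg_right (by linarith) (norm_nonneg _)
    rw [intervalIntegral.integral_add, intervalIntegral.integral_const_mul] at h1
    rotate_left
    · exact (by fun_prop : Continuous _).intervalIntegrable _ _
    · exact (by fun_prop : Continuous _).intervalIntegrable _ _
    rw [← hℓ] at h1 i0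
    have hℓ0 : 0 < ℓ := hP.trans_le hℓ1
    have h2 : ‖u c‖ ≤ g / (2 * ℓ) + g / 2 + g * (1 + 2 * P) / 2 := by
      rw [← mul_le_mul_iff_left₀ hℓ0]
      have : (g / (2 * ℓ) + g / 2 + g * (1 + 2 * P) / 2) * ℓ = g * (1 + ℓ) / 2 + g * (1 + 2 * P) / 2 * ℓ := by field_simp
      rw [this]; linarith
    have h3 : g / (2 * ℓ) ≤ (2 * P)⁻¹ * g := by rw [div_eq_mul_inv, mul_comm]; gcongr
    linarith
theorem near_alg {τx τy d w Dx Dy : En n} (hx : ‖τx‖ = 1) (hy : ‖τy‖ = 1) (ha : 0 ≤ ⟪τx, d⟫) (hb : 0 ≤ ⟪τy, d⟫) : ⟪τx, d⟫ * ‖Dy - Dx‖ ≤ ‖w - ⟪τx, d⟫ • Dx‖ + ‖w - ⟪τy, d⟫ • Dy‖ + (‖d - ⟪τx, d⟫ • τx‖ + ‖d - ⟪τy, d⟫ • τy‖) * ‖Dy‖ := by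
  set α := ⟪τx, d⟫
  set β := ⟪τy, d⟫
  have e : α • (Dy - Dx) = (w - α • Dx) - (w - β • Dy) + (α - β) • Dy := by rw [smul_sub, sub_smul]; abel
  have h1 : |α - β| ≤ ‖d - α • τx‖ + ‖d - β • τy‖ := by
    have h2 := abs_norm_sub_norm_le (α • τx) (β • τy)
    rw [norm_smul, norm_smul, hx, hy, mul_one, mul_one, norm_of_nonneg ha, norm_of_nonneg hb] at h2
    have h3 := norm_sub_le (d - β • τy) (d - α • τx)
    rw [sub_sub_sub_cancel_left] at h3
    linarith
  calc α * ‖Dy - Dx‖ = ‖α • (Dy - Dx)‖ := by rw [norm_smul, norm_of_nonneg ha]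
    _ ≤ ‖w - α • Dx‖ + ‖w - β • Dy‖ + ‖(α - β) • Dy‖ := by rw [e]; exact (norm_add_le _ _).trans (by gcongr; exact norm_sub_le _ _)
    _ ≤ _ := by rw [norm_smul, norm_eq_abs]; gcongr
theorem k1_Dg {γ u : Cv} (x y : ℝ) : k1 s γ u x y = ‖u y - u x - ⟪Dg γ γ x, γ y - γ x⟫ • Dg γ u x‖ ^ 2 * (‖deriv γ x‖ * ‖deriv γ y‖) /
      ‖γ y - γ x‖ ^ sP := by
  unfold k1 kk Dg
  rw [inner_smul_left, smul_smul]
  congr 6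
  simp; ring
theorem rho_le {γ u : Cv} (hs : 0 < s) {c K : ℝ} (hc : 0 < c) (hb : ∀ x, c ≤ ‖deriv γ x‖) {x y h : ℝ} (hd : 0 < ‖γ y - γ x‖) (hK : ‖γ y - γ x‖ ≤ K * h) : ‖u y - u x - ⟪Dg γ γ x, γ y - γ x⟫ • Dg γ u x‖ ^ 2 ≤ (K * h) ^ sP / c ^ 2 * k1 s γ u x y := by
  rw [k1_Dg]
  set R := ‖u y - u x - ⟪Dg γ γ x, γ y - γ x⟫ • Dg γ u x‖ ^ 2
  have hp := rpow_pos_of_pos hd sP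
  have h1 : ‖γ y - γ x‖ ^ sP ≤ (K * h) ^ sP :=
    rpow_le_rpow hd.le hK (by linarith)
  have h2 : c ^ 2 ≤ ‖deriv γ x‖ * ‖deriv γ y‖ := by rw [sq]; exact mul_le_mul (hb x) (hb y) hc.le (norm_nonneg _)
  calc R = ‖γ y - γ x‖ ^ sP / c ^ 2 * (R * c ^ 2 / ‖γ y - γ x‖ ^ sP) := by
        field_simp
    _ ≤ _ := by
        gcongr
        exact div_nonneg (hp.le.trans h1) pz
theorem near_fin {A B N N' Y X c h K s k1 k2 k3 k4 : ℝ} (hc : 0 < c) (hh : 0 < h) (hK0 : 0 < K) (hX : 0 ≤ X) (p1 : 0 ≤ k1) (p2 : 0 ≤ k2) (p3 : 0 ≤ k3) (p4 : 0 ≤ k4)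
    (r1 : A ^ 2 ≤ (K * h) ^ (2 * s + 1) / c ^ 2 * k1)
    (r2 : B ^ 2 ≤ (K * h) ^ (2 * s + 1) / c ^ 2 * k2)
    (r3 : N ^ 2 * Y ^ 2 ≤ (K * h) ^ (2 * s + 1) / c ^ 2 * k3)
    (r4 : N' ^ 2 * Y ^ 2 ≤ (K * h) ^ (2 * s + 1) / c ^ 2 * k4)
    (key : 0.9 * (c * h) * X ≤ A + B + (N * Y + N' * Y)) :
    X ^ 2 / h ^ (2 * s - 1) ≤ 8 * K ^ (2 * s + 1) / c ^ 4 * (k1 + k2 + k3 + k4) := by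
  have hhp := rpow_pos_of_pos hh (2 * s - 1)
  have hsplit : (K * h) ^ (2 * s + 1) = K ^ (2 * s + 1) * (h ^ (2 * s - 1) * h ^ 2) := by
    rw [mul_rpow hK0.le hh.le, ← rpow_natCast h 2, ← rpow_add hh]
    norm_num; left; ring_nf
  rw [hsplit] at r1 r2 r3 r4
  have hKp := rpow_pos_of_pos hK0 (2 * s + 1)
  generalize h ^ (2 * s - 1) = q at *
  generalize K ^ (2 * s + 1) = L at *
  set S := k1 + k2 + k3 + k4 with hS
  have hS0 : 0 ≤ S := by positivity
  set m := L * (q * h ^ 2) / c ^ 2 with hm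
  have hm0 : 0 ≤ m := by positivity
  have h1 : (0.9 * (c * h) * X) ^ 2 ≤ 4 * m * S := by
    have h3 := pow_le_pow_left₀ pz key 2
    have h4 : (A + B + (N * Y + N' * Y)) ^ 2 ≤ 4 * (A ^ 2 + B ^ 2 + N ^ 2 * Y ^ 2 + N' ^ 2 * Y ^ 2) := by nlinarith [sq_nonneg (A - B), sq_nonneg (A - N * Y), sq_nonneg (A - N' * Y), sq_nonneg (B - N * Y), sq_nonneg (B - N' * Y), sq_nonneg (N * Y - N' * Y)]
    have h5 : A ^ 2 + B ^ 2 + N ^ 2 * Y ^ 2 + N' ^ 2 * Y ^ 2 ≤ m * S := by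
      have : m * S = m * k1 + m * k2 + m * k3 + m * k4 := by rw [hS]; ring
      rw [this]; linarith
    linarith
  rw [div_le_iff₀ hhp]
  have h6 : c ^ 2 * h ^ 2 * X ^ 2 ≤ 8 * m * S := by
    have : (0.9 * (c * h) * X) ^ 2 = 0.81 * (c ^ 2 * h ^ 2 * X ^ 2) := by ring
    rw [this] at h1
    have : 0 ≤ c ^ 2 * h ^ 2 * X ^ 2 := by positivity
    nlinarith [mul_nonneg hm0 hS0]
  have h7 : X ^ 2 ≤ 8 * m * S / (c ^ 2 * h ^ 2) := by rw [le_div_iff₀ pz]; linarith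
  refine h7.trans (le_of_eq ?_)
  rw [hm]
  field_simp
set_option maxHeartbeats 1000000 in
theorem near_pt (hs : 3/2 < s) {γ u : Cv} (hγ : InHs s γ) {c K : ℝ} (hc : 0 < c) (hb : ∀ x, c ≤ ‖deriv γ x‖) (hK : ∀ x, ‖deriv γ x‖ ≤ K) {x y : ℝ} (hxy : x < y) (harc : Arc γ (Dg γ γ x) x y) : ‖Dg γ u y - Dg γ u x‖ ^ 2 / (y - x) ^ sM ≤ 8 * K ^ sP / c ^ 4 * (k1 s γ u x y + k1 s γ u y x + k3 s γ u x y + k3 s γ u y x) := by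
  have hne : ∀ x, deriv γ x ≠ 0 := fun x => norm_pos_iff.1 (hc.trans_le (hb x))
  have hcd := hγ.cd
  have hK0 : 0 < K := hc.trans_le ((hb 0).trans (hK 0))
  have hh : 0 < y - x := sub_pos.2 hxy
  set h := y - x with hhd
  set τx := Dg γ γ x
  set τy := Dg γ γ y
  have hx1 : ‖τx‖ = 1 := Dg_self_norm (hne x)
  have hy1 : ‖τy‖ = 1 := Dg_self_norm (hne y)
  set d := γ y - γ x with hd
  have hα : 0.9 * (c * h) ≤ ⟪τx, d⟫ := by
    refine le_trans ?_ (harc.len hγ le_rfl hxy.le le_rfl)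
    have := int_mono (f := fun _ => c) (g := fun z => ‖deriv γ z‖) (a := x) (b := y) (by fun_prop)
      (by fun_prop) le_rfl hxy.le le_rfl fun z _ => hb z
    rw [intervalIntegral.integral_const, smul_eq_mul] at this
    nlinarith
  have hα0 : 0 < ⟪τx, d⟫ := lt_of_lt_of_le pz hα
  have hd0 : 0 < ‖d‖ := by rw [norm_pos_iff]; intro h0; rw [h0, inner_zero_right] at hα0; exact lt_irrefl _ hα0
  have hdK : ‖d‖ ≤ K * h := by
    have := lip_of_sup hγ hK x y
    rwa [abs_of_pos hh] at this
  have hdir : ∀ z ∈ Icc x y, ‖Dg γ γ z - τx‖ ^ 2 ≤ 0.2 := by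
    intro z hz
    rw [norm_sub_sq_real, hx1, Dg_self_norm (hne z), Dg, inner_smul_left, real_inner_comm]
    have h1 := harc.dir z hz
    have h2 := norm_pos_iff.2 (hne z)
    have : 0.9 ≤ ‖deriv γ z‖⁻¹ * ⟪τx, deriv γ z⟫ := by rw [← div_eq_inv_mul, le_div_iff₀ h2]; exact h1
    simp only [conj_trivial] at this ⊢
    linarith
  have hβ : 0 ≤ ⟪τy, d⟫ := by
    rw [hd, ← hs_ftc_inner hγ]
    refine intervalIntegral.integral_nonneg hxy.le fun z hz => ?_
    have h1 := hdir z hz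
    have h2 := hdir y (right_mem_Icc.2 hxy.le)
    have h3 : ‖τy - Dg γ γ z‖ ^ 2 ≤ 0.8 := by
      have h4 := norm_sub_le (τy - τx) (Dg γ γ z - τx)
      rw [sub_sub_sub_cancel_right] at h4
      have h5 := pow_le_pow_left₀ (norm_nonneg _) h4 2
      nlinarith [sq_nonneg (‖τy - τx‖ - ‖Dg γ γ z - τx‖)]
    rw [norm_sub_sq_real, hy1, Dg_self_norm (hne z), Dg, inner_smul_right] at h3
    have h6 := norm_pos_iff.2 (hne z)
    have h7 : 0 ≤ ‖deriv γ z‖⁻¹ * ⟪τy, deriv γ z⟫ := by linarith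
    exact nonneg_of_mul_nonneg_right h7 (inv_pos.2 h6)
  have key := near_alg (w := u y - u x) (Dx := Dg γ u x) (Dy := Dg γ u y) hx1 hy1 hα0.le hβ
  have hdr : γ x - γ y = -d := by rw [hd]; abel
  have r1 := rho_le (u := u) (by linarith : 0 < s) hc hb hd0 hdK
  have r3 := rho_le (u := γ) (by linarith : 0 < s) hc hb hd0 hdK
  have hd0' : 0 < ‖γ x - γ y‖ := by rw [norm_sub_rev]; exact hd0
  have hdK' : ‖γ x - γ y‖ ≤ K * h := by rw [norm_sub_rev]; exact hdK
  have r2 := rho_le (u := u) (by linarith : 0 < s) hc hb hd0' hdK'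
  have r4 := rho_le (u := γ) (by linarith : 0 < s) hc hb hd0' hdK'
  have hur : u x - u y = -(u y - u x) := by abel
  have sg : ∀ (a w D : En n), -w - ⟪a, -d⟫ • D = -(w - ⟪a, d⟫ • D) := fun a w D => by
    rw [inner_neg_right, neg_smul]; abel
  rw [hdr, hur, sg, norm_neg] at r2
  rw [hdr, sg, norm_neg] at r4
  have hK00 : 0 ≤ (K * h) ^ sP / c ^ 2 := by positivity
  have p1 : 0 ≤ k1 s γ γ x y := k1_nonneg _ _ _ _
  have p2 : 0 ≤ k1 s γ γ y x := k1_nonneg _ _ _ _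
  refine near_fin hc hh hK0 (norm_nonneg _) (k1_nonneg _ _ _ _) (k1_nonneg _ _ _ _)
    (k3_nonneg _ _ _ _) (k3_nonneg _ _ _ _) r1 r2 (Y := ‖Dg γ u y‖)
    (N := ‖d - ⟪τx, d⟫ • τx‖) (N' := ‖d - ⟪τy, d⟫ • τy‖) ?_ ?_ ?_
  · refine (mul_le_mul_of_nonneg_right r3 (sq_nonneg _)).trans ?_
    rw [mul_assoc]
    refine mul_le_mul_of_nonneg_left ?_ hK00
    unfold k3; gcongr; nlinarith [sq_nonneg ‖Dg γ u x‖]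
  · refine (mul_le_mul_of_nonneg_right r4 (sq_nonneg _)).trans ?_
    rw [mul_assoc]
    refine mul_le_mul_of_nonneg_left ?_ hK00
    unfold k3; gcongr; nlinarith [sq_nonneg ‖Dg γ u x‖]
  · refine le_trans (mul_le_mul_of_nonneg_right hα (norm_nonneg _)) (key.trans (le_of_eq ?_))
    ring
theorem near_sym (hs : 3/2 < s) {γ u : Cv} (hγ : InHs s γ) {Λ P : ℝ} (hΛ : 0 < Λ) (hP : 0 < P) (hs2 : s < 2) (hP0 : 2 * (mC s * √(14 * Λ) * P ^ (s - 3/2)) ≤ 0.4) (hE : I2 (k1 s γ γ) ≤ oR Λ) {c K : ℝ} (hc : 0 < c) (hb : ∀ x, c ≤ ‖deriv γ x‖) (hK : ∀ x, ‖deriv γ x‖ ≤ K) {x y : ℝ} (hxy : x ≠ y) (hnear : |y - x| ≤ P / K) : ‖Dg γ u y - Dg γ u x‖ ^ 2 / |y - x| ^ sM ≤ 8 * K ^ sP / c ^ 4 * (k1 s γ u x y + k1 s γ u y x + k3 s γ u x y + k3 s γ u y x) := by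
  wlog h : x < y generalizing x y
  · have h' : y < x := lt_of_le_of_ne (not_lt.1 h) hxy.symm
    rw [norm_sub_rev, abs_sub_comm]
    refine (this hxy.symm (by rwa [abs_sub_comm]) h').trans (le_of_eq ?_)
    ring
  have hne : ∀ x, deriv γ x ≠ 0 := fun x => norm_pos_iff.1 (hc.trans_le (hb x))
  have hK0 : 0 < K := hc.trans_le ((hb 0).trans (hK 0))
  obtain ⟨b, hxb, -, harc, hbP⟩ := arc_ex hs hs2 hΛ hP hP0 hγ hne hE x
  have h1 : P ≤ K * (b - x) := by
    rw [← hbP]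
    refine (real_inner_le_norm _ _).trans ?_
    rw [harc.one, one_mul]
    have := lip_of_sup hγ hK x b
    rwa [abs_of_pos (sub_pos.2 hxb)] at this
  rw [abs_of_pos (sub_pos.2 h)] at hnear ⊢
  have h2 : y ≤ b := by
    have : P / K ≤ b - x := by rw [div_le_iff₀ hK0]; linarith
    linarith
  exact near_pt hs hγ hc hb hK h ⟨harc.one, fun z hz => harc.dir z ⟨hz.1, hz.2.trans h2⟩⟩
def Sf (s : ℝ) (γ u : Cv) (x y : ℝ) : ℝ :=
  k1 s γ u x y + k1 s γ u y x + k3 s γ u x y + k3 s γ u y x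
theorem Sf_nonneg (γ u : Cv) (x y : ℝ) : 0 ≤ Sf s γ u x y := by
  have := k1_nonneg (s := s) γ u x y
  have := k1_nonneg (s := s) γ u y x
  have := k3_nonneg (s := s) γ u x y
  have := k3_nonneg (s := s) γ u y x
  unfold Sf; positivity
set_option maxHeartbeats 1000000 in
theorem low_pt (hs0 : 3/2 < s) (hs2 : s < 2) {Λ c K P M g : ℝ} (hΛ : 0 < Λ) (hc : 0 < c) (hK0 : 0 < K) (hP : 0 < P) (hP0 : 2 * (mC s * √(14 * Λ) * P ^ (s - 3/2)) ≤ 0.4) (hM : 0 < M) (hg : 0 < g) {γ u : Cv} (hγ : InHs s γ) (hu : InHs s u) (hb : ∀ x, c ≤ ‖deriv γ x‖) (hK : ∀ x, ‖deriv γ x‖ ≤ K) (hE : I2 (k1 s γ γ) ≤ oR Λ) (hsu : ∀ x, ‖Dg γ u x‖ ≤ M * g) (hdu : ∀ x, ‖deriv u x‖ ≤ K * M * g) (x y : ℝ) :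
    ‖deriv u y - deriv u x‖ ^ 2 / dT x y ^ (2 * (s - 1) + 1) ≤ 2 * K ^ 2 * (8 * K ^ sP / c ^ 4) * Sf s γ u x y + 2 * (M * g) ^ 2 * (‖deriv γ y - deriv γ x‖ ^ 2 / dT x y ^ (2 * (s - 1) + 1)) + 4 * (K * M) ^ 2 / (P / K) ^ sM * g ^ 2 := by
  have hne : ∀ x, deriv γ x ≠ 0 := fun x => norm_pos_iff.1 (hc.trans_le (hb x))
  set h0 := P / K with hh0
  have hh0p : 0 < h0 := by positivity
  have hhp := rpow_pos_of_pos hh0p sM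
  set C1 := 2 * K ^ 2 * (8 * K ^ sP / c ^ 4) with hC1
  have hC1p : 0 < C1 := by have := rpow_pos_of_pos hK0 sP; positivity
  set C2 := 4 * (K * M) ^ 2 / h0 ^ sM with hC2
  have hC2p : 0 < C2 := by positivity
  have hes : 2 * (s - 1) + 1 = 2 * s - 1 := by ring
  rw [hes]
  obtain ⟨h, k, hh, rfl⟩ := exists_shift x y
  have hSk : Sf s γ u x (x + h + k) = Sf s γ u x (x + h) := by
    have a1 : ∀ x, k1 s γ u x (x + h + k) = k1 s γ u x (x + h) := fun x => by
      simp only [k1, per_int hγ.1, per_int hu.1, per_int (per_deriv hγ.1)]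
    have a2 : k1 s γ u (x + h + k) x = k1 s γ u (x + h) x := by simp only [k1, per_int hγ.1, per_int hu.1, per_int (per_deriv hγ.1), per_int (per_deriv hu.1)]
    have a3 : k3 s γ u x (x + h + k) = k3 s γ u x (x + h) := by simp only [k3, k1, per_int hγ.1, per_int (per_deriv hγ.1), per_int (Dg_per hγ hu)]
    have a4 : k3 s γ u (x + h + k) x = k3 s γ u (x + h) x := by simp only [k3, k1, per_int hγ.1, per_int (per_deriv hγ.1), per_int (Dg_per hγ hu)]
    simp only [Sf, a1, a2, a3, a4]
  rw [hSk, dT_add_int, dT_of_abs_le x h hh, per_int (per_deriv hγ.1), per_int (per_deriv hu.1)]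
  have hG0 : 0 ≤ 2 * (M * g) ^ 2 * (‖deriv γ (x + h) - deriv γ x‖ ^ 2 / |h| ^ sM) := by positivity
  have hS1 := mul_nonneg hC1p.le (Sf_nonneg (s := s) γ u x (x + h))
  have hC2g : 0 ≤ C2 * g ^ 2 := by positivity
  rcases eq_or_ne h 0 with rfl | hne0
  · simp only [add_zero, sub_self, norm_zero, abs_zero]
    simp only [add_zero] at hS1
    simp; linarith
  have hha : 0 < |h| := abs_pos.2 hne0
  have hhr := rpow_pos_of_pos hha sM
  rcases le_or_gt |h| h0 with hn | hf
  · have hn' := near_sym (u := u) hs0 hγ hΛ hP hs2 hP0 hE hc hb hK (x := x) (y := x + h)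
      (by intro h1; apply hne0; linarith) (by rwa [add_sub_cancel_left])
    rw [add_sub_cancel_left] at hn'
    have e : deriv u (x + h) - deriv u x = ‖deriv γ (x + h)‖ • (Dg γ u (x + h) - Dg γ u x) + (‖deriv γ (x + h)‖ - ‖deriv γ x‖) • Dg γ u x := by
      have : ∀ z, deriv u z = ‖deriv γ z‖ • Dg γ u z := fun z => by
        unfold Dg
        rw [smul_smul, mul_inv_cancel₀ (norm_ne_zero_iff.2 (hne z)), one_smul]
      rw [this (x + h), this x, smul_sub, sub_smul]; abel
    have h1 : ‖deriv u (x + h) - deriv u x‖ ≤ K * ‖Dg γ u (x + h) - Dg γ u x‖ + M * g * ‖deriv γ (x + h) - deriv γ x‖ := by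
      rw [e]
      refine (norm_add_le _ _).trans ?_
      rw [norm_smul, norm_smul, norm_norm, norm_eq_abs]
      refine add_le_add (mul_le_mul_of_nonneg_right (hK _) (norm_nonneg _)) ?_
      rw [mul_comm]
      exact mul_le_mul (hsu x) (abs_norm_sub_norm_le _ _) (abs_nonneg _) pz
    have h2 : ‖deriv u (x + h) - deriv u x‖ ^ 2 ≤ 2 * K ^ 2 * ‖Dg γ u (x + h) - Dg γ u x‖ ^ 2 + 2 * (M * g) ^ 2 * ‖deriv γ (x + h) - deriv γ x‖ ^ 2 := by
      have := pow_le_pow_left₀ (norm_nonneg _) h1 2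
      nlinarith [sq_nonneg (K * ‖Dg γ u (x + h) - Dg γ u x‖ - M * g * ‖deriv γ (x + h) - deriv γ x‖)]
    have h3 := div_le_div_of_nonneg_right h2 hhr.le
    rw [add_div, mul_div_assoc, mul_div_assoc (2 * (M * g) ^ 2)] at h3
    have h4 := mul_le_mul_of_nonneg_left hn' (by positivity : 0 ≤ 2 * K ^ 2)
    have h5 : 2 * K ^ 2 * (8 * K ^ sP / c ^ 4 * Sf s γ u x (x + h)) = C1 * Sf s γ u x (x + h) := by rw [hC1]; ring
    have h6 := h4.trans_eq h5
    linarith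
  · have h1 : ‖deriv u (x + h) - deriv u x‖ ≤ 2 * (K * M * g) :=
      (norm_sub_le _ _).trans (by linarith [hdu (x + h), hdu x])
    have h2 : h0 ^ sM ≤ |h| ^ sM :=
      rpow_le_rpow hh0p.le hf.le (by linarith)
    have h3 : ‖deriv u (x + h) - deriv u x‖ ^ 2 / |h| ^ sM ≤ (2 * (K * M * g)) ^ 2 / h0 ^ sM := by
      have := pow_le_pow_left₀ (norm_nonneg _) h1 2
      exact div_le_div₀ pz this hhp h2
    have h4 : (2 * (K * M * g)) ^ 2 / h0 ^ sM = C2 * g ^ 2 := by rw [hC2]; ring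
    linarith
theorem meas_swap {f : ℝ → ℝ → ℝ} (h : Measurable fun z : ℝ × ℝ => f z.1 z.2) : Measurable fun z : ℝ × ℝ => f z.2 z.1 := h.comp measurable_swap
theorem I2_sum4 {f g : ℝ → ℝ → ℝ} (hf : Measurable fun z : ℝ × ℝ => f z.1 z.2) (hg : Measurable fun z : ℝ × ℝ => g z.1 z.2) (f0 : ∀ x y, 0 ≤ f x y) (g0 : ∀ x y, 0 ≤ g x y) : I2 (fun x y => f x y + f y x + g x y + g y x) = 2 * I2 f + 2 * I2 g := by
  have hf' := meas_swap hf
  have hg' := meas_swap hg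
  unfold I2
  have e : ∀ z : ℝ × ℝ, oR (f z.1 z.2 + f z.2 z.1 + g z.1 z.2 + g z.2 z.1) = oR (f z.1 z.2) + oR (f z.2 z.1) + oR (g z.1 z.2) + oR (g z.2 z.1) :=
    fun z => by
      have a1 := f0 z.1 z.2
      have a2 := f0 z.2 z.1
      have a3 := g0 z.1 z.2
      have a4 := g0 z.2 z.1
      rw [ofReal_add pz a4, ofReal_add pz a3, ofReal_add a1 a2]
  simp_rw [e]
  rw [lintegral_add_left (by fun_prop), lintegral_add_left (by fun_prop), lintegral_add_left (by fun_prop)]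
  have s1 := lint_mu2_swap fun z => oR (f z.1 z.2)
  have s3 := lint_mu2_swap fun z => oR (g z.1 z.2)
  simp only [Prod.fst_swap, Prod.snd_swap] at s1 s3
  rw [s1, s3, two_mul, two_mul, add_assoc, add_assoc]
theorem I2_Sf (hs : 0 < s) {γ u : Cv} (hγ : InHs s γ) (hu : InHs s u) {g : ℝ} (hG : GE s γ u ≤ oR (g ^ 2)) : I2 (Sf s γ u) ≤ oR (4 * g ^ 2) := by
  obtain ⟨g1, -, g3, -, -⟩ := GE_comp hs hG
  have := I2_sum4 (f := k1 s γ u) (g := k3 s γ u) (k1_meas hγ hu) (k3_meas hγ hu)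
    (k1_nonneg γ u) (k3_nonneg γ u)
  calc I2 (Sf s γ u) = 2 * I2 (k1 s γ u) + 2 * I2 (k3 s γ u) := this
    _ ≤ oR (g ^ 2) + 2 * oR (g ^ 2) := by gcongr
    _ = 3 * oR (g ^ 2) := by rw [show (3 : ℝ≥0∞) = 1 + 2 by norm_num, add_mul, one_mul]
    _ ≤ _ := by
      rw [ofReal_mul (p := 4) (by norm_num), ENNReal.ofReal_ofNat]
      gcongr; norm_num
theorem Sf_meas {γ u : Cv} (hγ : InHs s γ) (hu : InHs s u) : Measurable fun z : ℝ × ℝ => Sf s γ u z.1 z.2 := by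
  have m1 := meas_swap (f := k1 s γ u) (k1_meas hγ hu)
  have m3 := meas_swap (f := k3 s γ u) (k3_meas hγ hu)
  exact (((k1_meas hγ hu).add m1).add (k3_meas hγ hu)).add m3
set_option maxHeartbeats 2000000 in
theorem lower (hs0 : 3/2 < s) (hs2 : s < 2) {Λ c K : ℝ} (hΛ : 0 < Λ) (hc : 0 < c) (hK0 : 0 < K) : ∃ C : ℝ, 0 < C ∧ ∀ (γ u : Cv), InHs s γ → (∀ x, c ≤ ‖deriv γ x‖) → (∀ x, ‖deriv γ x‖ ≤ K) → I2 (k1 s γ γ) ≤ oR Λ → InHs s u → ∀ g > 0, GE s γ u ≤ oR (g ^ 2) → gS u ≤ oR (C * g ^ 2) * (1 + gS γ) ∧ ∀ x, ‖u x‖ ≤ C * g ∧ ‖deriv u x‖ ≤ C * g := by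
  obtain ⟨P, hP, hP0⟩ := P0_ex hs0 Λ hΛ
  obtain ⟨M, hM, hsup⟩ := supS (n := n) hs0 hs2 hΛ
  set h0 := P / K with hh0
  have hh0p : 0 < h0 := by positivity
  have hhp := rpow_pos_of_pos hh0p sM
  set C1 := 2 * K ^ 2 * (8 * K ^ sP / c ^ 4) with hC1
  have hC1p : 0 < C1 := by have := rpow_pos_of_pos hK0 sP; positivity
  set C2 := 4 * (K * M) ^ 2 / h0 ^ sM with hC2
  have hC2p : 0 < C2 := by positivity
  refine ⟨4 * C1 + 2 * M ^ 2 + C2 + M + K * M, by positivity, fun γ u hγ hb hK hE hu g hg hG => ?_⟩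
  have hne : ∀ x, deriv γ x ≠ 0 := fun x => norm_pos_iff.1 (hc.trans_le (hb x))
  have hsu := hsup γ u hγ hne hE hu g hg hG
  have hdu : ∀ x, ‖deriv u x‖ ≤ K * M * g := fun x => by
    rw [Dg_mul (hne x)]
    calc _ ≤ M * g * K := mul_le_mul (hsu x).1 (hK x) (norm_nonneg _) pz
      _ = _ := by ring
  refine ⟨?_, fun x => ⟨(hsu x).2.trans ?_, (hdu x).trans ?_⟩⟩
  rotate_left
  · gcongr; nlinarith [mul_pos hK0 hM, sq_nonneg M]
  · gcongr; nlinarith [mul_pos hK0 hM, sq_nonneg M]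
  have mg := gag_meas hγ.cd (s - 1)
  rw [gag_mu2 hu.cd, gag_mu2 hγ.cd]
  set Gg := ∫⁻ z, oR (‖deriv γ z.2 - deriv γ z.1‖ ^ 2 /
    dT z.1 z.2 ^ (2 * (s - 1) + 1)) ∂mu2 with hGg
  have hIS := I2_Sf (by linarith) hγ hu hG
  have hmS := Sf_meas hγ hu
  calc _ ≤ ∫⁻ z, (oR C1 * oR (Sf s γ u z.1 z.2) + oR (2 * (M * g) ^ 2) * oR (‖deriv γ z.2 - deriv γ z.1‖ ^ 2 / dT z.1 z.2 ^ (2 * (s - 1) + 1)) + oR (C2 * g ^ 2)) ∂mu2 := by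
        refine lintegral_mono fun z => ?_
        have := dT_nonneg z.1 z.2
        rw [← ofReal_mul hC1p.le, ← ofReal_mul pz, ← ofReal_add (mul_nonneg hC1p.le (Sf_nonneg _ _ _ _)) pz, ← ofReal_add (add_nonneg (mul_nonneg hC1p.le (Sf_nonneg _ _ _ _)) pz)
            pz]
        exact ofReal_le_ofReal (low_pt hs0 hs2 hΛ hc hK0 hP hP0 hM hg hγ hu hb hK hE (fun x => (hsu x).1) hdu z.1 z.2)
    _ = oR C1 * I2 (Sf s γ u) + oR (2 * (M * g) ^ 2) * Gg + oR (C2 * g ^ 2) := by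
        rw [lintegral_add_right _ measurable_const, lintegral_add_left (hmS.ennreal_ofReal.const_mul _), lintegral_const_mul' _ _ ofReal_ne_top, lintegral_const_mul' _ _ ofReal_ne_top, lintegral_const, measure_univ, mul_one]
        rfl
    _ ≤ oR C1 * oR (4 * g ^ 2) + oR (2 * (M * g) ^ 2) * Gg + oR (C2 * g ^ 2) := by gcongr
    _ = oR (4 * C1 * g ^ 2 + C2 * g ^ 2) + oR (2 * (M * g) ^ 2) * Gg := by
        rw [← ofReal_mul hC1p.le, add_right_comm, ← ofReal_add pz pz]
        congr 3; ring
    _ ≤ _ := by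
        rw [mul_add, mul_one]
        refine add_le_add (ofReal_le_ofReal ?_)
          (mul_le_mul_left (ofReal_le_ofReal ?_) _)
        · have : 0 ≤ (2 * M ^ 2 + M + K * M) * g ^ 2 := by positivity
          nlinarith
        · have : 0 ≤ (4 * C1 + C2 + M + K * M) * g ^ 2 := by positivity
          nlinarith
theorem cs2 {X : Type*} [MeasurableSpace X] {μ : Measure X} {D A : X → ℝ≥0∞} (hD : Measurable D) (hA : Measurable A) : ∫⁻ x, D x * A x ∂μ ≤ (∫⁻ x, D x ^ 2 ∂μ) ^ (1/2 : ℝ) * (∫⁻ x, A x ^ 2 ∂μ) ^ (1/2 : ℝ) := by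
  have := ENNReal.lintegral_mul_le_Lp_mul_Lq μ (p := 2) (q := 2) (by
    rw [holderConjugate_iff]; norm_num) hD.aemeasurable hA.aemeasurable
  simpa using this
theorem minkL {X : Type*} [MeasurableSpace X] {μ : Measure X} [SFinite μ] {D A : X → ℝ≥0∞} {f : ℝ → X → ℝ≥0∞} {I : Set ℝ} (hD : Measurable D) (hA : Measurable A) (hf : Measurable (Function.uncurry f)) (h : ∀ x, D x ≤ A x + ∫⁻ t in I, f t x) (hfin : ∫⁻ x, D x ^ 2 ∂μ < ⊤) : (∫⁻ x, D x ^ 2 ∂μ) ^ (1/2 : ℝ) ≤ (∫⁻ x, A x ^ 2 ∂μ) ^ (1/2 : ℝ) + ∫⁻ t in I, (∫⁻ x, f t x ^ 2 ∂μ) ^ (1/2 : ℝ) := by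
  set Q := ∫⁻ x, D x ^ 2 ∂μ with hQ
  rcases eq_or_ne Q 0 with h0 | h0
  · rw [h0]; simp
  have hq0 : Q ^ (1/2 : ℝ) ≠ 0 := by simp [h0]
  have hqt : Q ^ (1/2 : ℝ) ≠ ⊤ := (ENNReal.rpow_lt_top_of_nonneg (by norm_num) hfin.ne).ne
  have hQQ : Q ^ (1/2 : ℝ) * Q ^ (1/2 : ℝ) = Q := by rw [← ENNReal.rpow_add _ _ h0 hfin.ne]; norm_num
  have hft : ∀ t, Measurable (f t) := fun t => hf.comp measurable_prodMk_left
  have hfs : Measurable fun p : X × ℝ => f p.2 p.1 := hf.comp measurable_swap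
  have key : Q ≤ Q ^ (1/2 : ℝ) * ((∫⁻ x, A x ^ 2 ∂μ) ^ (1/2 : ℝ) + ∫⁻ t in I, (∫⁻ x, f t x ^ 2 ∂μ) ^ (1/2 : ℝ)) := by
    calc Q ≤ ∫⁻ x, (D x * A x + D x * ∫⁻ t in I, f t x) ∂μ := by
          refine lintegral_mono fun x => ?_
          simp only
          rw [sq, ← mul_add]
          exact mul_le_mul_right (h x) _
      _ = ∫⁻ x, D x * A x ∂μ + ∫⁻ x, (∫⁻ t in I, D x * f t x) ∂μ := by
          rw [lintegral_add_left (f := fun x => D x * A x) (hD.mul hA)]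
          congr 1
          refine lintegral_congr fun x => ?_
          rw [lintegral_const_mul]
          exact hfs.comp measurable_prodMk_left
      _ = ∫⁻ x, D x * A x ∂μ + ∫⁻ t in I, (∫⁻ x, D x * f t x ∂μ) := by
          rw [lintegral_lintegral_swap]
          exact ((hD.comp measurable_fst).mul hfs).aemeasurable
      _ ≤ Q ^ (1/2 : ℝ) * (∫⁻ x, A x ^ 2 ∂μ) ^ (1/2 : ℝ) + ∫⁻ t in I, Q ^ (1/2 : ℝ) * (∫⁻ x, f t x ^ 2 ∂μ) ^ (1/2 : ℝ) :=
          add_le_add (cs2 hD hA) (lintegral_mono fun t => cs2 hD (hft t))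
      _ = _ := by rw [lintegral_const_mul' _ _ hqt, mul_add]
  nth_rewrite 1 [← hQQ] at key
  exact (ENNReal.mul_le_mul_iff_right hq0 hqt).1 key
theorem path_norm {E : Type*} [NormedAddCommGroup E] [NormedSpace ℝ E] {g : ℝ → E} {F : ℝ → ℝ} {T : ℝ} (hF : Continuous F) (hT : 0 ≤ T) (h : ∀ t ∈ Icc 0 T, ∃ g', HasDerivAt g g' t ∧ ‖g'‖ ≤ F t) : oR ‖g T‖ ≤ oR ‖g 0‖ + ∫⁻ t in Ioc 0 T, oR (F t) := by
  choose! g' hg' hb using h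
  have hF0 : ∀ t ∈ Icc 0 T, 0 ≤ F t := fun t ht => (norm_nonneg _).trans (hb t ht)
  have := image_norm_le_of_norm_deriv_right_le_deriv_boundary (f := g) (f' := g') (a := 0) (b := T)
    (B := fun t => ‖g 0‖ + ∫ τ in (0:ℝ)..t, F τ) (B' := F)
    (fun t ht => (hg' t ht).continuousAt.continuousWithinAt)
    (fun t ht => (hg' t ⟨ht.1, ht.2.le⟩).hasDerivWithinAt) (by simp)
    (fun t => ((hF.integral_hasStrictDerivAt 0 t).hasDerivAt).const_add _)
    (fun t ht => hb t ⟨ht.1, ht.2.le⟩) (right_mem_Icc.2 hT)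
  refine (ofReal_le_ofReal this).trans (ENNReal.ofReal_add_le.trans ?_)
  gcongr
  rw [intervalIntegral.integral_of_le hT, ofReal_integral_eq_lintegral_ofReal]
  · exact (hF.intervalIntegrable 0 T).1
  · refine (ae_restrict_iff' measurableSet_Ioc).2 (Eventually.of_forall fun t ht => hF0 t ⟨ht.1.le, ht.2⟩)
def Wt (s : ℝ) (a b d : En n) : ℝ :=
  (‖a‖ ^ 2) ^ (1/4 : ℝ) * (‖b‖ ^ 2) ^ (1/4 : ℝ) * (‖d‖ ^ 2) ^ (-(s + 1/2) / 2)
theorem sq_rp {x : ℝ} (hx : 0 < x) (q r : ℝ) (h : 4 * q = r) : ((x ^ 2) ^ q) ^ 2 = x ^ r := by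
  rw [← rpow_natCast x 2, ← rpow_mul hx.le, ← rpow_natCast _ 2, ← rpow_mul hx.le]
  congr 1; push_cast; linarith
theorem Wt_sq {a b d : En n} (ha : a ≠ 0) (hb : b ≠ 0) (hd : d ≠ 0) : Wt s a b d ^ 2 = ‖a‖ * ‖b‖ / ‖d‖ ^ sP := by
  have ha := norm_pos_iff.2 ha
  have hb := norm_pos_iff.2 hb
  have hd := norm_pos_iff.2 hd
  unfold Wt
  rw [mul_pow, mul_pow, sq_rp ha _ 1 (by norm_num), sq_rp hb _ 1 (by norm_num), sq_rp hd _ (-sP) (by ring), rpow_one, rpow_one, rpow_neg hd.le, div_eq_mul_inv]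
theorem Wt_nonneg (a b d : En n) : 0 ≤ Wt s a b d := by unfold Wt; positivity
theorem Wt_kk {a b d w p : En n} (ha : a ≠ 0) (hb : b ≠ 0) (hd : d ≠ 0) : Wt s a b d * ‖w - ((‖a‖ ^ 2)⁻¹ * ⟪a, d⟫) • p‖ = √(kk s a b d w p) := by
  rw [eq_comm, sqrt_eq_iff_mul_self_eq (kk_nonneg _ _ _ _ _)
    (mul_nonneg (Wt_nonneg _ _ _) (norm_nonneg _))]
  rw [← sq, mul_pow, Wt_sq ha hb hd, kk]; ring
theorem pw_deriv {a : Cv} {a' : En n} {t : ℝ} (ha : HasDerivAt a a' t) (h0 : a t ≠ 0) (q : ℝ) : ∃ w', HasDerivAt (fun τ => (‖a τ‖ ^ 2) ^ q) w' t ∧ |w'| ≤ (‖a t‖ ^ 2) ^ q * (2 * |q| * (‖a'‖ / ‖a t‖)) := by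
  have hp := norm_pos_iff.2 h0
  refine ⟨_, (ha.norm_sq).rpow_const (p := q) (Or.inl pz), ?_⟩
  have h1 := abs_real_inner_le_norm (a t) a'
  rw [abs_mul, abs_mul, abs_mul, abs_two, rpow_sub_one pz, abs_of_nonneg (by positivity : 0 ≤ (‖a t‖ ^ 2) ^ q / ‖a t‖ ^ 2)]
  calc 2 * |⟪a t, a'⟫| * |q| * ((‖a t‖ ^ 2) ^ q / ‖a t‖ ^ 2) ≤ 2 * (‖a t‖ * ‖a'‖) * |q| * ((‖a t‖ ^ 2) ^ q / ‖a t‖ ^ 2) := by gcongr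
    _ = _ := by field_simp
theorem log_mul {f g : ℝ → ℝ} {t α β : ℝ} (f0 : 0 ≤ f t) (g0 : 0 ≤ g t) (hf : ∃ w, HasDerivAt f w t ∧ |w| ≤ f t * α) (hg : ∃ w, HasDerivAt g w t ∧ |w| ≤ g t * β) : ∃ w, HasDerivAt (fun τ => f τ * g τ) w t ∧ |w| ≤ f t * g t * (α + β) := by
  obtain ⟨u, hu, hu'⟩ := hf
  obtain ⟨v, hv, hv'⟩ := hg
  refine ⟨_, hu.mul hv, (abs_add_le _ _).trans ?_⟩
  rw [abs_mul, abs_mul, abs_of_nonneg f0, abs_of_nonneg g0]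
  nlinarith [mul_le_mul_of_nonneg_right hu' g0, mul_le_mul_of_nonneg_left hv' f0]
theorem Wt_deriv (hs : 0 < s) {a b d : Cv} {a' b' d' : En n} {t : ℝ} (ha : HasDerivAt a a' t) (hb : HasDerivAt b b' t) (hd : HasDerivAt d d' t) (ha0 : a t ≠ 0) (hb0 : b t ≠ 0) (hd0 : d t ≠ 0) : ∃ w', HasDerivAt (fun τ => Wt s (a τ) (b τ) (d τ)) w' t ∧ |w'| ≤ Wt s (a t) (b t) (d t) * (1/2 * (‖a'‖ / ‖a t‖) + 1/2 * (‖b'‖ / ‖b t‖) + (s + 1/2) * (‖d'‖ / ‖d t‖)) := by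
  have := log_mul pz pz (log_mul pz pz
    (pw_deriv ha ha0 (1/4)) (pw_deriv hb hb0 (1/4))) (pw_deriv hd hd0 (-(s + 1/2) / 2))
  obtain ⟨w, h1, h2⟩ := this
  refine ⟨w, h1, h2.trans (le_of_eq ?_)⟩
  unfold Wt
  congr 1
  rw [abs_of_neg (by linarith : -(s + 1/2) / 2 < 0), abs_of_pos (by norm_num : (0:ℝ) < 1/4)]
  ring
theorem N_deriv {a d : Cv} {a' d' : En n} {t : ℝ} (ha : HasDerivAt a a' t) (hd : HasDerivAt d d' t) (ha0 : a t ≠ 0) : ∃ N', HasDerivAt (fun τ => d τ - ((‖a τ‖ ^ 2)⁻¹ * ⟪a τ, d τ⟫) • a τ) N' t ∧ ‖N'‖ ≤ 2 * ‖d' - ((‖a t‖ ^ 2)⁻¹ * ⟪a t, d t⟫) • a'‖ + ‖d t - ((‖a t‖ ^ 2)⁻¹ * ⟪a t, d t⟫) • a t‖ * (‖a'‖ / ‖a t‖) := by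
  have hp := norm_pos_iff.2 ha0
  have hc := (ha.norm_sq.inv pz).mul (ha.inner ℝ hd)
  refine ⟨_, hd.fun_sub (hc.smul ha), ?_⟩
  set c := (‖a t‖ ^ 2)⁻¹ * ⟪a t, d t⟫ with hcd
  set R := d' - c • a'
  set N := d t - c • a t
  have e : (-(2 * ⟪a t, a'⟫) / (‖a t‖ ^ 2) ^ 2 * ⟪a t, d t⟫ + (‖a t‖ ^ 2)⁻¹ * (⟪a t, d'⟫ + ⟪a', d t⟫)) = (‖a t‖ ^ 2)⁻¹ * (⟪a t, R⟫ + ⟪a', N⟫) := by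
    simp only [R, N, inner_sub_right, inner_smul_right, hcd, real_inner_comm a']
    rw [real_inner_comm (a t) a']
    field_simp; ring
  have h1 : ‖(‖a t‖ ^ 2)⁻¹ * (⟪a t, R⟫ + ⟪a', N⟫)‖ * ‖a t‖ ≤ ‖R‖ + ‖N‖ * (‖a'‖ / ‖a t‖) := by
    have h2 : |⟪a t, R⟫ + ⟪a', N⟫| ≤ ‖a t‖ * ‖R‖ + ‖a'‖ * ‖N‖ :=
      (abs_add_le _ _).trans (add_le_add (abs_real_inner_le_norm _ _) (abs_real_inner_le_norm _ _))
    rw [norm_eq_abs, abs_mul, abs_of_pos (by positivity : 0 < (‖a t‖ ^ 2)⁻¹)]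
    calc _ ≤ (‖a t‖ ^ 2)⁻¹ * (‖a t‖ * ‖R‖ + ‖a'‖ * ‖N‖) * ‖a t‖ := by gcongr
      _ = _ := by field_simp
  calc ‖d' - (c • a' + (-(2 * ⟪a t, a'⟫) / (‖a t‖ ^ 2) ^ 2 * ⟪a t, d t⟫ + (‖a t‖ ^ 2)⁻¹ * (⟪a t, d'⟫ + ⟪a', d t⟫)) • a t)‖ = ‖R - ((‖a t‖ ^ 2)⁻¹ * (⟪a t, R⟫ + ⟪a', N⟫)) • a t‖ := by
        rw [e, sub_add_eq_sub_sub]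
    _ ≤ ‖R‖ + ‖(‖a t‖ ^ 2)⁻¹ * (⟪a t, R⟫ + ⟪a', N⟫)‖ * ‖a t‖ := by rw [← norm_smul]; exact norm_sub_le _ _
    _ ≤ _ := by linarith
def fk (s : ℝ) (γ u : Cv) (x y : ℝ) : ℝ :=
  18 * k1 s γ u x y + 9 * (2 * s + 1) * k2 s γ u x y + 9 * k3 s γ u x y
theorem fk_alg {A B α β δ s : ℝ} (hs : 0 < s) (hs2 : s < 2) : (2 * A + B * (3/2 * α + 1/2 * β + (s + 1/2) * δ)) ^ 2 ≤ 18 * A ^ 2 + 9 * (2 * s + 1) * (B ^ 2 * δ ^ 2) + 9 * (B ^ 2 * (α ^ 2 + β ^ 2)) := by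
  have h1 : (2 * A + B * (3/2 * α + 1/2 * β + (s + 1/2) * δ)) ^ 2 ≤ 4 * ((2 * A) ^ 2 + (3/2 * (B * α)) ^ 2 + (1/2 * (B * β)) ^ 2 + ((s + 1/2) * (B * δ)) ^ 2) := by
    have e : (2 * A + B * (3/2 * α + 1/2 * β + (s + 1/2) * δ)) = 2 * A + 3/2 * (B * α) + 1/2 * (B * β) + (s + 1/2) * (B * δ) := by ring
    rw [e]
    generalize 2 * A = p
    generalize 3/2 * (B * α) = q
    generalize 1/2 * (B * β) = r
    generalize (s + 1/2) * (B * δ) = v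
    nlinarith [sq_nonneg (p - q), sq_nonneg (p - r), sq_nonneg (p - v), sq_nonneg (q - r), sq_nonneg (q - v), sq_nonneg (r - v)]
  have h2 : 4 * (s + 1/2) ^ 2 ≤ 9 * (2 * s + 1) := by nlinarith
  have h3 := mul_le_mul_of_nonneg_right h2 (sq_nonneg (B * δ))
  nlinarith [sq_nonneg A, sq_nonneg (B * α), sq_nonneg (B * β)]
theorem g_deriv (hs : 0 < s) (hs2 : s < 2) {a b d : Cv} {a' b' d' : En n} {t : ℝ} (ha : HasDerivAt a a' t) (hb : HasDerivAt b b' t) (hd : HasDerivAt d d' t) (ha0 : a t ≠ 0) (hb0 : b t ≠ 0) (hd0 : d t ≠ 0) : ∃ g', HasDerivAt (fun τ => Wt s (a τ) (b τ) (d τ) • (d τ - ((‖a τ‖ ^ 2)⁻¹ * ⟪a τ, d τ⟫) • a τ)) g' t ∧ ‖g'‖ ≤ √(18 * kk s (a t) (b t) (d t) d' a' + 9 * sP * (kk s (a t) (b t) (d t) (d t) (a t) * (‖d'‖ ^ 2 / ‖d t‖ ^ 2))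
        + 9 * (kk s (a t) (b t) (d t) (d t) (a t) * (‖‖a t‖⁻¹ • a'‖ ^ 2 + ‖‖b t‖⁻¹ • b'‖ ^ 2))) := by
  obtain ⟨w, hw, hw'⟩ := Wt_deriv hs ha hb hd ha0 hb0 hd0
  obtain ⟨N, hN, hN'⟩ := N_deriv ha hd ha0
  refine ⟨_, hw.smul hN, le_sqrt_of_sq_le ?_⟩
  have hW := Wt_nonneg (s := s) (a t) (b t) (d t)
  have e1 := Wt_kk (s := s) (w := d') (p := a') ha0 hb0 hd0
  have e2 := Wt_kk (s := s) (w := d t) (p := a t) ha0 hb0 hd0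
  have e3 : ∀ (p q : En n), ‖‖p‖⁻¹ • q‖ = ‖q‖ / ‖p‖ := fun p q => by
    rw [norm_smul, norm_inv, norm_norm, div_eq_inv_mul]
  rw [e3, e3, ← div_pow, ← sq_sqrt (kk_nonneg (s := s) (a t) (b t) (d t) d' a'), ← sq_sqrt (kk_nonneg (s := s) (a t) (b t) (d t) (d t) (a t)), ← e1, ← e2]
  refine le_trans (pow_le_pow_left₀ (norm_nonneg _) ?_ 2) (fk_alg hs hs2)
  refine (norm_add_le _ _).trans ?_
  rw [norm_smul, norm_smul, norm_eq_abs, norm_eq_abs, abs_of_nonneg hW]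
  have h1 := mul_le_mul_of_nonneg_left hN' hW
  have h2 := mul_le_mul_of_nonneg_right hw' (norm_nonneg (d t - ((‖a t‖ ^ 2)⁻¹ * ⟪a t, d t⟫) • a t))
  refine (add_le_add h1 h2).trans (le_of_eq ?_)
  ring
theorem kk_cont (hs : 0 < s) {a b d w p : Cv} (ha : Continuous a) (hb : Continuous b) (hd : Continuous d) (hw : Continuous w) (hp : Continuous p) (ha0 : ∀ t, a t ≠ 0) (hd0 : ∀ t, d t ≠ 0) : Continuous fun t => kk s (a t) (b t) (d t) (w t) (p t) := by
  unfold kk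
  have h1 : Continuous fun t => (‖a t‖ ^ 2)⁻¹ :=
    (ha.norm.pow 2).inv₀ fun t => pow_ne_zero _ (norm_ne_zero_iff.2 (ha0 t))
  have h2 : Continuous fun t => ‖d t‖ ^ sP :=
    hd.norm.rpow_const fun t => Or.inl (norm_ne_zero_iff.2 (hd0 t))
  refine Continuous.div ?_ h2 fun t => (rpow_pos_of_pos (norm_pos_iff.2 (hd0 t)) _).ne'
  fun_prop
theorem fk_cont (hs : 0 < s) {γ u : ℝ → Cv} {x y : ℝ} (h1 : ∀ x, Continuous fun t => γ t x) (h2 : ∀ x, Continuous fun t => deriv (γ t) x) (h3 : ∀ x, Continuous fun t => u t x) (h4 : ∀ x, Continuous fun t => deriv (u t) x) (h0 : ∀ t x, deriv (γ t) x ≠ 0) (hd0 : ∀ t, γ t y - γ t x ≠ 0) : Continuous fun t => fk s (γ t) (u t) x y := by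
  have a1 : Continuous fun t => k1 s (γ t) (u t) x y :=
    kk_cont hs (h2 x) (h2 y) ((h1 y).sub (h1 x)) ((h3 y).sub (h3 x)) (h4 x) (fun t => h0 t x) hd0
  have a2 : Continuous fun t => k1 s (γ t) (γ t) x y :=
    kk_cont hs (h2 x) (h2 y) ((h1 y).sub (h1 x)) ((h1 y).sub (h1 x)) (h2 x) (fun t => h0 t x) hd0
  have a3 : ∀ x, Continuous fun t => Dg (γ t) (u t) x := fun x =>
    ((h2 x).norm.inv₀ fun t => norm_ne_zero_iff.2 (h0 t x)).smul (h4 x)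
  have a4 : Continuous fun t => ‖u t y - u t x‖ ^ 2 / ‖γ t y - γ t x‖ ^ 2 :=
    (((h3 y).sub (h3 x)).norm.pow 2).div (((h1 y).sub (h1 x)).norm.pow 2)
      fun t => pow_ne_zero _ (norm_ne_zero_iff.2 (hd0 t))
  have a5 := (a3 x).norm.pow 2
  have a6 := (a3 y).norm.pow 2
  unfold fk k2 k3
  exact ((a1.const_mul 18).add ((a2.mul a4).const_mul _)).add ((a2.mul (a5.add a6)).const_mul _)
theorem fk_nonneg (hs : 0 < s) (γ u : Cv) (x y : ℝ) : 0 ≤ fk s γ u x y := by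
  have := k1_nonneg (s := s) γ u x y
  have := k2_nonneg (s := s) γ u x y
  have := k3_nonneg (s := s) γ u x y
  unfold fk; positivity
theorem I2_comb3 {f g h : ℝ → ℝ → ℝ} (hf : Measurable fun z : ℝ × ℝ => f z.1 z.2) (hg : Measurable fun z : ℝ × ℝ => g z.1 z.2)
    (f0 : ∀ x y, 0 ≤ f x y) (g0 : ∀ x y, 0 ≤ g x y) (h0 : ∀ x y, 0 ≤ h x y) {a b c : ℝ} (ha : 0 ≤ a)
    (hb : 0 ≤ b) (hc : 0 ≤ c) :
    I2 (fun x y => a * f x y + b * g x y + c * h x y) = oR a * I2 f + oR b * I2 g + oR c * I2 h := by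
  unfold I2
  have e : ∀ z : ℝ × ℝ, oR (a * f z.1 z.2 + b * g z.1 z.2 + c * h z.1 z.2) = oR a * oR (f z.1 z.2) + oR b * oR (g z.1 z.2) + oR c * oR (h z.1 z.2) := fun z => by
    have a1 := mul_nonneg ha (f0 z.1 z.2)
    have a2 := mul_nonneg hb (g0 z.1 z.2)
    have a3 := mul_nonneg hc (h0 z.1 z.2)
    rw [ofReal_add pz a3, ofReal_add a1 a2, ofReal_mul ha, ofReal_mul hb, ofReal_mul hc]
  simp_rw [e]
  rw [lintegral_add_left (by fun_prop), lintegral_add_left (by fun_prop), lintegral_const_mul' _ _ ofReal_ne_top, lintegral_const_mul' _ _ ofReal_ne_top, lintegral_const_mul' _ _ ofReal_ne_top]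
theorem I2_fk (hs : 0 < s) {γ u : Cv} (hγ : InHs s γ) (hu : InHs s u) : I2 (fk s γ u) ≤ 9 * GE s γ u := by
  have := I2_comb3 (f := k1 s γ u) (g := k2 s γ u) (h := k3 s γ u) (k1_meas hγ hu) (k2_meas hγ hu)
    (k1_nonneg γ u) (k2_nonneg γ u) (k3_nonneg γ u) (a := 18) (b := 9 * sP) (c := 9)
    (by norm_num) pz (by norm_num)
  calc I2 (fk s γ u) = _ := this
    _ = 9 * (2 * I2 (k1 s γ u) + oR sP * I2 (k2 s γ u) + I2 (k3 s γ u)) := by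
      rw [ofReal_mul (by norm_num), mul_add, mul_add, ← mul_assoc, ← mul_assoc]
      norm_num
    _ ≤ _ := by
      unfold GE
      refine mul_le_mul_right ?_ _
      rw [add_assoc _ (I1 _)]
      exact le_self_add
theorem ofReal_sqrt_sq {a : ℝ} (ha : 0 ≤ a) : oR √a ^ 2 = oR a := by rw [← ENNReal.ofReal_pow (sqrt_nonneg _), sq_sqrt ha]
namespace C1Path
theorem ne_all (P : C1Path s n) {x y t t' : ℝ} (ht : t ∈ U1) (ht' : t' ∈ U1) (h : P.Γ t y - P.Γ t x ≠ 0) : P.Γ t' y - P.Γ t' x ≠ 0 := by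
  intro h1
  obtain ⟨k, rfl⟩ := inj_mod (P.mem t' ht') (sub_eq_zero.1 h1)
  exact h (by rw [per_int (P.mem t ht).1.1, sub_self])
theorem E_pt (hs0 : 3/2 < s) (hs2 : s < 2) (P : C1Path s n) {T : ℝ} (hT : T ∈ U1) (x y : ℝ) : oR √(k1 s (P.Γ T) (P.Γ T) x y) ≤ oR √(k1 s (P.Γ 0) (P.Γ 0) x y) + ∫⁻ t in Ioc 0 T, oR √(fk s (P.Γ (cl t)) (P.V (cl t)) x y) := by
  have hs : 0 < s := by linarith
  by_cases h : P.Γ T y - P.Γ T x = 0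
  · have : k1 s (P.Γ T) (P.Γ T) x y = 0 := by
      unfold k1 kk
      rw [h, norm_zero, zero_rpow (by linarith), div_zero]
    rw [this]; simp
  have hne : ∀ t ∈ U1, P.Γ t y - P.Γ t x ≠ 0 := fun t ht => P.ne_all hT ht h
  have hd : ∀ t ∈ U1, ∀ x, deriv (P.Γ t) x ≠ 0 := fun t ht x => (P.mem t ht).2.2 x
  set g : Cv := fun τ => Wt s (P.Gd τ x) (P.Gd τ y) (P.Gx τ y - P.Gx τ x) • ((P.Gx τ y - P.Gx τ x) - ((‖P.Gd τ x‖ ^ 2)⁻¹ * ⟪P.Gd τ x, P.Gx τ y - P.Gx τ x⟫) • P.Gd τ x)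
    with hg
  have hgn : ∀ t ∈ U1, ‖g t‖ = √(k1 s (P.Γ t) (P.Γ t) x y) := by
    intro t ht
    have e := P.G_eq hs0 ht
    simp only [hg, ← (e _).1, ← (e _).2]
    rw [norm_smul, norm_eq_abs, abs_of_nonneg (Wt_nonneg _ _ _), Wt_kk (hd t ht x) (hd t ht y) (hne t ht), k1]
  rw [← hgn T hT, ← hgn 0 (by simp)]
  have hc := P.cont_cl hs0
  have hv := P.V_cont hs0
  refine path_norm ?_ hT.1 ?_
  · refine (fk_cont (γ := fun t => P.Γ (cl t)) (u := fun t => P.V (cl t)) hs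
      (fun x => hc.1.comp (by fun_prop : Continuous fun t : ℝ => (t, x)))
      (fun x => hc.2.comp (by fun_prop : Continuous fun t : ℝ => (t, x)))
      (fun x => hv.1.comp (by fun_prop : Continuous fun t : ℝ => (t, x)))
      (fun x => hv.2.comp (by fun_prop : Continuous fun t : ℝ => (t, x)))
      (fun t => hd _ (cl_mem t)) (fun t => hne _ (cl_mem t))).sqrt
  · intro t ht
    have ht' : t ∈ U1 := ⟨ht.1, ht.2.trans hT.2⟩
    have e := P.G_eq hs0 ht'
    have e' := P.V_eq ht'
    have := g_deriv hs hs2 (P.Gx_hd hs0 t x).2 (P.Gx_hd hs0 t y).2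
      ((P.Gx_hd hs0 t y).1.fun_sub (P.Gx_hd hs0 t x).1) (by rw [← (e x).2]; exact hd t ht' x)
      (by rw [← (e y).2]; exact hd t ht' y) (by rw [← (e x).1, ← (e y).1]; exact hne t ht')
    obtain ⟨g', h1, h2⟩ := this
    refine ⟨g', h1, h2.trans (le_of_eq ?_)⟩
    rw [cl_eq ht']
    simp only [← (e _).1, ← (e _).2, ← (e' _).1, ← (e' _).2]
    rfl
theorem fk_fam (hs0 : 3/2 < s) (P : C1Path s n) : Measurable fun p : ℝ × ℝ × ℝ =>
    fk s (P.Γ (cl p.1)) (P.V (cl p.1)) p.2.1 p.2.2 := by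
  have hc := P.cont_cl hs0
  have hv := P.V_cont hs0
  have a := k1_fam (s := s) (γ := fun t => P.Γ (cl t)) (v := fun t => P.V (cl t)) hc.1 hc.2 hv.1 hv.2
  have b := k2_fam (s := s) (γ := fun t => P.Γ (cl t)) (u := fun t => P.V (cl t)) hc.1 hc.2 hv.1
  have c := k3_fam (s := s) (γ := fun t => P.Γ (cl t)) (u := fun t => P.V (cl t)) hc.1 hc.2 hv.2
  unfold fk
  exact ((a.const_mul _).add (b.const_mul _)).add (c.const_mul _)
theorem E_fin (hs0 : 3/2 < s) {γ : Cv} (hγ : InM s γ) : I2 (k1 s γ γ) < ⊤ := by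
  obtain ⟨c, K, A, hc, hA, hg⟩ := hγ.good hs0
  obtain ⟨C, hC, h⟩ := upper (n := n) hs0 hc K A
  have := (GE_comp (by linarith) (h γ γ hg hγ.1)).1
  refine lt_of_le_of_lt ?_ (this.trans_lt ofReal_lt_top)
  rw [two_mul]; exact le_self_add
theorem spd_Ioc (hs0 : 3/2 < s) (P : C1Path s n) {T : ℝ} (hT : T ∈ U1) : ∫⁻ t in Ioc 0 T, P.spd t ≤ oR (pathLen P) := by
  rw [← (P.len_eq hs0).1]
  exact lintegral_mono_set (Ioc_subset_Ioc_right hT.2)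
theorem E_bd (hs0 : 3/2 < s) (hs2 : s < 2) (P : C1Path s n) {T : ℝ} (hT : T ∈ U1) : I2 (k1 s (P.Γ T) (P.Γ T)) ^ (1/2 : ℝ) ≤ I2 (k1 s (P.Γ 0) (P.Γ 0)) ^ (1/2 : ℝ) + 3 * oR (pathLen P) := by
  have h0 : (0:ℝ) ∈ U1 := by simp
  have hm := fun t ht => k1_meas (P.mem t ht).1 (P.mem t ht).1
  have e : ∀ γ : Cv, ∫⁻ z : ℝ × ℝ, oR √(k1 s γ γ z.1 z.2) ^ 2 ∂mu2 = I2 (k1 s γ γ) := fun γ => by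
    unfold I2
    exact lintegral_congr fun z => ofReal_sqrt_sq (k1_nonneg _ _ _ _)
  have hfam : Measurable (Function.uncurry fun (t : ℝ) (z : ℝ × ℝ) =>
      oR √(fk s (P.Γ (cl t)) (P.V (cl t)) z.1 z.2)) :=
    (P.fk_fam hs0).sqrt.ennreal_ofReal
  have := minkL (μ := mu2) (I := Ioc 0 T) (hm T hT).sqrt.ennreal_ofReal
    (hm 0 h0).sqrt.ennreal_ofReal hfam (fun z => P.E_pt hs0 hs2 hT z.1 z.2)
    (by rw [e]; exact E_fin hs0 (P.mem T hT))
  rw [e, e] at this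
  refine this.trans (add_le_add le_rfl ?_)
  refine le_trans ?_ (mul_le_mul_right (P.spd_Ioc hs0 hT) _)
  rw [← lintegral_const_mul' _ _ (by norm_num)]
  refine lintegral_mono fun t => ?_
  have h1 : ∫⁻ z : ℝ × ℝ, oR √(fk s (P.Γ (cl t)) (P.V (cl t)) z.1 z.2) ^ 2 ∂mu2 ≤ 9 * GE s (P.Γ (cl t)) (P.V (cl t)) := by
    refine le_trans (le_of_eq ?_) (I2_fk (by linarith) (P.mem _ (cl_mem t)).1 (P.memV _ (cl_mem t)))
    exact lintegral_congr fun z => ofReal_sqrt_sq (fk_nonneg (by linarith) _ _ _ _)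
  refine (ENNReal.rpow_le_rpow h1 (by norm_num)).trans (le_of_eq ?_)
  rw [ENNReal.mul_rpow_of_nonneg _ _ (by norm_num), spd]
  congr 1
  rw [show (9 : ℝ≥0∞) = 3 ^ (2:ℝ) by norm_num, ← ENNReal.rpow_mul]
  norm_num
end C1Path
theorem G_seq {G : ℝ≥0∞} (hG : G ≠ ⊤) {ε : ℝ} (hε : 0 < ε) : 0 < √G.toReal + ε ∧ G ≤ oR ((√G.toReal + ε) ^ 2) := by
  have h0 := sqrt_nonneg G.toReal
  refine ⟨by linarith, ?_⟩
  rw [← ofReal_toReal hG]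
  refine ofReal_le_ofReal ?_
  rw [ENNReal.toReal_ofReal ENNReal.toReal_nonneg]
  nlinarith [sq_sqrt (ENNReal.toReal_nonneg (a := G))]
theorem lim_g {a C : ℝ} {G : ℝ≥0∞} (hC : 0 < C) (hG : G ≠ ⊤) (h : ∀ g > 0, G ≤ oR (g ^ 2) → a ≤ C * g) : oR a ≤ oR C * G ^ (1/2 : ℝ) := by
  have h1 : a ≤ C * √G.toReal := by
    refine le_of_forall_pos_le_add fun ε hε => ?_
    have := G_seq hG (show 0 < ε / C by positivity)
    refine (h _ this.1 this.2).trans (le_of_eq ?_)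
    field_simp
  refine (ofReal_le_ofReal h1).trans (le_of_eq ?_)
  rw [ofReal_mul hC.le, sqrt_eq_rpow, ← ENNReal.ofReal_rpow_of_nonneg ENNReal.toReal_nonneg (by norm_num), ofReal_toReal hG]
theorem lim_g2 {a X : ℝ≥0∞} {C : ℝ} {G : ℝ≥0∞} (hC : 0 < C) (hG : G ≠ ⊤) (hX : X ≠ ⊤) (h : ∀ g > 0, G ≤ oR (g ^ 2) → a ≤ oR (C * g ^ 2) * X) : a ^ (1/2 : ℝ) ≤ oR √C * G ^ (1/2 : ℝ) * X ^ (1/2 : ℝ) := by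
  have h1 : a ≤ oR (C * (√G.toReal + 0) ^ 2) * X := by
    have ht : Tendsto (fun ε : ℝ => oR (C * (√G.toReal + ε) ^ 2) * X) (𝓝[>] 0)
        (𝓝 (oR (C * (√G.toReal + 0) ^ 2) * X)) := by
      refine ENNReal.Tendsto.mul_const ?_ (Or.inr hX)
      refine (ENNReal.continuous_ofReal.tendsto _).comp ?_
      exact tendsto_nhdsWithin_of_tendsto_nhds ((by fun_prop : Continuous fun ε : ℝ =>
        C * (√G.toReal + ε) ^ 2).tendsto 0)
    refine ge_of_tendsto ht ?_
    filter_upwards [self_mem_nhdsWithin] with ε hε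
    have := G_seq hG hε
    exact h _ this.1 this.2
  rw [add_zero, sq_sqrt ENNReal.toReal_nonneg, ofReal_mul hC.le, ofReal_toReal hG] at h1
  refine (ENNReal.rpow_le_rpow h1 (by norm_num)).trans (le_of_eq ?_)
  rw [ENNReal.mul_rpow_of_nonneg _ _ (by norm_num), ENNReal.mul_rpow_of_nonneg _ _ (by norm_num), sqrt_eq_rpow, ← ENNReal.ofReal_rpow_of_nonneg hC.le (by norm_num)]
namespace C1Path
theorem GE_ne (hs0 : 3/2 < s) (P : C1Path s n) (t : ℝ) : GE s (P.Γ (cl t)) (P.V (cl t)) ≠ ⊤ := by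
  obtain ⟨B, hB, hb⟩ := P.GE_bdd hs0
  exact ((hb _ (cl_mem t)).trans_lt ofReal_lt_top).ne
theorem path_int (hs0 : 3/2 < s) (P : C1Path s n) {E : Type*} [NormedAddCommGroup E] [NormedSpace ℝ E] {g : ℝ → E} {F : ℝ → ℝ} {T C : ℝ} (hF : Continuous F) (hT : T ∈ U1) (hC : 0 ≤ C) (hg0 : g 0 = 0) (h : ∀ t ∈ Icc 0 T, ∃ g', HasDerivAt g g' t ∧ ‖g'‖ ≤ F t) (hb : ∀ t, oR (F t) ≤ oR C * P.spd t) : ‖g T‖ ≤ C * pathLen P := by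
  have := path_norm hF hT.1 h
  rw [hg0, norm_zero, ENNReal.ofReal_zero, zero_add] at this
  have h2 : oR ‖g T‖ ≤ oR (C * pathLen P) := by
    refine this.trans ((lintegral_mono hb).trans ?_)
    rw [lintegral_const_mul' _ _ ofReal_ne_top, ofReal_mul hC]
    exact mul_le_mul_right (P.spd_Ioc hs0 hT) _
  exact (ENNReal.ofReal_le_ofReal_iff (mul_nonneg hC (P.len_eq hs0).2)).1 h2
theorem est1 (hs0 : 3/2 < s) (hs2 : s < 2) {Λ : ℝ} (hΛ : 0 < Λ) : ∃ C : ℝ, 0 < C ∧ ∀ P : C1Path s n, (∀ t ∈ U1, I2 (k1 s (P.Γ t) (P.Γ t)) ≤ oR Λ) → ∀ T ∈ U1, ∀ x, ‖P.Γ T x - P.Γ 0 x‖ ≤ C * pathLen P ∧ |Real.log ‖deriv (P.Γ T) x‖ - Real.log ‖deriv (P.Γ 0) x‖| ≤ C * pathLen P := by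
  obtain ⟨C, hC, hsup⟩ := supS (n := n) hs0 hs2 hΛ
  refine ⟨C, hC, fun P hE T hT x => ?_⟩
  have h0 : (0:ℝ) ∈ U1 := by simp
  have key : ∀ t, oR ‖Dg (P.Γ (cl t)) (P.V (cl t)) x‖ ≤ oR C * P.spd t ∧ oR ‖P.V (cl t) x‖ ≤ oR C * P.spd t := by
    intro t
    have hm := P.mem _ (cl_mem t)
    have := hsup _ _ hm.1 hm.2.2 (hE _ (cl_mem t)) (P.memV _ (cl_mem t))
    exact ⟨lim_g hC (P.GE_ne hs0 t) fun g hg hG => (this g hg hG x).1, lim_g hC (P.GE_ne hs0 t) fun g hg hG => (this g hg hG x).2⟩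
  have hdc := (P.cont_cl hs0).2.comp (by fun_prop : Continuous fun t : ℝ => (t, x))
  have hvd := P.Vd_ct hs0 x
  constructor
  · have := P.path_int (g := fun t => P.Gx t x - P.Γ 0 x) (F := fun t => ‖P.V (cl t) x‖) hs0
      (P.Vx_ct hs0 x).norm hT hC.le (by simp [(P.G_eq hs0 h0 x).1])
      (fun t ht => ⟨_, (P.Gx_hd hs0 t x).1.sub_const _, le_rfl⟩) fun t => (key t).2
    rw [(P.G_eq hs0 hT x).1]; exact this
  · have := P.path_int (g := fun t => Real.log (‖P.Gd t x‖ ^ 2) / 2 - Real.log ‖deriv (P.Γ 0) x‖)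
      (F := fun t => ‖Dg (P.Γ (cl t)) (P.V (cl t)) x‖) (T := T) (C := C) hs0 ?_ hT hC.le ?_ ?_
      fun t => (key t).1
    · rw [norm_eq_abs, Real.log_pow] at this
      convert this using 2
      rw [(P.G_eq hs0 hT x).2]; push_cast; ring
    · unfold Dg
      exact ((hdc.norm.inv₀ fun t => norm_ne_zero_iff.2 ((P.mem _ (cl_mem t)).2.2 x)).smul hvd).norm
    · rw [Real.log_pow, (P.G_eq hs0 h0 x).2]; push_cast; ring
    · intro t ht
      have ht' : t ∈ U1 := ⟨ht.1, ht.2.trans hT.2⟩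
      have e := (P.G_eq hs0 ht' x).2
      have hne : P.Gd t x ≠ 0 := e ▸ (P.mem t ht').2.2 x
      have hn : 0 < ‖P.Gd t x‖ := norm_pos_iff.2 hne
      have hd := ((P.Gx_hd hs0 t x).2.norm_sq.log pz).div_const 2 |>.sub_const
        (Real.log ‖deriv (P.Γ 0) x‖)
      refine ⟨_, hd, ?_⟩
      rw [cl_eq ht', Dg, e, (P.V_eq ht' x).2, norm_smul, norm_inv, norm_norm, norm_eq_abs, abs_div, abs_div, abs_mul, abs_of_pos (by positivity : 0 < ‖P.Gd t x‖ ^ 2)]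
      have hi := abs_real_inner_le_norm (P.Gd t x) (P.Vd t x)
      rw [div_div, div_le_iff₀ pz]
      rw [show |(2:ℝ)| = 2 by norm_num]
      calc _ ≤ 2 * (‖P.Gd t x‖ * ‖P.Vd t x‖) := by linarith
        _ = _ := by field_simp
theorem gag_sq (v : En n) (d p : ℝ) (hd : 0 ≤ d) : oR (√(d ^ p)⁻¹ * ‖v‖) ^ 2 = oR (‖v‖ ^ 2 / d ^ p) := by
  rw [← ENNReal.ofReal_pow pz, mul_pow, sq_sqrt pz]
  congr 1; rw [div_eq_inv_mul]
theorem gag_path (hs0 : 3/2 < s) (P : C1Path s n) {T : ℝ} (hT : T ∈ U1) : gagliardoSqE (s - 1) (deriv fun x => P.Γ T x - P.Γ 0 x) ^ (1/2 : ℝ) ≤ ∫⁻ t in Ioc 0 T, gagliardoSqE (s - 1) (deriv (P.V (cl t))) ^ (1/2 : ℝ) := by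
  have h0 : (0:ℝ) ∈ U1 := by simp
  have hT1 := (P.mem T hT).1
  have h01 := (P.mem 0 h0).1
  have hsub := hT1.sub h01
  set p := 2 * (s - 1) + 1 with hp
  set D := deriv fun x => P.Γ T x - P.Γ 0 x with hD
  have hDe : ∀ x, D x = P.Gd T x - P.Gd 0 x := fun x => by
    rw [← (P.G_eq hs0 hT x).2, ← (P.G_eq hs0 h0 x).2]
    exact ((hT1.hd x).fun_sub (h01.hd x)).deriv
  have hDc : Continuous D := hsub.cd
  have hwm : Measurable fun z : ℝ × ℝ => √(dT z.1 z.2 ^ p)⁻¹ :=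
    ((measurable_dT.pow_const p).inv).sqrt
  have hvc := (P.V_cont hs0).2
  have m := minkL (μ := mu2) (I := Ioc 0 T)
    (D := fun z => oR (√(dT z.1 z.2 ^ p)⁻¹ * ‖D z.2 - D z.1‖))
    (A := fun _ => 0)
    (f := fun t z => oR (√(dT z.1 z.2 ^ p)⁻¹ * ‖P.Vd t z.2 - P.Vd t z.1‖))
    (hwm.mul (by fun_prop : Continuous fun z : ℝ × ℝ => ‖D z.2 - D z.1‖).measurable).ennreal_ofReal
    measurable_const ?_ ?_ ?_
  · simp only [gag_sq _ _ _ (dT_nonneg _ _)] at m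
    rw [← gag_mu2 hDc] at m
    refine m.trans (le_of_eq ?_)
    simp only [ne_eq, OfNat.ofNat_ne_zero, not_false_eq_true, zero_pow, lintegral_zero]
    rw [ENNReal.zero_rpow_of_pos (by norm_num), zero_add]
    refine lintegral_congr fun t => ?_
    rw [gag_mu2 (P.memV _ (cl_mem t)).cd]
    rfl
  · have c1 : Continuous fun q : ℝ × ℝ × ℝ => ‖P.Vd q.1 q.2.2 - P.Vd q.1 q.2.1‖ :=
      ((hvc.comp (by fun_prop : Continuous fun q : ℝ × ℝ × ℝ => (q.1, q.2.2))).sub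
        (hvc.comp (by fun_prop : Continuous fun q : ℝ × ℝ × ℝ => (q.1, q.2.1)))).norm
    exact ((hwm.comp measurable_snd).mul c1.measurable).ennreal_ofReal
  · intro z
    have hw : 0 ≤ √(dT z.1 z.2 ^ p)⁻¹ := sqrt_nonneg _
    have := path_norm (T := T) (g := fun t => √(dT z.1 z.2 ^ p)⁻¹ • ((P.Gd t z.2 - P.Gd 0 z.2) - (P.Gd t z.1 - P.Gd 0 z.1)))
      (F := fun t => √(dT z.1 z.2 ^ p)⁻¹ * ‖P.Vd t z.2 - P.Vd t z.1‖)
      (continuous_const.mul ((P.Vd_ct hs0 _).sub (P.Vd_ct hs0 _)).norm) hT.1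
      (fun t _ => ⟨_, ((((P.Gx_hd hs0 t z.2).2.sub_const _).fun_sub
        ((P.Gx_hd hs0 t z.1).2.sub_const _)).fun_const_smul _), by
          rw [norm_smul, norm_eq_abs, abs_of_nonneg hw]⟩)
    simp only [norm_smul, norm_eq_abs, abs_of_nonneg hw, sub_self, norm_zero, mul_zero, ENNReal.ofReal_zero] at this
    rw [hDe, hDe]
    exact this
  · simp only [gag_sq _ _ _ (dT_nonneg _ _)]
    rw [← gag_mu2 hDc]
    exact hsub.2.2
end C1Path
theorem half_add_le (a b : ℝ≥0∞) : (a + b) ^ (1/2 : ℝ) ≤ a ^ (1/2 : ℝ) + b ^ (1/2 : ℝ) :=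
  ENNReal.rpow_add_le_add_rpow _ _ (by norm_num) (by norm_num)
theorem half_two_le (a b : ℝ≥0∞) : (2 * a + 2 * b) ^ (1/2 : ℝ) ≤ 2 * a ^ (1/2 : ℝ) + 2 * b ^ (1/2 : ℝ) := by
  have h : (2 : ℝ≥0∞) ^ (1/2 : ℝ) ≤ 2 := by
    calc (2 : ℝ≥0∞) ^ (1/2 : ℝ) ≤ 2 ^ (1 : ℝ) :=
          ENNReal.rpow_le_rpow_of_exponent_le (by norm_num) (by norm_num)
      _ = 2 := by simp
  refine (half_add_le _ _).trans ?_
  rw [ENNReal.mul_rpow_of_nonneg _ _ (by norm_num), ENNReal.mul_rpow_of_nonneg _ _ (by norm_num)]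
  exact add_le_add (mul_le_mul_left h _) (mul_le_mul_left h _)
theorem q_solve {Q q L : ℝ≥0∞} (hQ : Q ≠ ⊤) (hL : L ≤ 1/4) (h : Q ≤ 2 * (L * (1 + Q)) + 2 * q) : Q ≤ 1 + 4 * q := by
  rcases eq_or_ne q ⊤ with rfl | hq
  · simp
  have h2 : Q ≤ 2 * (1/4 * (1 + Q)) + 2 * q := h.trans (by gcongr)
  lift Q to NNReal using hQ
  lift q to NNReal using hq
  have e : (1/4 : ℝ≥0∞) = ((1/4 : NNReal) : ℝ≥0∞) := by rw [ENNReal.coe_div (by norm_num)]; norm_num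
  rw [e] at h2
  have h3 : Q ≤ 2 * (1/4 * (1 + Q)) + 2 * q := by exact_mod_cast h2
  have h4 : Q ≤ 1 + 4 * q := by
    have : (Q:ℝ) ≤ 2 * (1/4 * (1 + Q)) + 2 * q := by exact_mod_cast h3
    have : (Q:ℝ) ≤ 1 + 4 * q := by linarith
    exact_mod_cast this
  exact_mod_cast h4
namespace C1Path
theorem est2 (hs0 : 3/2 < s) (hs2 : s < 2) {Λ c K : ℝ} (hΛ : 0 < Λ) (hc : 0 < c) (hK : 0 < K) : ∃ C : ℝ, 0 < C ∧ ∀ P : C1Path s n, (∀ t ∈ U1, I2 (k1 s (P.Γ t) (P.Γ t)) ≤ oR Λ ∧ ∀ x, c ≤ ‖deriv (P.Γ t) x‖ ∧ ‖deriv (P.Γ t) x‖ ≤ K) → ∀ T ∈ U1, (∀ x, ‖P.Γ T x - P.Γ 0 x‖ ≤ C * pathLen P ∧ ‖deriv (P.Γ T) x - deriv (P.Γ 0) x‖ ≤ C * pathLen P) ∧ (C * pathLen P ≤ 1/4 → gagliardoSqE (s - 1) (deriv fun x => P.Γ T x - P.Γ 0 x) ^ (1/2 : ℝ) ≤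
        oR (C * pathLen P) * (2 + 4 * gS (P.Γ 0) ^ (1/2 : ℝ))) := by
  obtain ⟨C, hC, hlow⟩ := lower (n := n) hs0 hs2 hΛ hc hK
  refine ⟨C + √C, by positivity, fun P hE T hT => ?_⟩
  have hl := (P.len_eq hs0).2
  have hsC := sqrt_nonneg C
  have h0 : (0:ℝ) ∈ U1 := by simp
  have hk := fun t => hlow _ _ (P.mem _ (cl_mem t)).1 (fun x => ((hE _ (cl_mem t)).2 x).1)
    (fun x => ((hE _ (cl_mem t)).2 x).2) (hE _ (cl_mem t)).1 (P.memV _ (cl_mem t))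
  have hCl : C * pathLen P ≤ (C + √C) * pathLen P := by nlinarith
  refine ⟨fun x => ⟨?_, ?_⟩, fun hsm => ?_⟩
  · have := P.path_int (g := fun t => P.Gx t x - P.Γ 0 x) (F := fun t => ‖P.V (cl t) x‖) hs0
      (P.Vx_ct hs0 x).norm hT hC.le (by simp [(P.G_eq hs0 h0 x).1])
      (fun t ht => ⟨_, (P.Gx_hd hs0 t x).1.sub_const _, le_rfl⟩)
      fun t => lim_g hC (P.GE_ne hs0 t) fun g hg hG => ((hk t g hg hG).2 x).1
    rw [(P.G_eq hs0 hT x).1]; exact this.trans hCl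
  · have := P.path_int (g := fun t => P.Gd t x - deriv (P.Γ 0) x)
      (F := fun t => ‖deriv (P.V (cl t)) x‖) hs0
      (P.Vd_ct hs0 x).norm hT hC.le (by simp [(P.G_eq hs0 h0 x).2])
      (fun t ht => ⟨_, (P.Gx_hd hs0 t x).2.sub_const _, le_rfl⟩)
      fun t => lim_g hC (P.GE_ne hs0 t) fun g hg hG => ((hk t g hg hG).2 x).2
    rw [(P.G_eq hs0 hT x).2]; exact this.trans hCl
  set L := oR ((C + √C) * pathLen P) with hL
  set q : ℝ → ℝ≥0∞ := fun t => gS (P.Γ t) ^ (1/2 : ℝ) with hq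
  set Q := ⨆ t ∈ U1, q t with hQ
  have hQt : Q ≠ ⊤ := by
    obtain ⟨c', K', A', hc', hA', hg⟩ := P.good hs0
    refine ((iSup₂_le fun t ht => ENNReal.rpow_le_rpow (hg t ht).gag (by norm_num)).trans_lt
      (ENNReal.rpow_lt_top_of_nonneg (by norm_num) (ofReal_ne_top (r := A')))).ne
  have hqQ : ∀ t ∈ U1, q t ≤ Q := fun t ht => le_iSup₂_of_le t ht le_rfl
  have hD : ∀ T ∈ U1, gagliardoSqE (s - 1) (deriv fun x => P.Γ T x - P.Γ 0 x) ^ (1/2 : ℝ) ≤ L * (1 + Q) := by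
    intro T hT
    refine (P.gag_path hs0 hT).trans ?_
    have hb : ∀ t, gagliardoSqE (s - 1) (deriv (P.V (cl t))) ^ (1/2 : ℝ) ≤ oR √C * (1 + Q) * P.spd t := by
      intro t
      have hf : gagliardoSqE (s - 1) (deriv (P.Γ (cl t))) ≠ ⊤ := (P.mem _ (cl_mem t)).1.2.2.ne
      refine (lim_g2 hC (P.GE_ne hs0 t) (X := 1 + gagliardoSqE (s - 1) (deriv (P.Γ (cl t))))
        (by simp [hf]) fun g hg hG => (hk t g hg hG).1).trans ?_
      rw [mul_assoc, mul_assoc, mul_comm (1 + Q)]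
      refine mul_le_mul_right (mul_le_mul_right ((half_add_le _ _).trans ?_) _) _
      rw [ENNReal.one_rpow]
      exact add_le_add le_rfl (hqQ _ (cl_mem t))
    refine (lintegral_mono hb).trans ?_
    rw [lintegral_const_mul _ (P.spd_meas hs0)]
    refine (mul_le_mul_right (P.spd_Ioc hs0 hT) _).trans ?_
    rw [mul_right_comm, ← ofReal_mul hsC]
    refine mul_le_mul_left (ofReal_le_ofReal ?_) _
    nlinarith
  have hL4 : L ≤ 1/4 := by
    rw [hL]
    refine (ofReal_le_ofReal hsm).trans (le_of_eq ?_)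
    rw [ENNReal.ofReal_div_of_pos (by norm_num)]; norm_num
  have hQ2 : Q ≤ 1 + 4 * q 0 := by
    refine q_solve hQt hL4 (iSup₂_le fun t ht => ?_)
    have e : deriv (P.Γ t) = fun x => (1:ℝ) • deriv (fun x => P.Γ t x - P.Γ 0 x) x + (1:ℝ) • deriv (P.Γ 0) x := by
      funext x
      rw [(((P.mem t ht).1.hd x).fun_sub ((P.mem 0 h0).1.hd x)).deriv]
      simp
    have := gag_comb ((P.mem t ht).1.sub (P.mem 0 h0).1).cd (P.mem 0 h0).1.cd (s - 1) 1 1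
    rw [← e] at this
    norm_num at this
    refine ((ENNReal.rpow_le_rpow this (by norm_num)).trans (half_two_le _ _)).trans ?_
    exact add_le_add (mul_le_mul_right (hD t ht) _) le_rfl
  refine (hD T hT).trans (mul_le_mul_right ?_ _)
  calc 1 + Q ≤ 1 + (1 + 4 * q 0) := add_le_add le_rfl hQ2
    _ = _ := by rw [← add_assoc, one_add_one_eq_two]
end C1Path
theorem ex_path {a b : Cv} {ε : ℝ} (h : geodDist s a b < oR ε) : ∃ P : C1Path s n, P.Γ 0 = a ∧ P.Γ 1 = b ∧ pathLen P < ε := by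
  unfold geodDist at h
  obtain ⟨P, h⟩ := iInf_lt_iff.1 h
  obtain ⟨hP, h⟩ := iInf_lt_iff.1 h
  exact ⟨P, hP.1, hP.2, (ENNReal.ofReal_lt_ofReal_iff'.1 h).1⟩
theorem half_sq {a : ℝ≥0∞} {b : ℝ} (hb : 0 ≤ b) (h : a ^ (1/2 : ℝ) ≤ oR b) : a ≤ oR (b ^ 2) := by
  have := ENNReal.rpow_le_rpow h (z := 2) (by norm_num)
  rw [← ENNReal.rpow_mul] at this
  norm_num at this
  rwa [ENNReal.ofReal_pow hb]
theorem half_of {a : ℝ≥0∞} {b : ℝ} (hb : 0 ≤ b) (h : a ≤ oR b) : a ^ (1/2 : ℝ) ≤ oR √b := by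
  rw [sqrt_eq_rpow, ← ENNReal.ofReal_rpow_of_nonneg hb (by norm_num)]
  exact ENNReal.rpow_le_rpow h (by norm_num)
theorem unif (hs0 : 3/2 < s) (hs2 : s < 2) {Λ0 c0 K0 : ℝ} (hΛ : 0 < Λ0) (hc : 0 < c0) (hK : 0 < K0) : ∃ Λ c K : ℝ, 0 < Λ ∧ 0 < c ∧ 0 < K ∧ ∀ P : C1Path s n, pathLen P ≤ 1 → I2 (k1 s (P.Γ 0) (P.Γ 0)) ≤ oR Λ0 → (∀ x, c0 ≤ ‖deriv (P.Γ 0) x‖ ∧ ‖deriv (P.Γ 0) x‖ ≤ K0) → ∀ t ∈ U1, I2 (k1 s (P.Γ t) (P.Γ t)) ≤ oR Λ ∧ ∀ x, c ≤ ‖deriv (P.Γ t) x‖ ∧ ‖deriv (P.Γ t) x‖ ≤ K := by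
  have h3 : 0 < (√Λ0 + 3) ^ 2 := by positivity
  obtain ⟨C, hC, hest⟩ := C1Path.est1 (n := n) hs0 hs2 h3
  refine ⟨(√Λ0 + 3) ^ 2, c0 * Real.exp (-C), K0 * Real.exp C, h3, by positivity, by positivity, fun P hl hE hd => ?_⟩
  have hE' : ∀ t ∈ U1, I2 (k1 s (P.Γ t) (P.Γ t)) ≤ oR ((√Λ0 + 3) ^ 2) := by
    intro t ht
    refine half_sq pz ((P.E_bd hs0 hs2 ht).trans ?_)
    rw [ofReal_add pz (by norm_num)]
    refine add_le_add (half_of hΛ.le hE) ?_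
    calc _ ≤ 3 * oR 1 := by gcongr
      _ = _ := by simp
  intro t ht
  refine ⟨hE' t ht, fun x => ?_⟩
  have h0 : (0:ℝ) ∈ U1 := by simp
  have h1 := ((hest P hE' t ht x).2).trans (mul_le_of_le_one_right hC.le hl)
  have p0 : 0 < ‖deriv (P.Γ 0) x‖ := norm_pos_iff.2 ((P.mem 0 h0).2.2 x)
  have p1 : 0 < ‖deriv (P.Γ t) x‖ := norm_pos_iff.2 ((P.mem t ht).2.2 x)
  obtain ⟨a, b⟩ := abs_le.1 h1
  constructor
  · calc c0 * Real.exp (-C) ≤ ‖deriv (P.Γ 0) x‖ * Real.exp (-C) := by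
          gcongr; exact (hd x).1
      _ = Real.exp (Real.log ‖deriv (P.Γ 0) x‖ + -C) := by rw [Real.exp_add, Real.exp_log p0]
      _ ≤ Real.exp (Real.log ‖deriv (P.Γ t) x‖) := Real.exp_le_exp.2 (by linarith)
      _ = _ := Real.exp_log p1
  · calc ‖deriv (P.Γ t) x‖ = Real.exp (Real.log ‖deriv (P.Γ t) x‖) := (Real.exp_log p1).symm
      _ ≤ Real.exp (Real.log ‖deriv (P.Γ 0) x‖ + C) := Real.exp_le_exp.2 (by linarith)
      _ = ‖deriv (P.Γ 0) x‖ * Real.exp C := by rw [Real.exp_add, Real.exp_log p0]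
      _ ≤ _ := by gcongr; exact (hd x).2
theorem cauchy_data (hs0 : 3/2 < s) (hs2 : s < 2) {γk : ℕ → Cv} (hm : ∀ k, InM s (γk k)) (hC : ∀ ε : ℝ, 0 < ε → ∃ N : ℕ, ∀ m ≥ N, ∀ l ≥ N, geodDist s (γk m) (γk l) < oR ε) : ∃ Λ c K : ℝ, ∃ N : ℕ, 0 < Λ ∧ 0 < c ∧ 0 < K ∧ (∀ m ≥ N, I2 (k1 s (γk m) (γk m)) ≤ oR Λ ∧ ∀ x, c ≤ ‖deriv (γk m) x‖ ∧ ‖deriv (γk m) x‖ ≤ K) ∧ ∀ ε > 0, ∃ M : ℕ, ∀ m ≥ M, ∀ l ≥ M, (∀ x, ‖γk l x - γk m x‖ ≤ ε ∧ ‖deriv (γk l) x - deriv (γk m) x‖ ≤ ε) ∧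
        gagliardoSqE (s - 1) (deriv fun x => γk l x - γk m x) ≤ oR (ε ^ 2) := by
  have h0 : (0:ℝ) ∈ U1 := by simp
  have h1 : (1:ℝ) ∈ U1 := by simp
  obtain ⟨N1, hN1⟩ := hC 1 one_pos
  obtain ⟨c0, K0, A0, hc0, hA0, hg0⟩ := (hm N1).good hs0
  have hK0 : 0 < K0 := hc0.trans_le ((hg0.lb 0).trans (hg0.ub 0))
  have hEf := C1Path.E_fin hs0 (hm N1)
  obtain ⟨Λ1, c1, K1, hΛ1, hc1, hK1, hu1⟩ := unif (n := n) hs0 hs2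
    (Λ0 := (I2 (k1 s (γk N1) (γk N1))).toReal + 1) pz hc0 hK0
  have hm1 : ∀ m ≥ N1, I2 (k1 s (γk m) (γk m)) ≤ oR Λ1 ∧ ∀ x, c1 ≤ ‖deriv (γk m) x‖ ∧ ‖deriv (γk m) x‖ ≤ K1 := by
    intro m hmN
    obtain ⟨P, hP0, hP1, hl⟩ := ex_path (hN1 N1 le_rfl m hmN)
    have := hu1 P hl.le (by
      rw [hP0]; conv_lhs => rw [← ofReal_toReal hEf.ne]
      exact ofReal_le_ofReal (by linarith))
      (fun x => by rw [hP0]; exact ⟨hg0.lb x, hg0.ub x⟩) 1 h1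
    rwa [hP1] at this
  obtain ⟨Λ2, c2, K2, hΛ2, hc2, hK2, hu2⟩ := unif (n := n) hs0 hs2 hΛ1 hc1 hK1
  obtain ⟨C, hCp, hest⟩ := C1Path.est2 (n := n) hs0 hs2 hΛ2 hc2 hK2
  have step : ∀ m ≥ N1, ∀ l, ∀ ε > 0, ε ≤ 1 → C * ε ≤ 1/4 → geodDist s (γk m) (γk l) < oR ε → (∀ x, ‖γk l x - γk m x‖ ≤ C * ε ∧ ‖deriv (γk l) x - deriv (γk m) x‖ ≤ C * ε) ∧ gagliardoSqE (s - 1) (deriv fun x => γk l x - γk m x) ^ (1/2 : ℝ) ≤ oR (C * ε) * (2 + 4 * gS (γk m) ^ (1/2 : ℝ)) := by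
    intro m hmN l ε hε hε1 hεC hd
    obtain ⟨P, hP0, hP1, hl⟩ := ex_path hd
    have hle : C * pathLen P ≤ C * ε := by gcongr
    have := hest P (hu2 P (hl.le.trans hε1) (by rw [hP0]; exact (hm1 m hmN).1)
      (by rw [hP0]; exact (hm1 m hmN).2)) 1 h1
    rw [hP0, hP1] at this
    refine ⟨fun x => ⟨(this.1 x).1.trans hle, (this.1 x).2.trans hle⟩, (this.2 (hle.trans hεC)).trans (mul_le_mul_left (ofReal_le_ofReal hle) _)⟩
  set δ := min 1 (1 / (4 * C)) with hδ
  have hδ0 : 0 < δ := by positivity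
  have hδC : C * δ ≤ 1/4 := by
    calc C * δ ≤ C * (1 / (4 * C)) := by gcongr; exact min_le_right _ _
      _ = 1/4 := by field_simp
  obtain ⟨N2', hN2'⟩ := hC δ hδ0
  set N2 := max N1 N2' with hN2
  set q2 := gS (γk N2) ^ (1/2 : ℝ) with hq2
  have hq2t : q2 ≠ ⊤ := ENNReal.rpow_ne_top_of_nonneg (by norm_num) (hm N2).1.2.2.ne
  set Q := 2 * (oR (C * δ) * (2 + 4 * q2)) + 2 * q2 with hQ
  have hQt : Q ≠ ⊤ := by
    rw [hQ]
    refine ENNReal.add_ne_top.2 ⟨ENNReal.mul_ne_top (by norm_num) (ENNReal.mul_ne_top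
      ofReal_ne_top (ENNReal.add_ne_top.2 ⟨by norm_num, ENNReal.mul_ne_top (by norm_num) hq2t⟩)),
      ENNReal.mul_ne_top (by norm_num) hq2t⟩
  have hgag : ∀ m ≥ N2, gS (γk m) ^ (1/2 : ℝ) ≤ Q := by
    intro m hmN
    have := (step N2 (le_max_left _ _) m δ hδ0 (min_le_left _ _) hδC
      (hN2' _ (le_max_right _ _) m ((le_max_right _ _).trans hmN))).2
    have e : deriv (γk m) = fun x => (1:ℝ) • deriv (fun x => γk m x - γk N2 x) x + (1:ℝ) • deriv (γk N2) x := by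
      funext x
      rw [(((hm m).1.hd x).fun_sub ((hm N2).1.hd x)).deriv]
      simp
    have h := gag_comb ((hm m).1.sub (hm N2).1).cd (hm N2).1.cd (s - 1) 1 1
    rw [← e] at h
    norm_num at h
    refine ((ENNReal.rpow_le_rpow h (by norm_num)).trans (half_two_le _ _)).trans ?_
    exact add_le_add (mul_le_mul_right this _) le_rfl
  refine ⟨Λ1, c1, K1, N1, hΛ1, hc1, hK1, hm1, fun ε hε => ?_⟩
  set R := 2 + 4 * Q.toReal with hR
  have hR1 : 1 ≤ R := by have := ENNReal.toReal_nonneg (a := Q); linarith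
  have hRe : oR R = 2 + 4 * Q := by
    rw [hR, ofReal_add (by norm_num) pz, ofReal_mul (by norm_num), ofReal_toReal hQt]
    norm_num
  set η := min δ (ε / (C * R)) with hη
  have hη0 : 0 < η := by positivity
  have hηC : C * η ≤ 1/4 := le_trans (by gcongr; exact min_le_left _ _) hδC
  have hηR : C * η * R ≤ ε := by
    calc C * η * R ≤ C * (ε / (C * R)) * R := by gcongr; exact min_le_right _ _
      _ = ε := by field_simp
  have hηε : C * η ≤ ε := le_trans (le_mul_of_one_le_right pz hR1) hηR
  obtain ⟨M', hM'⟩ := hC η hη0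
  refine ⟨max N2 M', fun m hmM l hl => ?_⟩
  have hmN2 : m ≥ N2 := (le_max_left _ _).trans hmM
  have := step m ((le_max_left _ _).trans hmN2) l η hη0
    ((min_le_left _ _).trans (min_le_left _ _)) hηC
    (hM' m ((le_max_right _ _).trans hmM) l ((le_max_right _ _).trans hl))
  refine ⟨fun x => ⟨(this.1 x).1.trans hηε, (this.1 x).2.trans hηε⟩, half_sq hε.le
    (this.2.trans ?_)⟩
  calc _ ≤ oR (C * η) * (2 + 4 * Q) := by gcongr; exact hgag m hmN2
    _ = oR (C * η * R) := by rw [← hRe, ofReal_mul (p := C * η) pz]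
    _ ≤ _ := ofReal_le_ofReal hηR
theorem per_unif {f : Cv} (hf : Continuous f) (hp : Function.Periodic f 1) {ε : ℝ} (hε : 0 < ε) : ∃ H > 0, H ≤ 1/4 ∧ ∀ x h, |h| ≤ H → ‖f (x + h) - f x‖ ≤ ε := by
  have hu := (isCompact_Icc (a := (-1:ℝ)) (b := 2)).uniformContinuousOn_of_continuous hf.continuousOn
  obtain ⟨δ, hδ, h⟩ := Metric.uniformContinuousOn_iff.1 hu ε hε
  refine ⟨min (δ/2) (1/4), by positivity, min_le_right _ _, fun x k hk => ?_⟩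
  have h1 : |k| ≤ 1/4 := hk.trans (min_le_right _ _)
  have h2 : |k| ≤ δ/2 := hk.trans (min_le_left _ _)
  obtain ⟨h3, h4⟩ := abs_le.1 h1
  have f0 := Int.fract_nonneg x
  have f1 := Int.fract_lt_one x
  have := h (Int.fract x + k) ⟨by linarith, by linarith⟩ (Int.fract x) ⟨by linarith, by linarith⟩
    (by rw [dist_eq, add_sub_cancel_left]; linarith)
  rw [← per_int hp (Int.fract x + k) ⌊x⌋, ← per_int hp (Int.fract x) ⌊x⌋, add_right_comm, Int.fract_add_floor, dist_eq_norm] at this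
  exact this.le
theorem limit_ex {γk : ℕ → Cv} (hm : ∀ k, InHs s (γk k)) (hC : ∀ ε > 0, ∃ M : ℕ, ∀ m ≥ M, ∀ l ≥ M, (∀ x, ‖γk l x - γk m x‖ ≤ ε ∧ ‖deriv (γk l) x - deriv (γk m) x‖ ≤ ε) ∧ gagliardoSqE (s - 1) (deriv fun x => γk l x - γk m x) ≤ oR (ε ^ 2)) : ∃ γ : Cv, InHs s γ ∧ ∀ ε > 0, ∃ M : ℕ, ∀ m ≥ M, (∀ x, ‖γk m x - γ x‖ ≤ ε ∧ ‖deriv (γk m) x - deriv γ x‖ ≤ ε) ∧ gagliardoSqE (s - 1) (deriv fun x => γk m x - γ x) ≤ oR (ε ^ 2) := by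
  have c1 : ∀ x, CauchySeq fun k => γk k x := fun x => by
    refine Metric.cauchySeq_iff.2 fun ε hε => ?_
    obtain ⟨M, hM⟩ := hC (ε/2) pz
    refine ⟨M, fun m hm l hl => ?_⟩
    rw [dist_eq_norm]
    have := ((hM l hl m hm).1 x).1
    linarith
  have c2 : ∀ x, CauchySeq fun k => deriv (γk k) x := fun x => by
    refine Metric.cauchySeq_iff.2 fun ε hε => ?_
    obtain ⟨M, hM⟩ := hC (ε/2) pz
    refine ⟨M, fun m hm l hl => ?_⟩
    rw [dist_eq_norm]
    have := ((hM l hl m hm).1 x).2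
    linarith
  choose γ hγ using fun x => cauchySeq_tendsto_of_complete (c1 x)
  choose γ' hγ' using fun x => cauchySeq_tendsto_of_complete (c2 x)
  have u1 : ∀ ε > 0, ∃ M : ℕ, ∀ m ≥ M, ∀ x, ‖γk m x - γ x‖ ≤ ε ∧ ‖deriv (γk m) x - γ' x‖ ≤ ε := by
    intro ε hε
    obtain ⟨M, hM⟩ := hC ε hε
    refine ⟨M, fun m hmM x => ⟨?_, ?_⟩⟩
    · refine le_of_tendsto ((tendsto_const_nhds.sub (hγ x)).norm) ?_
      filter_upwards [eventually_ge_atTop M] with l hl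
      exact ((hM l hl m hmM).1 x).1
    · refine le_of_tendsto ((tendsto_const_nhds.sub (hγ' x)).norm) ?_
      filter_upwards [eventually_ge_atTop M] with l hl
      exact ((hM l hl m hmM).1 x).2
  have tu : TendstoUniformly (fun k x => deriv (γk k) x) γ' atTop := by
    refine Metric.tendstoUniformly_iff.2 fun ε hε => ?_
    obtain ⟨M, hM⟩ := u1 (ε/2) pz
    filter_upwards [eventually_ge_atTop M] with m hmM x
    rw [dist_comm, dist_eq_norm]
    have := (hM m hmM x).2
    linarith
  have hd : ∀ x, HasDerivAt γ (γ' x) x := fun x =>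
    hasDerivAt_of_tendstoUniformly tu (Eventually.of_forall fun k x => (hm k).hd x) hγ x
  have hde : deriv γ = γ' := funext fun x => (hd x).deriv
  have hc' : Continuous γ' := tu.continuous (Frequently.of_forall fun k => (hm k).cd)
  have hper : Function.Periodic γ 1 := fun x =>
    tendsto_nhds_unique (hγ (x + 1)) (by simpa only [(hm _).1 x] using hγ x)
  have hcd : ContDiff ℝ 1 γ := by refine contDiff_one_iff_deriv.2 ⟨fun x => (hd x).differentiableAt, hde ▸ hc'⟩
  have dsub : ∀ m, deriv (fun x => γk m x - γ x) = fun x => deriv (γk m) x - γ' x := fun m =>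
    funext fun x => (((hm m).hd x).fun_sub (hd x)).deriv
  have dsub2 : ∀ m l, deriv (fun x => γk m x - γk l x) = fun x => deriv (γk m) x - deriv (γk l) x := fun m l =>
    funext fun x => (((hm m).hd x).fun_sub ((hm l).hd x)).deriv
  have hfat : ∀ ε > 0, ∃ M : ℕ, ∀ m ≥ M, gagliardoSqE (s - 1) (deriv fun x => γk m x - γ x) ≤ oR (ε ^ 2) := by
    intro ε hε
    obtain ⟨M, hM⟩ := hC ε hε
    refine ⟨M, fun m hmM => ?_⟩
    have hmc := (hm m).cd
    rw [dsub, gag_mu2 (v := fun x => deriv (γk m) x - γ' x) (hmc.sub hc')]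
    set F : ℕ → ℝ × ℝ → ℝ≥0∞ := fun l z => oR
      (‖(deriv (γk m) z.2 - deriv (γk l) z.2) - (deriv (γk m) z.1 - deriv (γk l) z.1)‖ ^ 2 /
        dT z.1 z.2 ^ (2 * (s - 1) + 1)) with hF
    have hFm : ∀ l, Measurable (F l) := fun l =>
      gag_meas (v := fun x => deriv (γk m) x - deriv (γk l) x) (hmc.sub (hm l).cd) _
    have hlim : ∀ z, Tendsto (fun l => F l z) atTop (𝓝 (oR
      (‖(deriv (γk m) z.2 - γ' z.2) - (deriv (γk m) z.1 - γ' z.1)‖ ^ 2 /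
        dT z.1 z.2 ^ (2 * (s - 1) + 1)))) := fun z => by
      refine (ENNReal.continuous_ofReal.tendsto _).comp (Tendsto.div_const ?_ _)
      exact (((tendsto_const_nhds.sub (hγ' _)).sub (tendsto_const_nhds.sub (hγ' _))).norm).pow 2
    calc _ = ∫⁻ z, liminf (fun l => F l z) atTop ∂mu2 :=
          lintegral_congr fun z => (hlim z).liminf_eq.symm
      _ ≤ liminf (fun l => ∫⁻ z, F l z ∂mu2) atTop := lintegral_liminf_le hFm
      _ ≤ _ := by
        refine liminf_le_of_frequently_le' (Eventually.frequently ?_)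
        filter_upwards [eventually_ge_atTop M] with l hl
        have := (hM l hl m hmM).2
        rw [dsub2, gag_mu2 (v := fun x => deriv (γk m) x - deriv (γk l) x) (hmc.sub (hm l).cd)] at this
        exact this
  refine ⟨γ, ⟨hper, hcd, ?_⟩, fun ε hε => ?_⟩
  · obtain ⟨M, hM⟩ := hfat 1 one_pos
    have e : deriv γ = fun x => (1:ℝ) • deriv (γk M) x + (-1:ℝ) • deriv (fun x => γk M x - γ x) x := by rw [dsub, hde]; funext x; simp
    rw [e]
    refine (gag_comb (hm M).cd (by rw [dsub]; exact (hm M).cd.sub hc') (s - 1) 1 (-1)).trans_lt ?_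
    refine ENNReal.add_lt_top.2 ⟨ENNReal.mul_lt_top ofReal_lt_top (hm M).2.2, ENNReal.mul_lt_top ofReal_lt_top ((hM M le_rfl).trans_lt ofReal_lt_top)⟩
  · obtain ⟨M1, h1⟩ := u1 ε hε
    obtain ⟨M2, h2⟩ := hfat ε hε
    refine ⟨max M1 M2, fun m hmM => ⟨fun x => ?_, h2 m ((le_max_right _ _).trans hmM)⟩⟩
    rw [hde]; exact h1 m ((le_max_left _ _).trans hmM) x
theorem Hs_small {u : Cv} {ε : ℝ} (hε : 0 ≤ ε) (hu : InHs s u) (h : ∀ x, ‖u x‖ ≤ ε ∧ ‖deriv u x‖ ≤ ε) (hg : gS u ≤ oR (ε ^ 2)) : HsNorm s u ≤ 2 * ε := by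
  have aux : ∀ v : Cv, Continuous v → (∀ x, ‖v x‖ ≤ ε) → ∫ x in I01, ‖v x‖ ^ 2 ≤ ε ^ 2 := by
    intro v hv hb
    calc ∫ x in I01, ‖v x‖ ^ 2 ≤ ∫ x in I01, ε ^ 2 :=
          integral_mono (intg_sq hv) (integrable_const _) fun x =>
            pow_le_pow_left₀ (norm_nonneg _) (hb x) 2
      _ = ε ^ 2 := by simp
  unfold HsNorm HsNormSq
  rw [show 2 * ε = √((2 * ε) ^ 2) by rw [sqrt_sq pz]]
  refine sqrt_le_sqrt ?_
  have h1 := aux u hu.c fun x => (h x).1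
  have h2 := aux _ hu.cd fun x => (h x).2
  have h3 := ENNReal.toReal_le_of_le_ofReal pz hg
  nlinarith [sq_nonneg ε]
theorem near_chord {η : Cv} (hη : InHs s η) {c H : ℝ} (hlb : ∀ x, c ≤ ‖deriv η x‖) (hmod : ∀ x h, |h| ≤ H → ‖deriv η (x + h) - deriv η x‖ ≤ c / 4) (x h : ℝ) (hh : |h| ≤ H) : c / 2 * |h| ≤ ‖η (x + h) - η x‖ := by
  have hcd := hη.cd
  have h1 : ‖(∫ θ in (0:ℝ)..1, (deriv η (x + θ * h) - deriv η x))‖ ≤ c / 4 * |(1:ℝ) - 0| := by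
    refine intervalIntegral.norm_integral_le_of_norm_le_const fun θ hθ => hmod _ _ ?_
    rw [uIoc_of_le zero_le_one] at hθ
    rw [abs_mul, abs_of_pos hθ.1]
    exact (mul_le_of_le_one_left (abs_nonneg _) hθ.2).trans hh
  rw [intervalIntegral.integral_sub ((by fun_prop : Continuous _).intervalIntegrable _ _)
    ((by fun_prop : Continuous _).intervalIntegrable _ _)] at h1
  norm_num at h1
  rw [ftc_h hη, norm_smul, norm_eq_abs, mul_comm]
  refine mul_le_mul_of_nonneg_left ?_ (abs_nonneg _)
  have h2 := norm_sub_norm_le (deriv η x) (∫ θ in (0:ℝ)..1, deriv η (x + θ * h))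
  rw [norm_sub_rev] at h2
  have := hlb x
  have : 0 ≤ c / 4 := (norm_nonneg _).trans (hmod x 0 (by simpa using (abs_nonneg h).trans hh))
  linarith
theorem I2_rect {k : ℝ → ℝ → ℝ} (hk : Measurable fun z : ℝ × ℝ => k z.1 z.2) (hp1 : ∀ x y, k (x + 1) y = k x y) (hp2 : ∀ x y, k x (y + 1) = k x y) {a b ρ m : ℝ} (hρ : ρ ≤ 1) (h : ∀ x ∈ Ioc a (a + ρ), ∀ y ∈ Ioc b (b + ρ), m ≤ k x y) : oR m * oR ρ * oR ρ ≤ I2 k := by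
  have e : I2 k = ∫⁻ x in Ioc a (a + 1), ∫⁻ y in Ioc b (b + 1), oR (k x y) := by
    unfold I2
    rw [lint_mu2 (by fun_prop)]
    rw [lint_periodic (fun x => ?_)]
    · refine lintegral_congr fun x => ?_
      rw [lint_periodic (fun y => ?_)]
      rw [hp2]
    · simp only [hp1]
  rw [e]
  calc _ = ∫⁻ x in Ioc a (a + ρ), ∫⁻ y in Ioc b (b + ρ), oR m := by
        simp only [lintegral_const, Measure.restrict_apply MeasurableSet.univ, univ_inter, volume_Ioc, add_sub_cancel_left]
    _ ≤ ∫⁻ x in Ioc a (a + ρ), ∫⁻ y in Ioc b (b + ρ), oR (k x y) := by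
        refine setLIntegral_mono' measurableSet_Ioc fun x hx => ?_
        exact setLIntegral_mono' measurableSet_Ioc fun y hy => ofReal_le_ofReal (h x hx y hy)
    _ ≤ ∫⁻ x in Ioc a (a + 1), ∫⁻ y in Ioc b (b + ρ), oR (k x y) :=
        lintegral_mono_set (Ioc_subset_Ioc_right (by linarith))
    _ ≤ _ := lintegral_mono fun x => lintegral_mono_set (Ioc_subset_Ioc_right (by linarith))
theorem min_pair {η : Cv} (hη : InM s η) {H : ℝ} (hH : 0 < H) (hH2 : H ≤ 1/4) : ∃ x1 h1, H ≤ h1 ∧ h1 ≤ 1 - H ∧ 0 < ‖η (x1 + h1) - η x1‖ ∧ ∀ x h, H ≤ h → h ≤ 1 - H → ‖η (x1 + h1) - η x1‖ ≤ ‖η (x + h) - η x‖ := by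
  have hc := hη.1.c
  obtain ⟨⟨x1, h1⟩, hm, hmin⟩ := ((isCompact_Icc (a := (0:ℝ)) (b := 1)).prod
    (isCompact_Icc (a := H) (b := 1 - H))).exists_isMinOn
    ⟨(0, H), by constructor <;> constructor <;> simp <;> linarith⟩
    (f := fun p : ℝ × ℝ => ‖η (p.1 + p.2) - η p.1‖) (by fun_prop : Continuous _).continuousOn
  refine ⟨x1, h1, hm.2.1, hm.2.2, ?_, fun x h hh1 hh2 => ?_⟩
  · rw [norm_pos_iff, sub_ne_zero]
    intro he
    obtain ⟨k, hk⟩ := inj_mod hη he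
    have hk' : h1 = k := by linarith
    have h2 := hm.2.1
    have h3 := hm.2.2
    simp only at h2 h3
    rw [hk'] at h2 h3
    have a1 : (0:ℝ) < k := by linarith
    have a2 : (k:ℝ) < 1 := by linarith
    have a3 : 0 < k := by exact_mod_cast a1
    have a4 : k < 1 := by exact_mod_cast a2
    omega
  · have := hmin (show (Int.fract x, h) ∈ U1 ×ˢ Icc H (1 - H) from
      ⟨⟨Int.fract_nonneg _, (Int.fract_lt_one _).le⟩, hh1, hh2⟩)
    simp only [mem_ofPred_eq] at this
    rw [← per_int hη.1.1 (Int.fract x + h) ⌊x⌋, ← per_int hη.1.1 (Int.fract x) ⌊x⌋, add_right_comm, Int.fract_add_floor] at this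
    exact this
theorem min_orth {η : Cv} (hη : InHs s η) {H x1 h1 : ℝ} (ha : H < h1) (hb : h1 < 1 - H) (hmin : ∀ x h, H ≤ h → h ≤ 1 - H → ‖η (x1 + h1) - η x1‖ ≤ ‖η (x + h) - η x‖) : ⟪deriv η x1, η (x1 + h1) - η x1⟫ = 0 := by
  set y := x1 + h1 with hy
  have hloc : IsLocalMin (fun x => ‖η y - η x‖ ^ 2) x1 := by
    have : Ioo (y - (1 - H)) (y - H) ∈ 𝓝 x1 := Ioo_mem_nhds (by linarith) (by linarith)
    filter_upwards [this] with x hx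
    have := hmin x (y - x) (by linarith [hx.2]) (by linarith [hx.1])
    rw [add_sub_cancel] at this
    exact pow_le_pow_left₀ (norm_nonneg _) this 2
  have hd := ((hasDerivAt_const x1 (η y)).fun_sub (hη.hd x1)).norm_sq
  have := hloc.hasDerivAt_eq_zero hd
  rw [zero_sub, inner_neg_right, real_inner_comm] at this
  linarith
theorem proj_lb {a d : En n} {r : ℝ} (ha : a ≠ 0) (h1 : 7/8 * r ≤ ‖d‖) (hr : 0 ≤ r) (h2 : |⟪a, d⟫| ≤ 3/8 * (‖a‖ * r)) : r ^ 2 / 2 ≤ ‖d - ((‖a‖ ^ 2)⁻¹ * ⟪a, d⟫) • a‖ ^ 2 := by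
  have ha' : 0 < ‖a‖ := norm_pos_iff.2 ha
  have e : ‖d - ((‖a‖ ^ 2)⁻¹ * ⟪a, d⟫) • a‖ ^ 2 = ‖d‖ ^ 2 - (⟪a, d⟫ / ‖a‖) ^ 2 := by
    rw [norm_sub_sq_real, inner_smul_right, norm_smul, mul_pow, norm_eq_abs, sq_abs, real_inner_comm]
    field_simp
    ring
  have h3 : (⟪a, d⟫ / ‖a‖) ^ 2 ≤ (3/8 * r) ^ 2 := by
    rw [← sq_abs, abs_div, abs_norm]
    refine pow_le_pow_left₀ pz ?_ 2
    rw [div_le_iff₀ ha']; linarith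
  have h4 : (7/8 * r) ^ 2 ≤ ‖d‖ ^ 2 := pow_le_pow_left₀ pz h1 2
  rw [e]
  nlinarith [sq_nonneg r]
theorem sep_pt {η : Cv} (hη : InHs s η) (hs : 0 < s) {c K H x1 y1 r ρ : ℝ} (hc : 0 < c) (hK : 0 < K) (hlb : ∀ x, c ≤ ‖deriv η x‖) (hub : ∀ x, ‖deriv η x‖ ≤ K) (hmod : ∀ x h, |h| ≤ H → ‖deriv η (x + h) - deriv η x‖ ≤ c / 4) (hr : 0 < r) (hr1 : ‖η y1 - η x1‖ = r) (ho : ⟪deriv η x1, η y1 - η x1⟫ = 0) (hρ : ρ = r / (16 * K)) (hρH : ρ ≤ H) {x y : ℝ} (hx : x ∈ Ioc x1 (x1 + ρ)) (hy : y ∈ Ioc y1 (y1 + ρ)) : r ^ 2 / 2 * (c * c) / (2 * r) ^ sP ≤ k1 s η η x y := by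
  have hKρ : K * ρ = r / 16 := by rw [hρ]; field_simp
  have e1 : ‖η x - η x1‖ ≤ r / 16 := by
    refine (lip_of_sup hη hub x1 x).trans ?_
    rw [abs_of_nonneg (by linarith [hx.1])]
    nlinarith [hx.2]
  have e2 : ‖η y - η y1‖ ≤ r / 16 := by
    refine (lip_of_sup hη hub y1 y).trans ?_
    rw [abs_of_nonneg (by linarith [hy.1])]
    nlinarith [hy.2]
  set d := η y - η x with hd
  set d1 := η y1 - η x1 with hd1
  have e3 : ‖d - d1‖ ≤ r / 8 := by
    have : d - d1 = (η y - η y1) - (η x - η x1) := by rw [hd, hd1]; abel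
    rw [this]
    exact (norm_sub_le _ _).trans (by linarith)
  have n1 : 7/8 * r ≤ ‖d‖ := by
    have := norm_sub_norm_le d1 d
    rw [norm_sub_rev d1 d] at this; linarith
  have n2 : ‖d‖ ≤ 2 * r := by
    have := norm_sub_norm_le d d1
    linarith
  have hm : ‖deriv η x - deriv η x1‖ ≤ c / 4 := by
    have := hmod x1 (x - x1) (by rw [abs_of_nonneg (by linarith [hx.1])]; linarith [hx.2])
    rwa [add_sub_cancel] at this
  have n3 : |⟪deriv η x, d⟫| ≤ 3/8 * (‖deriv η x‖ * r) := by
    have : ⟪deriv η x, d⟫ = ⟪deriv η x, d - d1⟫ + ⟪deriv η x - deriv η x1, d1⟫ := by rw [inner_sub_right (deriv η x) d d1, inner_sub_left (deriv η x) (deriv η x1) d1, ho]; ring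
    rw [this]
    refine (abs_add_le _ _).trans ?_
    have a1 := (abs_real_inner_le_norm (deriv η x) (d - d1)).trans
      (mul_le_mul_of_nonneg_left e3 (norm_nonneg _))
    have a2 := (abs_real_inner_le_norm (deriv η x - deriv η x1) d1).trans
      (mul_le_mul_of_nonneg_right hm (norm_nonneg _))
    rw [hr1] at a2
    have := hlb x
    nlinarith
  have hdx : deriv η x ≠ 0 := norm_pos_iff.1 (hc.trans_le (hlb x))
  have p := proj_lb hdx n1 hr.le n3
  unfold k1 kk
  have hdp : 0 < ‖d‖ := by linarith
  refine div_le_div₀ pz ?_ (rpow_pos_of_pos hdp _)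
    (rpow_le_rpow hdp.le n2 (by linarith))
  refine mul_le_mul p (mul_le_mul (hlb x) (hlb y) hc.le (norm_nonneg _)) pz
    pz
theorem sep (hs0 : 3/2 < s) {Λ c K H : ℝ} (hΛ : 0 < Λ) (hc : 0 < c) (hK : 0 < K) (hH : 0 < H) (hH2 : H ≤ 1/4) : ∃ r0 > 0, ∀ η : Cv, InM s η → (∀ x, c ≤ ‖deriv η x‖) → (∀ x, ‖deriv η x‖ ≤ K) → (∀ x h, |h| ≤ H → ‖deriv η (x + h) - deriv η x‖ ≤ c / 4) → I2 (k1 s η η) ≤ oR Λ → ∀ x h, H ≤ h → h ≤ 1 - H → r0 ≤ ‖η (x + h) - η x‖ := by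
  set B := (1 / (16 * K)) ^ 2 * (c * c) / (2 * 2 ^ sP) with hB
  have h2p : (0:ℝ) < 2 ^ sP := rpow_pos_of_pos two_pos _
  have hBp : 0 < B := by positivity
  have hrp : 0 < (B / Λ) ^ (2 * s - 3)⁻¹ := rpow_pos_of_pos pz _
  refine ⟨min (c * H / 4) ((B / Λ) ^ (2 * s - 3)⁻¹), by positivity, fun η hη hlb hub hmod hE x h hx1 hx2 => ?_⟩
  obtain ⟨x1, h1, ha, hb, hpos, hmin⟩ := min_pair hη hH hH2
  refine le_trans ?_ (hmin x h hx1 hx2)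
  set r := ‖η (x1 + h1) - η x1‖ with hr
  by_cases hrc : c * H / 4 ≤ r
  · exact (min_le_left _ _).trans hrc
  push Not at hrc
  refine (min_le_right _ _).trans ?_
  have hcK : c ≤ K := (hlb 0).trans (hub 0)
  have b1 : H < h1 := by
    rcases ha.eq_or_lt with e | e
    · exfalso
      have := near_chord hη.1 hlb hmod x1 h1 (by rw [← e, abs_of_pos hH])
      rw [← e, abs_of_pos hH, e] at this
      nlinarith
    · exact e
  have b2 : h1 < 1 - H := by
    rcases hb.eq_or_lt with e | e
    · exfalso
      have := near_chord hη.1 hlb hmod x1 (-H) (by rw [abs_neg, abs_of_pos hH])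
      have e2 : η (x1 + -H) = η (x1 + h1) := by rw [← hη.1.1 (x1 + -H), e]; congr 1; ring
      rw [e2, abs_neg, abs_of_pos hH] at this
      nlinarith
    · exact e
  have ho := min_orth hη.1 b1 b2 hmin
  set ρ := r / (16 * K) with hρ
  have hρp : 0 < ρ := by positivity
  have hρH : ρ ≤ H := by
    rw [hρ, div_le_iff₀ pz]
    nlinarith
  have hrect := I2_rect (k1_meas hη.1 hη.1) (fun x y => (k1_per hη.1 hη.1 x y).1)
    (fun x y => (k1_per hη.1 hη.1 x y).2) (a := x1) (b := x1 + h1) (ρ := ρ) (by linarith)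
    (fun x hx y hy => sep_pt hη.1 (by linarith) hc hK hlb hub hmod hpos hr.symm ho hρ hρH hx hy)
  have hm0 : 0 ≤ r ^ 2 / 2 * (c * c) / (2 * r) ^ sP := by positivity
  rw [← ofReal_mul hm0, ← ofReal_mul pz] at hrect
  have h3 := (ENNReal.ofReal_le_ofReal_iff hΛ.le).1 (hrect.trans hE)
  have hrs : r ^ sP = r ^ (2 * s - 3) * r ^ 4 := by rw [← rpow_natCast r 4, ← rpow_add hpos]; congr 1; push_cast; ring
  have hrp2 : 0 < r ^ (2 * s - 3) := rpow_pos_of_pos hpos _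
  have h4 : B / Λ ≤ r ^ (2 * s - 3) := by
    rw [mul_rpow two_pos.le hpos.le, hrs, hρ] at h3
    have e : r ^ 2 / 2 * (c * c) / (2 ^ sP * (r ^ (2 * s - 3) * r ^ 4)) * (r / (16 * K)) * (r / (16 * K)) = B / r ^ (2 * s - 3) := by rw [hB]; field_simp
    rw [e, div_le_iff₀ hrp2] at h3
    rw [div_le_iff₀ hΛ]; linarith
  calc (B / Λ) ^ (2 * s - 3)⁻¹ ≤ (r ^ (2 * s - 3)) ^ (2 * s - 3)⁻¹ :=
        rpow_le_rpow pz h4 (inv_nonneg.2 (by linarith))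
    _ = r := rpow_rpow_inv hpos.le (by linarith)
theorem Good.inM {c K A : ℝ} (hc : 0 < c) {γ : Cv} (h : Good s c K A γ) : InM s γ := by
  refine ⟨h.hs, fun a ha b hb hab => ?_, fun x => norm_pos_iff.1 (hc.trans_le (h.lb x))⟩
  obtain ⟨r, k, hr, e⟩ := exists_shift a b
  have h1 := h.chord a r hr
  rw [← per_int h.hs.1 (a + r) k, ← e, hab, sub_self, norm_zero] at h1
  have h2 : r = 0 := by
    have := abs_nonneg r
    exact abs_eq_zero.1 (by nlinarith)
  rw [h2, add_zero] at e
  have h3 : (-1:ℝ) < k := by linarith [ha.2, hb.1]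
  have h4 : (k:ℝ) < 1 := by linarith [ha.1, hb.2]
  have h5 : (-1:ℤ) < k := by exact_mod_cast h3
  have h6 : k < (1:ℤ) := by exact_mod_cast h4
  have : k = 0 := by omega
  rw [e, this]; simp
theorem Good.near {c K A δ : ℝ} (hA : 0 ≤ A) {γ w : Cv} (h : Good s c K A γ) (hw : InHs s w) (hδ : δ ≤ c / 2) (hd : ∀ x, ‖deriv w x‖ ≤ δ) (hg : gS w ≤ oR (δ ^ 2)) {b : ℝ} (hb : b ∈ U1) : Good s (c / 2) (K + δ) (2 * A + 2 * δ ^ 2) (fun x => (1:ℝ) • γ x + b • w x) := by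
  have hδ0 : 0 ≤ δ := (norm_nonneg _).trans (hd 0)
  have sm : ∀ z : En n, ‖b • z‖ ≤ ‖z‖ := fun z => by
    rw [norm_smul, norm_of_nonneg hb.1]
    exact mul_le_of_le_one_left (norm_nonneg _) hb.2
  refine ⟨h.hs.comb hw 1 b, fun x r hr => ?_, fun x => ?_, fun x => ?_, ?_⟩
  · have h1 := h.chord x r hr
    have h2 := lip_of_sup hw hd x (x + r)
    rw [add_sub_cancel_left] at h2
    have h3 := (sm (w (x + r) - w x)).trans h2
    have e : (1:ℝ) • γ (x + r) + b • w (x + r) - ((1:ℝ) • γ x + b • w x) = (γ (x + r) - γ x) + b • (w (x + r) - w x) := by module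
    rw [e]
    have h4 := norm_sub_le ((γ (x + r) - γ x) + b • (w (x + r) - w x)) (b • (w (x + r) - w x))
    rw [add_sub_cancel_right] at h4
    nlinarith [abs_nonneg r]
  · rw [deriv_comb h.hs hw]
    simp only [one_smul]
    have h4 := norm_sub_le (deriv γ x + b • deriv w x) (b • deriv w x)
    rw [add_sub_cancel_right] at h4
    linarith [h.lb x, sm (deriv w x), hd x]
  · rw [deriv_comb h.hs hw]
    simp only [one_smul]
    exact (norm_add_le _ _).trans (by linarith [h.ub x, sm (deriv w x), hd x])
  · rw [deriv_comb h.hs hw]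
    refine (gag_comb h.hs.cd hw.cd _ _ _).trans ?_
    rw [ofReal_add pz pz, ofReal_mul (q := A) (by norm_num), ofReal_mul (q := δ ^ 2) (by norm_num)]
    refine add_le_add (mul_le_mul' (ofReal_le_ofReal (by norm_num)) h.gag)
      (mul_le_mul' (ofReal_le_ofReal ?_) hg)
    nlinarith [hb.1, hb.2]
def lineP {γ w : Cv} (hw : InHs s w)
    (hM : ∀ b ∈ U1, InM s (fun x => (1:ℝ) • γ x + b • w x)) : C1Path s n where
  Γ := fun t x => (1:ℝ) • γ x + (1 - t) • w x
  V := fun _ x => (0:ℝ) • w x + (-1:ℝ) • w x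
  mem := fun t ht => hM _ ⟨by linarith [ht.2], by linarith [ht.1]⟩
  memV := fun _ _ => hw.comb hw 0 (-1)
  isDeriv := fun t _ => by
    refine tendsto_const_nhds.congr' ?_
    filter_upwards [self_mem_nhdsWithin] with h hh
    refine (HsNorm_zero (n := n) (s := s)).symm.trans (congrArg _ ?_)
    funext x
    have e : (1:ℝ) • γ x + (1 - (t + h)) • w x - ((1:ℝ) • γ x + (1 - t) • w x) = h • (-w x) := by module
    rw [e, inv_smul_smul₀ hh.2]
    module
  contV := fun t _ => by
    simp only [sub_self, HsNorm_zero]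
    exact tendsto_const_nhds
theorem dist_le_of {a b : Cv} (P : C1Path s n) (h0 : P.Γ 0 = a) (h1 : P.Γ 1 = b) : geodDist s a b ≤ oR (pathLen P) := iInf₂_le P ⟨h0, h1⟩
theorem len_le (hs : 3/2 < s) (P : C1Path s n) {B : ℝ} (hB : 0 ≤ B) (h : ∀ t ∈ U1, GE s (P.Γ t) (P.V t) ≤ oR (B ^ 2)) : oR (pathLen P) ≤ oR B := by
  rw [← (P.len_eq hs).1]
  have : ∀ t, P.spd t ≤ oR B := fun t => by
    have := ENNReal.rpow_le_rpow (h _ (cl_mem t)) (z := 1/2) (by norm_num)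
    rw [ENNReal.ofReal_rpow_of_nonneg pz (by norm_num), ← sqrt_eq_rpow, sqrt_sq hB] at this
    exact this
  refine (lintegral_mono this).trans ?_
  simp
theorem line_conv (hs : 3/2 < s) {c K A : ℝ} (hc : 0 < c) (hA : 0 ≤ A) {γ : Cv} (h : Good s c K A γ) : ∃ C > 0, ∀ δ : ℝ, 0 ≤ δ → δ ≤ c / 2 → δ ≤ 1 → ∀ η : Cv, InHs s η → (∀ x, ‖η x - γ x‖ ≤ δ ∧ ‖deriv η x - deriv γ x‖ ≤ δ) → gagliardoSqE (s - 1) (deriv fun x => η x - γ x) ≤ oR (δ ^ 2) → geodDist s η γ ≤ oR (C * δ) := by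
  obtain ⟨C, hC, hup⟩ := upper (n := n) hs (half_pos hc) (K + 1) (2 * A + 2)
  refine ⟨2 * √C, by positivity, fun δ hδ0 hδ hδ1 η hη hcl hg => ?_⟩
  have hw := hη.sub h.hs
  have hdw : ∀ x, ‖deriv (fun x => η x - γ x) x‖ ≤ δ := fun x => by
    rw [((hη.hd x).fun_sub (h.hs.hd x)).deriv]; exact (hcl x).2
  have hG : ∀ b ∈ U1, Good s (c/2) (K+1) (2*A+2)
      (fun x => (1:ℝ) • γ x + b • (η x - γ x)) := fun b hb => by
    obtain ⟨a1, a2, a3, a4, a5⟩ := h.near hA hw hδ hdw hg hb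
    exact ⟨a1, a2, a3, fun x => (a4 x).trans (by linarith), a5.trans (ofReal_le_ofReal (by nlinarith))⟩
  set P := lineP hw fun b hb => (hG b hb).inM (half_pos hc) with hP
  have hN := Hs_small hδ0 hw (fun x => ⟨(hcl x).1, hdw x⟩) hg
  refine (dist_le_of P ?_ ?_).trans (len_le hs P pz fun t ht => ?_)
  · funext x
    simp [hP, lineP]
  · funext x
    simp [hP, lineP]
  · refine (hup _ _ (hG (1 - t) ⟨by linarith [ht.2], by linarith [ht.1]⟩) (P.memV t ht)).trans
      (ofReal_le_ofReal ?_)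
    have e : HsNorm s (P.V t) = HsNorm s (fun x => η x - γ x) := by
      have := HsNorm_smul (s := s) (fun x => η x - γ x) (-1)
      simpa [hP, lineP] using this
    have h0 := HsNorm_nonneg (s := s) (fun x => η x - γ x)
    rw [e, mul_pow, mul_pow, sq_sqrt hC.le]
    nlinarith [pow_le_pow_left₀ h0 hN 2]
theorem complete (hs0 : 3/2 < s) (hs2 : s < 2) {γk : ℕ → Cv} (hm : ∀ k, InM s (γk k)) (hC : ∀ ε : ℝ, 0 < ε → ∃ N : ℕ, ∀ m ≥ N, ∀ l ≥ N, geodDist s (γk m) (γk l) < oR ε) : ∃ γ : Cv, InM s γ ∧ Tendsto (fun k => geodDist s (γk k) γ) atTop (𝓝 0) := by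
  obtain ⟨Λ, c, K, N, hΛ, hc, hK, hN, hD⟩ := cauchy_data hs0 hs2 hm hC
  obtain ⟨γ, hγ, hlim⟩ := limit_ex (fun k => (hm k).1) hD
  have lb : ∀ x, c ≤ ‖deriv γ x‖ := fun x => by
    refine le_of_forall_pos_le_add fun ε hε => ?_
    obtain ⟨M, hM⟩ := hlim ε hε
    have h1 := ((hM (max M N) (le_max_left _ _)).1 x).2
    have h2 := ((hN (max M N) (le_max_right _ _)).2 x).1
    have := norm_sub_norm_le (deriv (γk (max M N)) x) (deriv γ x)
    linarith
  have ub : ∀ x, ‖deriv γ x‖ ≤ K := fun x => by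
    refine le_of_forall_pos_le_add fun ε hε => ?_
    obtain ⟨M, hM⟩ := hlim ε hε
    have h1 := ((hM (max M N) (le_max_left _ _)).1 x).2
    have h2 := ((hN (max M N) (le_max_right _ _)).2 x).2
    have := norm_sub_norm_le (deriv γ x) (deriv (γk (max M N)) x)
    rw [norm_sub_rev] at this
    linarith
  obtain ⟨H, hH, hH4, hmod⟩ := per_unif hγ.cd (per_deriv hγ.1) (show 0 < c / 12 by positivity)
  obtain ⟨r0, hr0, hsep⟩ := sep (n := n) hs0 hΛ hc hK hH hH4
  obtain ⟨M1, hM1⟩ := hlim (c / 12) pz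
  have far : ∀ x h, H ≤ h → h ≤ 1 - H → r0 ≤ ‖γ (x + h) - γ x‖ := fun x h h1 h2 => by
    refine le_of_forall_pos_le_add fun ε hε => ?_
    obtain ⟨M, hM⟩ := hlim (ε / 2) pz
    set m := max M (max N M1) with hmm
    have m1 : M ≤ m := le_max_left _ _
    have m2 : N ≤ m := (le_max_left _ _).trans (le_max_right _ _)
    have m3 : M1 ≤ m := (le_max_right _ _).trans (le_max_right _ _)
    have a := hsep (γk m) (hm m) (fun x => ((hN m m2).2 x).1) (fun x => ((hN m m2).2 x).2)
      (fun x h hh => by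
        have b1 := ((hM1 m m3).1 (x + h)).2
        have b2 := ((hM1 m m3).1 x).2
        have b3 := hmod x h hh
        have e : deriv (γk m) (x + h) - deriv (γk m) x = (deriv (γk m) (x + h) - deriv γ (x + h)) + (deriv γ (x + h) - deriv γ x) - (deriv (γk m) x - deriv γ x) := by abel
        rw [e]
        refine (norm_sub_le _ _).trans ?_
        have := norm_add_le (deriv (γk m) (x + h) - deriv γ (x + h)) (deriv γ (x + h) - deriv γ x)
        linarith) (hN m m2).1 x h h1 h2
    have b1 := ((hM m m1).1 (x + h)).1
    have b2 := ((hM m m1).1 x).1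
    have e : γk m (x + h) - γk m x = (γk m (x + h) - γ (x + h)) + (γ (x + h) - γ x) - (γk m x - γ x) := by abel
    rw [e] at a
    have t1 := norm_sub_le ((γk m (x + h) - γ (x + h)) + (γ (x + h) - γ x)) (γk m x - γ x)
    have t2 := norm_add_le (γk m (x + h) - γ (x + h)) (γ (x + h) - γ x)
    linarith
  have hgood : Good s (min (c/2) (2 * r0)) K (gS γ).toReal γ := by
    refine ⟨hγ, fun x h hh => ?_, fun x => ?_, ub, by rw [ofReal_toReal hγ.2.2.ne]⟩
    · rcases le_total |h| H with hle | hle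
      · exact (mul_le_mul_of_nonneg_right (min_le_left _ _) (abs_nonneg _)).trans
          (near_chord hγ lb (fun x h hh => (hmod x h hh).trans (by linarith)) x h hle)
      · have q : r0 ≤ ‖γ (x + h) - γ x‖ := by
          rcases le_total 0 h with h0 | h0
          · rw [abs_of_nonneg h0] at hle hh
            exact far x h hle (by linarith)
          · rw [abs_of_nonpos h0] at hle hh
            have := far (x + h) (-h) hle (by linarith)
            rwa [add_neg_cancel_right, norm_sub_rev] at this
        have := mul_le_mul_of_nonneg_right (min_le_right (c/2) (2 * r0)) (abs_nonneg h)
        nlinarith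
    · exact (min_le_left _ _).trans (by linarith [lb x])
  have hc1 : 0 < min (c/2) (2 * r0) := by positivity
  refine ⟨γ, hgood.inM hc1, ?_⟩
  obtain ⟨C, hC0, hl⟩ := line_conv hs0 hc1 ENNReal.toReal_nonneg hgood
  set c1 := min (c/2) (2 * r0)
  rw [ENNReal.tendsto_atTop_zero]
  intro ε hε
  obtain ⟨e, he, hee⟩ : ∃ e : ℝ, 0 < e ∧ oR e ≤ ε := by
    obtain ⟨e, h1, h2⟩ := ENNReal.lt_iff_exists_nnreal_btwn.1 hε
    exact ⟨e, by exact_mod_cast h1, by rw [ENNReal.ofReal_coe_nnreal]; exact h2.le⟩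
  have hδ : 0 < min (c1/2) (min 1 (e / C)) := by positivity
  obtain ⟨M, hM⟩ := hlim _ hδ
  refine ⟨M, fun m hmm => ?_⟩
  refine (hl _ hδ.le (min_le_left _ _) ((min_le_right _ _).trans (min_le_left _ _)) (γk m) (hm m).1
    (hM m hmm).1 (hM m hmm).2).trans (le_trans (ofReal_le_ofReal ?_) hee)
  have : min (c1/2) (min 1 (e / C)) ≤ e / C := (min_le_right _ _).trans (min_le_right _ _)
  rw [le_div_iff₀ hC0] at this
  linarith
theorem InHs.smul {u : Cv} (hu : InHs s u) (a : ℝ) : InHs s (fun x => a • u x) := by simpa using hu.comb hu a 0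
theorem InHs.add {u v : Cv} (hu : InHs s u) (hv : InHs s v) : InHs s (fun x => u x + v x) := by simpa using hu.comb hv 1 1
theorem HsNorm_comb {u v : Cv} (hu : InHs s u) (hv : InHs s v) (a b : ℝ) : HsNorm s (fun x => a • u x + b • v x) ≤ 2 * |a| * HsNorm s u + 2 * |b| * HsNorm s v := by
  have h := HsNormSq_comb hu hv a b
  rw [← HsNorm_sq, ← HsNorm_sq, ← HsNorm_sq, ← sq_abs a, ← sq_abs b] at h
  have h1 := HsNorm_nonneg (s := s) u
  have h2 := HsNorm_nonneg (s := s) v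
  have h3 : 0 ≤ |a| * HsNorm s u := by positivity
  have h4 : 0 ≤ |b| * HsNorm s v := by positivity
  refine le_of_sq_le_sq ?_ pz
  nlinarith [mul_nonneg h3 h4]
theorem I2_cmul {a : ℝ} (ha : 0 ≤ a) {k k' : ℝ → ℝ → ℝ} (h : ∀ x y, k' x y = a * k x y) : I2 k' = oR a * I2 k := by
  unfold I2
  rw [← lintegral_const_mul' _ _ ofReal_ne_top]
  refine lintegral_congr fun z => ?_
  rw [h, ofReal_mul ha]
theorem I1_cmul {a : ℝ} (ha : 0 ≤ a) {k k' : ℝ → ℝ} (h : ∀ x, k' x = a * k x) : I1 k' = oR a * I1 k := by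
  unfold I1
  rw [← lintegral_const_mul' _ _ ofReal_ne_top]
  refine lintegral_congr fun z => ?_
  rw [h, ofReal_mul ha]
theorem GE_smul (γ u : Cv) (a : ℝ) : GE s γ (fun x => a • u x) = oR (a ^ 2) * GE s γ u := by
  have hd : ∀ x, deriv (fun x => a • u x) x = a • deriv u x := fun x => by
    simp [deriv_fun_const_smul_field]
  have hD : ∀ x, ‖Dg γ (fun x => a • u x) x‖ ^ 2 = a ^ 2 * ‖Dg γ u x‖ ^ 2 := fun x => by
    unfold Dg
    rw [hd, smul_comm, norm_smul, mul_pow, norm_eq_abs, sq_abs]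
  have hn : ∀ x y, ‖a • u y - a • u x‖ ^ 2 = a ^ 2 * ‖u y - u x‖ ^ 2 := fun x y => by
    rw [← smul_sub, norm_smul, mul_pow, norm_eq_abs, sq_abs]
  unfold GE
  rw [I2_cmul (sq_nonneg a) (k := k1 s γ u) (k' := k1 s γ fun x => a • u x), I2_cmul (sq_nonneg a) (k := k2 s γ u) (k' := k2 s γ fun x => a • u x), I2_cmul (sq_nonneg a) (k := k3 s γ u) (k' := k3 s γ fun x => a • u x), I1_cmul (sq_nonneg a) (k := l1 γ u) (k' := l1 γ fun x => a • u x), I1_cmul (sq_nonneg a) (k := l0 γ u) (k' := l0 γ fun x => a • u x)]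
  · ring
  · intro x
    unfold l0
    rw [norm_smul, mul_pow, norm_eq_abs, sq_abs]; ring
  · intro x
    unfold l1
    rw [hD]; ring
  · intro x y
    unfold k3
    rw [hD, hD]; ring
  · intro x y
    unfold k2
    rw [hn]; ring
  · intro x y
    unfold k1 kk
    rw [hd, ← smul_sub, smul_comm, ← smul_sub, norm_smul, mul_pow, norm_eq_abs, sq_abs]; ring
namespace C1Path
theorem quot_mem (P : C1Path s n) {t h : ℝ} (ht : t ∈ U1) (hh : t + h ∈ U1) : InHs s (fun x => h⁻¹ • (P.Γ (t + h) x - P.Γ t x) - P.V t x) :=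
  (((P.mem _ hh).1.sub (P.mem t ht).1).smul _).sub (P.memV t ht)
def reparam (P : C1Path s n) {ψ g : ℝ → ℝ} (hd : ∀ t, HasDerivAt ψ (g t) t) (hg : Continuous g)
    (hm : ∀ t ∈ U1, ψ t ∈ U1) : C1Path s n where
  Γ := fun t => P.Γ (ψ t)
  V := fun t x => g t • P.V (ψ t) x
  mem := fun t ht => P.mem _ (hm t ht)
  memV := fun t ht => (P.memV _ (hm t ht)).smul _
  isDeriv := fun t ht => by
    set L := 𝓝[{h : ℝ | t + h ∈ U1 ∧ h ≠ 0}] 0 with hL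
    set k : ℝ → ℝ := fun h => ψ (t + h) - ψ t with hk
    set W : ℝ → Cv := fun k x => k⁻¹ • (P.Γ (ψ t + k) x - P.Γ (ψ t) x) - P.V (ψ t) x with hW
    set F : ℝ → ℝ := fun k => if k = 0 then 0 else HsNorm s (W k) with hF
    have hF0 : Tendsto F (𝓝[{k | ψ t + k ∈ U1}] 0) (𝓝 0) := by
      rw [Metric.tendsto_nhds]
      intro ε hε
      have h1 := Metric.tendsto_nhds.1 (P.isDeriv (ψ t) (hm t ht)) ε hε
      rw [eventually_nhdsWithin_iff] at h1 ⊢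
      filter_upwards [h1] with q hq hq2
      by_cases h0 : q = 0
      · simp [hF, h0, hε]
      · simp only [hF, h0, if_false]
        exact hq ⟨hq2, h0⟩
    have hLe : L ≤ 𝓝[≠] 0 := nhdsWithin_mono _ fun h hh => hh.2
    have hq : Tendsto (fun h => h⁻¹ * k h) L (𝓝 (g t)) := by
      have := (hasDerivAt_iff_tendsto_slope_zero.1 (hd t)).mono_left hLe
      simpa [hk] using this
    have hk0 : Tendsto k L (𝓝[{k | ψ t + k ∈ U1}] 0) := by
      refine tendsto_nhdsWithin_iff.2 ⟨?_, ?_⟩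
      · have hc : ContinuousAt (fun h => ψ (t + h) - ψ t) 0 := by
          have : ContinuousAt ψ (t + 0) := (hd _).continuousAt
          have h2 : ContinuousAt (fun h : ℝ => t + h) 0 := by fun_prop
          exact (ContinuousAt.comp (f := fun h : ℝ => t + h) this h2).sub continuousAt_const
        have := hc.tendsto
        simp only [add_zero, sub_self] at this
        exact this.mono_left nhdsWithin_le_nhds
      · filter_upwards [self_mem_nhdsWithin] with h hh
        simp only [hk, mem_ofPred_eq, add_sub_cancel]
        exact hm _ hh.1
    have hlim : Tendsto (fun h => 2 * |h⁻¹ * k h| * F (k h) + 2 * |h⁻¹ * k h - g t| * HsNorm s (P.V (ψ t))) L (𝓝 0) := by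
      have a := (hq.abs.const_mul 2).mul (hF0.comp hk0)
      have b := (((hq.sub_const (g t)).abs.const_mul 2).mul_const (HsNorm s (P.V (ψ t))))
      simpa using a.add b
    refine squeeze_zero' (Eventually.of_forall fun _ => HsNorm_nonneg _) ?_ hlim
    filter_upwards [self_mem_nhdsWithin] with h hh
    have hm1 := hm t ht
    have hm2 : ψ t + k h ∈ U1 := by simp only [hk, add_sub_cancel]; exact hm _ hh.1
    by_cases h0 : k h = 0
    · have e : (fun x => h⁻¹ • (P.Γ (ψ (t + h)) x - P.Γ (ψ t) x) - g t • P.V (ψ t) x) = fun x => (0:ℝ) • P.V (ψ t) x + (h⁻¹ * k h - g t) • P.V (ψ t) x := by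
        funext x
        have : ψ (t + h) = ψ t := sub_eq_zero.1 h0
        rw [this, h0]; module
      rw [e]
      refine (HsNorm_comb (P.memV _ hm1) (P.memV _ hm1) _ _).trans (le_of_eq ?_)
      simp [h0]
    · have e : (fun x => h⁻¹ • (P.Γ (ψ (t + h)) x - P.Γ (ψ t) x) - g t • P.V (ψ t) x) = fun x => (h⁻¹ * k h) • W (k h) x + (h⁻¹ * k h - g t) • P.V (ψ t) x := by
        funext x
        have e1 : ψ t + k h = ψ (t + h) := by simp [hk]
        simp only [hW, e1]
        rw [smul_sub (h⁻¹ * k h), smul_smul, mul_assoc, mul_inv_cancel₀ h0]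
        module
      rw [e]
      refine (HsNorm_comb (P.quot_mem hm1 hm2) (P.memV _ hm1) _ _).trans (le_of_eq ?_)
      simp only [hF, hW, h0, if_false]
  contV := fun t ht => by
    have hψ : Tendsto ψ (𝓝[U1] t) (𝓝[U1] (ψ t)) := by
      refine tendsto_nhdsWithin_iff.2 ⟨(hd t).continuousAt.tendsto.mono_left nhdsWithin_le_nhds, ?_⟩
      filter_upwards [self_mem_nhdsWithin] with τ hτ using hm τ hτ
    have hg' : Tendsto g (𝓝[U1] t) (𝓝 (g t)) :=
      hg.continuousAt.tendsto.mono_left nhdsWithin_le_nhds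
    have a := (hg'.abs.const_mul 2).mul ((P.contV (ψ t) (hm t ht)).comp hψ)
    have b := (((hg'.sub_const (g t)).abs.const_mul 2).mul_const (HsNorm s (P.V (ψ t))))
    have hlim := a.add b
    simp only [sub_self, abs_zero, mul_zero, zero_mul, add_zero] at hlim
    refine squeeze_zero' (Eventually.of_forall fun _ => HsNorm_nonneg _) ?_ hlim
    filter_upwards [self_mem_nhdsWithin] with τ hτ
    have e : (fun x => g τ • P.V (ψ τ) x - g t • P.V (ψ t) x) = fun x => g τ • (P.V (ψ τ) x - P.V (ψ t) x) + (g τ - g t) • P.V (ψ t) x := by funext x; module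
    rw [e]
    exact HsNorm_comb ((P.memV _ (hm τ hτ)).sub (P.memV _ (hm t ht))) (P.memV _ (hm t ht)) _ _
def sumP (P Q : C1Path s n)
    (hM : ∀ t ∈ U1, InM s (fun x => P.Γ t x + (Q.Γ t x - Q.Γ 0 x))) : C1Path s n where
  Γ := fun t x => P.Γ t x + (Q.Γ t x - Q.Γ 0 x)
  V := fun t x => P.V t x + Q.V t x
  mem := hM
  memV := fun t ht => (P.memV t ht).add (Q.memV t ht)
  isDeriv := fun t ht => by
    have hlim := ((P.isDeriv t ht).const_mul (2 * |(1:ℝ)|)).add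
      ((Q.isDeriv t ht).const_mul (2 * |(1:ℝ)|))
    simp only [mul_zero, add_zero] at hlim
    refine squeeze_zero' (Eventually.of_forall fun _ => HsNorm_nonneg _) ?_ hlim
    filter_upwards [self_mem_nhdsWithin] with h hh
    refine le_trans (le_of_eq (congrArg _ ?_))
      (HsNorm_comb (P.quot_mem ht hh.1) (Q.quot_mem ht hh.1) 1 1)
    funext x; module
  contV := fun t ht => by
    have hlim := ((P.contV t ht).const_mul (2 * |(1:ℝ)|)).add
      ((Q.contV t ht).const_mul (2 * |(1:ℝ)|))
    simp only [mul_zero, add_zero] at hlim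
    refine squeeze_zero' (Eventually.of_forall fun _ => HsNorm_nonneg _) ?_ hlim
    filter_upwards [self_mem_nhdsWithin] with τ hτ
    refine le_trans (le_of_eq (congrArg _ ?_))
      (HsNorm_comb ((P.memV τ hτ).sub (P.memV t ht)) ((Q.memV τ hτ).sub (Q.memV t ht)) 1 1)
    funext x; module
theorem spd_reparam (P : C1Path s n) {ψ g : ℝ → ℝ} (hd : ∀ t, HasDerivAt ψ (g t) t) (hg : Continuous g) (hm : ∀ t ∈ U1, ψ t ∈ U1) {t : ℝ} (ht : t ∈ U1) : (P.reparam hd hg hm).spd t = oR |g t| * P.spd (ψ t) := by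
  unfold spd reparam
  simp only
  rw [cl_eq ht, cl_eq (hm t ht), GE_smul, ENNReal.mul_rpow_of_nonneg _ _ (by norm_num), ENNReal.ofReal_rpow_of_nonneg (sq_nonneg _) (by norm_num), ← sqrt_eq_rpow, sqrt_sq_eq_abs]
theorem len_reparam (hs : 3/2 < s) (P : C1Path s n) {ψ g : ℝ → ℝ} (hd : ∀ t, HasDerivAt ψ (g t) t) (hg : Continuous g) (hm : ∀ t ∈ U1, ψ t ∈ U1) (hmon : Monotone ψ ∨ Antitone ψ) : pathLen (P.reparam hd hg hm) ≤ pathLen P := by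
  refine (ENNReal.ofReal_le_ofReal_iff (P.len_eq hs).2).1 ?_
  rw [← ((P.reparam hd hg hm).len_eq hs).1, ← (P.len_eq hs).1]
  have hsub : ψ '' Icc 0 1 ⊆ Icc 0 1 := by rintro _ ⟨t, ht, rfl⟩; exact hm t ht
  rw [restrict_Ioc_eq_restrict_Icc]
  refine le_trans ?_ (lintegral_mono_set hsub)
  have hdw : ∀ x ∈ U1, HasDerivWithinAt ψ (g x) (Icc 0 1) x :=
    fun x _ => (hd x).hasDerivWithinAt
  rcases hmon with h | h
  · rw [lintegral_image_eq_lintegral_deriv_mul_of_monotoneOn measurableSet_Icc hdw (h.monotoneOn _)]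
    refine le_of_eq (setLIntegral_congr_fun measurableSet_Icc fun t ht => ?_)
    rw [spd_reparam _ _ _ _ ht, abs_of_nonneg]
    rw [← (hd t).deriv]; exact h.deriv_nonneg
  · rw [lintegral_image_eq_lintegral_deriv_mul_of_antitoneOn measurableSet_Icc hdw (h.antitoneOn _)]
    refine le_of_eq (setLIntegral_congr_fun measurableSet_Icc fun t ht => ?_)
    rw [spd_reparam _ _ _ _ ht, abs_of_nonpos]
    rw [← (hd t).deriv]; exact h.deriv_nonpos
end C1Path
theorem d_refl (hs : 3/2 < s) {γ : Cv} (hγ : InM s γ) : geodDist s γ γ = 0 := by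
  refine le_antisymm ((dist_le_of (C1Path.const hγ) rfl rfl).trans ?_) zero_le
  refine (len_le hs _ le_rfl (B := 0) fun t ht => ?_).trans (by simp)
  have := GE_smul (s := s) γ (fun _ => (0 : En n)) 0
  simp only [smul_zero] at this
  simp only [C1Path.const]
  rw [this]; simp
theorem d_symm_le (hs : 3/2 < s) (a b : Cv) : geodDist s b a ≤ geodDist s a b := by
  refine le_iInf₂ fun P hP => ?_
  have hd : ∀ t : ℝ, HasDerivAt (fun t : ℝ => 1 - t) ((fun _ => (-1:ℝ)) t) t := fun t => by
    simpa using (hasDerivAt_id t).const_sub 1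
  have hm : ∀ t ∈ U1, (fun t : ℝ => 1 - t) t ∈ U1 := fun t ht =>
    ⟨by simp only; linarith [ht.2], by simp only; linarith [ht.1]⟩
  refine (dist_le_of (P.reparam hd continuous_const hm) ?_ ?_).trans
    (ofReal_le_ofReal (P.len_reparam hs hd continuous_const hm
      (Or.inr fun x y h => by simp only; linarith)))
  · simp only [C1Path.reparam, sub_zero]; exact hP.2
  · simp only [C1Path.reparam, sub_self]; exact hP.1
theorem st_hd (b t : ℝ) : HasDerivAt (fun t => smoothTransition (2 * t - b))
    (deriv (fun t => smoothTransition (2 * t - b)) t) t ∧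
    Continuous (deriv (fun t => smoothTransition (2 * t - b))) := by
  have h : ContDiff ℝ 1 (fun t => smoothTransition (2 * t - b)) :=
    (smoothTransition.contDiff (n := 1)).comp (by fun_prop)
  exact ⟨(h.differentiable one_ne_zero t).hasDerivAt, h.continuous_deriv le_rfl⟩
theorem d_tri (hs : 3/2 < s) (a b c : Cv) : geodDist s a c ≤ geodDist s a b + geodDist s b c := by
  unfold geodDist
  refine ENNReal.le_iInf₂_add_iInf₂ fun P hP Q hQ => ?_
  have hm : ∀ b : ℝ, ∀ t ∈ U1, smoothTransition (2 * t - b) ∈ U1 :=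
    fun b t _ => ⟨smoothTransition.nonneg _, smoothTransition.le_one _⟩
  have hmon : ∀ b : ℝ, Monotone (fun t => smoothTransition (2 * t - b)) := fun b x y h =>
    smoothTransition.monotone (by linarith)
  set P' := P.reparam (fun t => (st_hd 0 t).1) (st_hd 0 0).2 (hm 0) with hP'
  set Q' := Q.reparam (fun t => (st_hd 1 t).1) (st_hd 1 0).2 (hm 1) with hQ'
  have lP : pathLen P' ≤ pathLen P := P.len_reparam hs _ _ _ (Or.inl (hmon 0))
  have lQ : pathLen Q' ≤ pathLen Q := Q.len_reparam hs _ _ _ (Or.inl (hmon 1))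
  have Q0 : ∀ t ≤ (1/2:ℝ), Q'.Γ t = b := fun t ht => by
    rw [← hQ.1]
    simp only [hQ', C1Path.reparam]
    rw [smoothTransition.zero_of_nonpos (by linarith)]
  have P1 : ∀ t, (1/2:ℝ) ≤ t → P'.Γ t = b := fun t ht => by
    rw [← hP.2]
    simp only [hP', C1Path.reparam]
    rw [smoothTransition.one_of_one_le (by linarith)]
  have E1 : ∀ t ≤ (1/2:ℝ), (fun x => P'.Γ t x + (Q'.Γ t x - Q'.Γ 0 x)) = P'.Γ t := fun t ht => by
    funext x; rw [Q0 t ht, Q0 0 (by norm_num)]; simp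
  have E2 : ∀ t, (1/2:ℝ) ≤ t → (fun x => P'.Γ t x + (Q'.Γ t x - Q'.Γ 0 x)) = Q'.Γ t := fun t ht => by
    funext x; rw [P1 t ht, Q0 0 (by norm_num)]; simp
  have hM : ∀ t ∈ U1, InM s (fun x => P'.Γ t x + (Q'.Γ t x - Q'.Γ 0 x)) := fun t ht => by
    rcases le_total t (1/2) with h | h
    · rw [E1 t h]; exact P'.mem t ht
    · rw [E2 t h]; exact Q'.mem t ht
  have VQ : ∀ t < (1/2:ℝ), Q'.V t = fun _ => 0 := fun t ht => by
    funext x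
    have : deriv (fun t => smoothTransition (2 * t - 1)) t = 0 := by
      have : (fun t => smoothTransition (2 * t - 1)) =ᶠ[𝓝 t] fun _ => 0 := by
        filter_upwards [Iio_mem_nhds ht] with q hq
        exact smoothTransition.zero_of_nonpos (by linarith [mem_Iio.1 hq])
      rw [this.deriv_eq]; simp
    simp only [hQ', C1Path.reparam, this, zero_smul]
  have VP : ∀ t, (1/2:ℝ) < t → P'.V t = fun _ => 0 := fun t ht => by
    funext x
    have : deriv (fun t => smoothTransition (2 * t - 0)) t = 0 := by
      have : (fun t => smoothTransition (2 * t - 0)) =ᶠ[𝓝 t] fun _ => 1 := by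
        filter_upwards [Ioi_mem_nhds ht] with q hq
        exact smoothTransition.one_of_one_le (by linarith [mem_Ioi.1 hq])
      rw [this.deriv_eq]; simp
    simp only [hP', C1Path.reparam, this, zero_smul]
  set R := C1Path.sumP P' Q' hM with hR
  have hsp : ∀ᵐ t ∂(volume.restrict (Ioc (0:ℝ) 1)), R.spd t ≤ P'.spd t + Q'.spd t := by
    have hne : ∀ᵐ t : ℝ ∂(volume.restrict (Ioc (0:ℝ) 1)), t ≠ 1/2 :=
      ae_restrict_of_ae (Measure.ae_ne volume (1/2))
    filter_upwards [hne, ae_restrict_mem measurableSet_Ioc] with t h1 h2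
    have ht : t ∈ U1 := ⟨h2.1.le, h2.2⟩
    have key : R.spd t = GE s (fun x => P'.Γ t x + (Q'.Γ t x - Q'.Γ 0 x))
        (fun x => P'.V t x + Q'.V t x) ^ (1/2:ℝ) := by
      unfold C1Path.spd
      rw [cl_eq ht, hR]; rfl
    rw [key]
    rcases lt_or_gt_of_ne h1 with h | h
    · rw [E1 t h.le, VQ t h]
      simp only [add_zero]
      refine le_trans (le_of_eq ?_) le_self_add
      unfold C1Path.spd
      rw [cl_eq ht]
    · rw [E2 t h.le, VP t h]
      simp only [zero_add]
      refine le_trans (le_of_eq ?_) le_add_self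
      unfold C1Path.spd
      rw [cl_eq ht]
  have hlen : oR (pathLen R) ≤ oR (pathLen P') + oR (pathLen Q') := by
    rw [← (R.len_eq hs).1, ← (P'.len_eq hs).1, ← (Q'.len_eq hs).1, ← lintegral_add_left (P'.spd_meas hs)]
    exact lintegral_mono_ae hsp
  refine (dist_le_of R ?_ ?_).trans (hlen.trans (add_le_add (ofReal_le_ofReal lP)
    (ofReal_le_ofReal lQ)))
  · refine (E1 0 (by norm_num)).trans ?_
    rw [← hP.1]
    simp only [hP', C1Path.reparam]
    rw [smoothTransition.zero_of_nonpos (by norm_num)]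
  · refine (E2 1 (by norm_num)).trans ?_
    rw [← hQ.2]
    simp only [hQ', C1Path.reparam]
    rw [smoothTransition.one_of_one_le (by norm_num)]
theorem d_def (hs0 : 3/2 < s) (hs2 : s < 2) {a b : Cv} (ha : InM s a) (h : geodDist s a b = 0) : a = b := by
  obtain ⟨c, K, A, hc, hA, hg⟩ := ha.good hs0
  have hfin := C1Path.E_fin hs0 ha
  have hK : 0 < K := hc.trans_le ((hg.lb 0).trans (hg.ub 0))
  set Λ0 := (I2 (k1 s a a)).toReal + 1 with hΛ0
  have hΛp : 0 < Λ0 := by positivity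
  have hΛ : I2 (k1 s a a) ≤ oR Λ0 := by
    refine (ENNReal.le_ofReal_iff_toReal_le ?_ hΛp.le).2 (by linarith)
    exact hfin.ne
  obtain ⟨Λ, c', K', hΛ', -, -, hu⟩ := unif (n := n) hs0 hs2 hΛp hc hK
  obtain ⟨C, hC, hest⟩ := C1Path.est1 (n := n) hs0 hs2 hΛ'
  funext x
  have : ‖b x - a x‖ ≤ 0 := by
    refine le_of_forall_pos_le_add fun ε hε => ?_
    obtain ⟨P, h0, h1, hl⟩ := ex_path (s := s) (a := a) (b := b) (ε := min 1 (ε / C))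
      (by rw [h, ENNReal.ofReal_pos]; positivity)
    have hP := hu P (hl.le.trans (min_le_left _ _)) (by rw [h0]; exact hΛ)
      (by rw [h0]; exact fun x => ⟨hg.lb x, hg.ub x⟩)
    have := (hest P (fun t ht => (hP t ht).1) 1 (by simp) x).1
    rw [h0, h1] at this
    have h2 : pathLen P ≤ ε / C := hl.le.trans (min_le_right _ _)
    rw [le_div_iff₀ hC] at h2
    linarith
  exact (sub_eq_zero.1 (norm_le_zero_iff.1 this)).symm
end Proof

/-- metric completeness: `(𝓜, d_G)` is a complete extended metric
space: `d_G` is reflexive, symmetric, satisfies the triangle inequality, is definite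
(possibly taking the value `∞`), and every `d_G`-Cauchy sequence in `𝓜` converges in
`d_G` to a limit in `𝓜`. -/
theorem statement17 (s : ℝ) (hs : s ∈ Set.Ioo (3 / 2 : ℝ) 2) (n : ℕ) (hn : 2 ≤ n) :
    (∀ γ : ℝ → En n, InM s γ → geodDist s γ γ = 0) ∧
    (∀ γ₀ γ₁ : ℝ → En n, InM s γ₀ → InM s γ₁ →
      geodDist s γ₀ γ₁ = geodDist s γ₁ γ₀) ∧
    (∀ γ₀ γ₁ γ₂ : ℝ → En n, InM s γ₀ → InM s γ₁ → InM s γ₂ →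
      geodDist s γ₀ γ₂ ≤ geodDist s γ₀ γ₁ + geodDist s γ₁ γ₂) ∧
    (∀ γ₀ γ₁ : ℝ → En n, InM s γ₀ → InM s γ₁ → geodDist s γ₀ γ₁ = 0 → γ₀ = γ₁) ∧
    (∀ γk : ℕ → ℝ → En n, (∀ k, InM s (γk k)) →
      (∀ ε : ℝ, 0 < ε → ∃ N : ℕ, ∀ m ≥ N, ∀ l ≥ N,
        geodDist s (γk m) (γk l) < ENNReal.ofReal ε) →
      ∃ γ : ℝ → En n, InM s γ ∧
        Tendsto (fun k => geodDist s (γk k) γ) atTop (𝓝 0)) := by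
  have h1 := hs.1
  exact ⟨fun γ hγ => d_refl h1 hγ,
    fun a b _ _ => le_antisymm (d_symm_le h1 b a) (d_symm_le h1 a b),
    fun a b c _ _ _ => d_tri h1 a b c, fun a b ha _ h => d_def h1 hs.2 ha h,
    fun γk hm hC => complete h1 hs.2 hm hC⟩
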